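/- arXiv:1210.6485 — 3 statements merged into one kernel-verified Lean document; each statement's English description precedes it below -/
import Mathlib

section
/- Every subcontinuum of a local dendrite is a local dendrite. -/
open Topology

/-- A continuum: a nonempty compact connected metrizable topological space. -/
def IsContinuum (X : Type*) [TopologicalSpace X] : Prop :=
  Nonempty X ∧ CompactSpace X ∧ ConnectedSpace X ∧ TopologicalSpace.MetrizableSpace X

/-- A simple closed curve in `X`: a subspace homeomorphic to the circle. -/
def IsSimpleClosedCurve {X : Type*} [TopologicalSpace X] (S : Set X) : Prop :=
  Nonempty (S ≃ₜ AddCircle (1 : ℝ))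

/-- A dendrite: a locally connected continuum containing no simple closed curve. -/
def IsDendrite (X : Type*) [TopologicalSpace X] : Prop :=
  IsContinuum X ∧ LocallyConnectedSpace X ∧ ∀ S : Set X, ¬ IsSimpleClosedCurve S

/-- A local dendrite: a continuum each of whose points has a neighborhood
that is a dendrite. -/
def IsLocalDendrite (X : Type*) [TopologicalSpace X] : Prop :=
  IsContinuum X ∧ ∀ x : X, ∃ N : Set X, N ∈ 𝓝 x ∧ IsDendrite N

/-- A branch point of `X`: a point whose complement has at least three
connected components. -/
def IsBranchPoint {X : Type*} [TopologicalSpace X] (x : X) : Prop :=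
  ∃ u v w : ConnectedComponents (↥({x}ᶜ : Set X)), u ≠ v ∧ u ≠ w ∧ v ≠ w

/-- `X ∖ {x}` has countably infinitely many connected components
(i.e. there are ℵ₀ branches at `x`). -/
def HasAlephNullBranchesAt (X : Type*) [TopologicalSpace X] (x : X) : Prop :=
  Countable (ConnectedComponents (↥({x}ᶜ : Set X))) ∧
    Infinite (ConnectedComponents (↥({x}ᶜ : Set X)))


open Set Filter

section LocallyPathConnected

variable {X : Type*} [MetricSpace X]

/-- A possibly discontinuous path `f : ℝ → X` in `C`, eventually constant near the ends of `[a, b]`,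
going from `x` to `y`, all of whose jumps are smaller than `δ`. -/
structure IsJumpPath (δ : ℝ) (C : Set X) (a b : ℝ) (x y : X) (f : ℝ → X) : Prop where
  mem : ∀ t, f t ∈ C
  exists_modulus : ∃ η > 0, (∀ t < a + η, f t = x) ∧ (∀ t > b - η, f t = y) ∧
    ∀ s t, |s - t| < η → dist (f s) (f t) < δ

theorem IsJumpPath.concat {δ : ℝ} {C : Set X} {a b c : ℝ} {x y z : X} {f g : ℝ → X}
    (hab : a < b) (hbc : b < c)
    (hf : IsJumpPath δ C a b x y f) (hg : IsJumpPath δ C b c y z g) :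
    IsJumpPath δ C a c x z (fun t => if t ≤ b then f t else g t) := by
  obtain ⟨hfC, η, hη, hf0, hf1, hfd⟩ := hf
  obtain ⟨hgC, θ, hθ, hg0, hg1, hgd⟩ := hg
  refine ⟨fun t => by split_ifs <;> simp [hfC, hgC],
    min (min η θ) (min (b - a) (c - b)), by simp [hη, hθ, hab, hbc], ?_, ?_, ?_⟩
  · intro t ht
    have h1 : min (min η θ) (min (b - a) (c - b)) ≤ η := by simp
    have h2 : min (min η θ) (min (b - a) (c - b)) ≤ b - a := by simp
    rw [if_pos (by linarith)]
    exact hf0 t (by linarith)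
  · intro t ht
    have h1 : min (min η θ) (min (b - a) (c - b)) ≤ θ := by simp
    have h2 : min (min η θ) (min (b - a) (c - b)) ≤ c - b := by simp
    rw [if_neg (by linarith)]
    exact hg1 t (by linarith)
  · have key : ∀ s t, s ≤ t → |s - t| < min (min η θ) (min (b - a) (c - b)) →
        dist (if s ≤ b then f s else g s) (if t ≤ b then f t else g t) < δ := by
      intro s t hst hd
      have h1 : |s - t| < η := hd.trans_le (by simp)
      have h2 : |s - t| < θ := hd.trans_le (by simp)
      by_cases hs : s ≤ b <;> by_cases ht : t ≤ b
      · simpa [hs, ht] using hfd s t h1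
      · rw [if_pos hs, if_neg ht]
        have := abs_lt.1 h1
        have := abs_lt.1 h2
        rw [hf1 s (by linarith), ← hf1 b (by linarith), hf1 b (by linarith), ← hg0 b (by linarith)]
        exact hgd _ _ (by rw [abs_lt]; constructor <;> linarith)
      · exact absurd (hst.trans ht) hs
      · simpa [hs, ht] using hgd s t h2
    intro s t hd
    rcases le_total s t with h | h
    · exact key s t h hd
    · rw [dist_comm]
      exact key t s h (by rwa [abs_sub_comm])

theorem IsPreconnected.exists_isJumpPath {C : Set X} (hC : IsPreconnected C) {δ : ℝ} (hδ : 0 < δ)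
    {x y : X} (hx : x ∈ C) (hy : y ∈ C) {a b : ℝ} (hab : a < b) :
    ∃ f, IsJumpPath δ C a b x y f := by
  have := hC.induction₂
    (fun x y => x ∈ C → y ∈ C → ∀ a b : ℝ, a < b → ∃ f, IsJumpPath δ C a b x y f)
    ?_ ?_ ?_ hx hy
  · exact this hx hy a b hab
  · intro x _
    filter_upwards [mem_nhdsWithin_of_mem_nhds (Metric.ball_mem_nhds x hδ)] with y hy hx hyC a b hab
    refine ⟨fun t => if t ≤ (a + b) / 2 then x else y, fun t => by split_ifs <;> assumption,
      (b - a) / 2, by linarith, ?_, ?_, ?_⟩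
    · intro t ht
      rw [if_pos (by linarith)]
    · intro t ht
      rw [if_neg (by linarith)]
    · intro s t _
      split_ifs
      · simpa using hδ
      · simpa [dist_comm] using hy
      · simpa using hy
      · simpa using hδ
  · intro x y z _ hy _ hxy hyz hx hz a b hab
    obtain ⟨f, hf⟩ := hxy hx hy a ((a + b) / 2) (by linarith)
    obtain ⟨g, hg⟩ := hyz hy hz ((a + b) / 2) b (by linarith)
    exact ⟨_, hf.concat (by linarith) (by linarith) hg⟩
  · intro x y _ _ hxy hy hx a b hab
    obtain ⟨f, hfC, η, hη, hf0, hf1, hfd⟩ := hxy hx hy a b hab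
    refine ⟨fun t => f (a + b - t), fun t => hfC _, η, hη, fun t ht => hf1 _ (by linarith),
      fun t ht => hf0 _ (by linarith), fun s t hst => hfd _ _ ?_⟩
    rw [abs_sub_comm]
    convert hst using 2
    ring

theorem exists_isJumpPath_near {ε δ δ' η : ℝ} (hη : 0 < η) (hδ' : 0 < δ')
    (hδ : ∀ x y : X, dist x y < δ → ∃ C : Set X, IsPreconnected C ∧ x ∈ C ∧ y ∈ C ∧
      C ⊆ Metric.ball x ε)
    {f : ℝ → X} (hf : ∀ s t, |s - t| < η → dist (f s) (f t) < δ) {a b : ℝ} (hab : a < b) :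
    ∃ g, IsJumpPath δ' univ a b (f a) (f b) g ∧ ∀ t ∈ Icc a b, dist (g t) (f t) < ε + δ := by
  have key : ∀ n : ℕ, ∀ a b : ℝ, a < b → b - a < 2 ^ n * η →
      ∃ g, IsJumpPath δ' univ a b (f a) (f b) g ∧ ∀ t ∈ Icc a b, dist (g t) (f t) < ε + δ := by
    intro n
    induction n with
    | zero =>
      intro a b hab hb
      obtain ⟨C, hC, ha, hb, hCb⟩ := hδ (f a) (f b)
        (hf a b (by rw [abs_lt]; constructor <;> linarith))
      obtain ⟨g, hg⟩ := hC.exists_isJumpPath hδ' ha hb hab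
      refine ⟨g, ⟨fun _ => trivial, hg.2⟩, fun t ht => ?_⟩
      have h1 : dist (g t) (f a) < ε := hCb (hg.1 t)
      have h2 := hf a t (by rw [abs_lt]; constructor <;> linarith [ht.1, ht.2])
      linarith [dist_triangle (g t) (f a) (f t)]
    | succ n ih =>
      intro a b hab hb
      rw [pow_succ] at hb
      obtain ⟨g, hg, hgf⟩ := ih a ((a + b) / 2) (by linarith) (by linarith)
      obtain ⟨h, hh, hhf⟩ := ih ((a + b) / 2) b (by linarith) (by linarith)
      refine ⟨_, hg.concat (by linarith) (by linarith) hh, fun t ht => ?_⟩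
      split_ifs with hc
      · exact hgf t ⟨ht.1, hc⟩
      · exact hhf t ⟨by linarith, ht.2⟩
  obtain ⟨n, hn⟩ := pow_unbounded_of_one_lt ((b - a) / η) (one_lt_two)
  exact key n a b hab (by rwa [div_lt_iff₀ hη] at hn)

theorem exists_isPreconnected_subset_ball [CompactSpace X] [LocallyConnectedSpace X] {ε : ℝ}
    (hε : 0 < ε) :
    ∃ δ > 0, ∀ x y : X, dist x y < δ → ∃ C : Set X, IsPreconnected C ∧ x ∈ C ∧ y ∈ C ∧
      C ⊆ Metric.ball x ε := by
  choose V hV hVc hVs using fun x : X => locallyConnectedSpace_iff_connected_subsets.1 ‹_› x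
    (Metric.ball x (ε / 2)) (Metric.ball_mem_nhds x (by linarith))
  obtain ⟨δ, hδ, H⟩ := lebesgue_number_lemma_of_metric (s := univ) (c := fun x => interior (V x))
    isCompact_univ (fun _ => isOpen_interior)
    (fun x _ => mem_iUnion.2 ⟨x, mem_interior_iff_mem_nhds.2 (hV x)⟩)
  refine ⟨δ, hδ, fun x y hxy => ?_⟩
  obtain ⟨z, hz⟩ := H x trivial
  have hx : x ∈ V z := interior_subset (hz (Metric.mem_ball_self hδ))
  refine ⟨V z, hVc z, hx, interior_subset (hz (by rwa [Metric.mem_ball, dist_comm])), ?_⟩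
  intro w hw
  have h1 : dist w z < ε / 2 := hVs z hw
  have h2 : dist x z < ε / 2 := hVs z hx
  have := dist_triangle_right w x z
  rw [Metric.mem_ball]
  linarith

theorem exists_joinedIn_ball [CompactSpace X] [LocallyConnectedSpace X] {ε : ℝ} (hε : 0 < ε) :
    ∃ δ > 0, ∀ x y : X, dist x y < δ → JoinedIn (Metric.ball x ε) x y := by
  -- scale `e n` controls the `n`-th modification, `d n` the jumps of the `n`-th path
  set e : ℕ → ℝ := fun n => ε / 16 / 2 ^ n with he
  have hepos : ∀ n, 0 < e n := fun n => by positivity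
  have hex : ∀ n, ∃ δ, 0 < δ ∧ δ ≤ e n ∧ ∀ x y : X, dist x y < δ →
      ∃ C : Set X, IsPreconnected C ∧ x ∈ C ∧ y ∈ C ∧ C ⊆ Metric.ball x (e n) := by
    intro n
    obtain ⟨δ, hδ, H⟩ := exists_isPreconnected_subset_ball (X := X) (hepos n)
    exact ⟨min δ (e n), lt_min hδ (hepos n), min_le_right _ _,
      fun x y h => H x y (h.trans_le (min_le_left _ _))⟩
  choose d hd0 hde hd using hex
  refine ⟨d 0, hd0 0, fun x y hxy => ?_⟩
  obtain ⟨C, hC, hxC, hyC, hCb⟩ := hd 0 x y hxy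
  obtain ⟨f₀, hf₀⟩ := hC.exists_isJumpPath (hd0 0) hxC hyC (zero_lt_one' ℝ)
  have step : ∀ n (f : {f // IsJumpPath (d n) univ 0 1 x y f}),
      ∃ g : {g // IsJumpPath (d (n + 1)) univ 0 1 x y g}, ∀ t, dist (f.1 t) (g.1 t) ≤ 2 * e n := by
    rintro n ⟨f, _, η, hη, hf0, hf1, hfd⟩
    obtain ⟨g, hg, hgf⟩ := exists_isJumpPath_near hη (hd0 (n + 1)) (hd n) hfd (zero_lt_one' ℝ)
    rw [hf0 0 (by linarith), hf1 1 (by linarith)] at hg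
    refine ⟨⟨g, hg⟩, fun t => ?_⟩
    obtain ⟨θ, hθ, hg0, hg1, -⟩ := hg.2
    dsimp only
    rcases lt_or_ge t 0 with h | h
    · rw [hf0 t (by linarith), hg0 t (by linarith), dist_self]
      linarith [hepos n]
    rcases lt_or_ge 1 t with h' | h'
    · rw [hf1 t (by linarith), hg1 t (by linarith), dist_self]
      linarith [hepos n]
    · rw [dist_comm]
      linarith [hgf t ⟨h, h'⟩, hde n]
  choose next hnext using step
  let F : ∀ n, {f // IsJumpPath (d n) univ 0 1 x y f} := fun n =>
    Nat.rec ⟨f₀, fun _ => trivial, hf₀.2⟩ (fun n f => next n f) n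
  have hF : ∀ t n, dist ((F n).1 t) ((F (n + 1)).1 t) ≤ (ε / 4) / 2 / 2 ^ n := by
    intro t n
    refine (hnext n (F n) t).trans (le_of_eq ?_)
    simp only [he]
    ring
  choose f hf using fun t => cauchySeq_tendsto_of_complete (cauchySeq_of_le_geometric_two (hF t))
  have hdist : ∀ t n, dist ((F n).1 t) (f t) ≤ (ε / 4) / 2 ^ n := fun t n =>
    dist_le_of_le_geometric_two_of_tendsto (hF t) (hf t) n
  have hsmall : Tendsto (fun n : ℕ => (ε / 4) / 2 ^ n) atTop (𝓝 0) := by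
    simpa [div_eq_mul_inv] using (tendsto_pow_atTop_nhds_zero_of_lt_one (r := (2 : ℝ)⁻¹)
      (by norm_num) (by norm_num)).const_mul (ε * 4⁻¹)
  have hcont : Continuous f := by
    rw [Metric.continuous_iff]
    intro t r hr
    obtain ⟨n, hn⟩ := (hsmall.eventually (gt_mem_nhds (show 0 < r / 3 by linarith))).exists
    obtain ⟨-, η, hη, -, -, hfd⟩ := (F n).2
    refine ⟨η, hη, fun s hs => ?_⟩
    have h1 := hfd s t hs
    have h2 := hdist s n
    have h3 := hdist t n
    have h4 : d n ≤ (ε / 4) / 2 ^ n := (hde n).trans (by simp only [he]; gcongr; linarith)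
    have h5 := dist_triangle4 (f s) ((F n).1 s) ((F n).1 t) (f t)
    rw [dist_comm (f s) ((F n).1 s)] at h5
    linarith
  have hconst : ∀ t z, (∀ n, (F n).1 t = z) → f t = z := fun t z hz =>
    tendsto_nhds_unique (hf t) (by simp [hz])
  refine JoinedIn.ofLine hcont.continuousOn (hconst 0 x fun n => ?_) (hconst 1 y fun n => ?_) ?_
  · obtain ⟨-, η, hη, h0, -, -⟩ := (F n).2
    exact h0 0 (by linarith)
  · obtain ⟨-, η, hη, -, h1, -⟩ := (F n).2
    exact h1 1 (by linarith)
  · rintro _ ⟨t, -, rfl⟩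
    have h1 : dist (f₀ t) (f t) ≤ ε / 4 / 2 ^ 0 := hdist t 0
    have h2 : dist (f₀ t) x < ε / 16 / 2 ^ 0 := hCb (hf₀.1 t)
    rw [Metric.mem_ball]
    linarith [dist_triangle_left (f t) x (f₀ t)]

theorem LocallyConnectedSpace.locallyPathConnectedSpace [CompactSpace X]
    [LocallyConnectedSpace X] : LocallyPathConnectedSpace X where
  path_connected_basis x := by
    refine ⟨fun s => ⟨fun hs => ?_, fun ⟨t, ht, hts⟩ => mem_of_superset ht.1 hts⟩⟩
    obtain ⟨ε, hε, hs⟩ := Metric.mem_nhds_iff.1 hs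
    obtain ⟨δ, hδ, H⟩ := exists_joinedIn_ball (X := X) hε
    refine ⟨pathComponentIn (Metric.ball x ε) x, ⟨?_, isPathConnected_pathComponentIn
      (Metric.mem_ball_self hε)⟩, pathComponentIn_subset.trans hs⟩
    filter_upwards [Metric.ball_mem_nhds x hδ] with y hy
    exact H x y (by rwa [dist_comm])

end LocallyPathConnected

section Arcs

variable {X : Type*}

/-- The closed subsets of `[0, 1]` containing both endpoints such that `f` takes equal values at
the two ends of every complementary gap. -/
def gapCompatibleSets (f : ℝ → X) : Set (Set ℝ) :=
  {K | IsClosed K ∧ K ⊆ Icc 0 1 ∧ 0 ∈ K ∧ 1 ∈ K ∧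
    ∀ a ∈ K, ∀ b ∈ K, a < b → (∀ c ∈ K, c ≤ a ∨ b ≤ c) → f a = f b}

theorem diff_Ioo_mem_gapCompatibleSets {f : ℝ → X} {K : Set ℝ} (hK : K ∈ gapCompatibleSets f)
    {s t : ℝ} (hs : s ∈ K) (ht : t ∈ K) (hf : f s = f t) :
    K \ Ioo s t ∈ gapCompatibleSets f := by
  obtain ⟨hKcl, hK01, hK0, hK1, hKgap⟩ := hK
  refine ⟨hKcl.sdiff isOpen_Ioo, sdiff_subset.trans hK01,
    ⟨hK0, fun h => absurd (hK01 hs).1 (not_le.2 h.1)⟩,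
    ⟨hK1, fun h => absurd (hK01 ht).2 (not_le.2 h.2)⟩, fun a ha b hb hab hgap => ?_⟩
  by_cases h : ∀ c ∈ K, c ≤ a ∨ b ≤ c
  · exact hKgap a ha.1 b hb.1 hab h
  push Not at h
  obtain ⟨c, hcK, hac, hcb⟩ := h
  have hc : c ∈ Ioo s t := by
    by_contra hc
    rcases hgap c ⟨hcK, hc⟩ with h | h <;> linarith
  have hsa : s ≤ a := (hgap s ⟨hs, fun h => lt_irrefl _ h.1⟩).resolve_right
    (by linarith [hc.1])
  have htb : b ≤ t := (hgap t ⟨ht, fun h => lt_irrefl _ h.2⟩).resolve_left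
    (by linarith [hc.2])
  have has : a = s := by
    by_contra hne
    exact ha.2 ⟨lt_of_le_of_ne hsa (Ne.symm hne), by linarith⟩
  have hbt : b = t := by
    by_contra hne
    exact hb.2 ⟨by linarith, lt_of_le_of_ne htb hne⟩
  rw [has, hbt, hf]

variable [MetricSpace X]

theorem sInter_mem_gapCompatibleSets {f : ℝ → X} (hf : Continuous f) {c : Set (Set ℝ)}
    (hc : c ⊆ gapCompatibleSets f) (hchain : IsChain (· ⊆ ·) c) (hne : c.Nonempty) :
    ⋂₀ c ∈ gapCompatibleSets f := by
  obtain ⟨K₁, hK₁⟩ := hne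
  refine ⟨isClosed_sInter fun K hK => (hc hK).1, (sInter_subset_of_mem hK₁).trans (hc hK₁).2.1,
    fun K hK => (hc hK).2.2.1, fun K hK => (hc hK).2.2.2.1, fun a ha b hb hab hgap => ?_⟩
  by_contra hne
  obtain ⟨ε, hε, hεab, hsep⟩ : ∃ ε > 0, ε ≤ (b - a) / 3 ∧ ∀ s t, |s - a| ≤ ε → |t - b| ≤ ε →
      f s ≠ f t := by
    have hev : ∀ᶠ p : ℝ × ℝ in 𝓝 (a, b), f p.1 ≠ f p.2 :=
      (isOpen_ne_fun (hf.comp continuous_fst) (hf.comp continuous_snd)).mem_nhds hne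
    obtain ⟨ε, hε, H⟩ := Metric.nhds_basis_closedBall.eventually_iff.1 hev
    refine ⟨min ε ((b - a) / 3), lt_min hε (by linarith), min_le_right _ _, fun s t hs ht => ?_⟩
    refine @H (s, t) ?_
    rw [Metric.mem_closedBall, Prod.dist_eq]
    exact max_le (hs.trans (min_le_left _ _)) (ht.trans (min_le_left _ _))
  obtain ⟨K, hKc, hK⟩ : ∃ K ∈ c, ¬ (K ∩ Icc (a + ε) (b - ε)).Nonempty := by
    by_contra! hcon
    have : Nonempty c := ⟨⟨K₁, hK₁⟩⟩
    obtain ⟨z, hz⟩ := IsCompact.nonempty_iInter_of_directed_nonempty_isCompact_isClosed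
      (fun K : c => K.1 ∩ Icc (a + ε) (b - ε))
      (by
        intro K L
        rcases hchain.total K.2 L.2 with h | h
        · exact ⟨K, subset_rfl, inter_subset_inter_left _ h⟩
        · exact ⟨L, inter_subset_inter_left _ h, subset_rfl⟩)
      (fun K => hcon K.1 K.2)
      (fun K => isCompact_Icc.inter_left (hc K.2).1)
      (fun K => (hc K.2).1.inter isClosed_Icc)
    rw [mem_iInter] at hz
    have hz1 := (hz ⟨K₁, hK₁⟩).2
    rcases hgap z (fun K hK => (hz ⟨K, hK⟩).1) with h | h
    · linarith [hz1.1]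
    · linarith [hz1.2]
  obtain ⟨hKcl, hK01, hK0, hK1, hKgap⟩ := hc hKc
  obtain ⟨a', ha', hamax⟩ := (isCompact_Icc.inter_left hKcl : IsCompact (K ∩ Icc a (a + ε)))
    |>.exists_isGreatest ⟨a, ha K hKc, le_rfl, by linarith⟩
  obtain ⟨b', hb', hbmin⟩ := (isCompact_Icc.inter_left hKcl : IsCompact (K ∩ Icc (b - ε) b))
    |>.exists_isLeast ⟨b, hb K hKc, by linarith, le_rfl⟩
  obtain ⟨ha'K, ha1, ha2⟩ := ha'
  obtain ⟨hb'K, hb1, hb2⟩ := hb'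
  refine hsep a' b' (by rw [abs_le]; constructor <;> linarith)
    (by rw [abs_le]; constructor <;> linarith)
    (hKgap a' ha'K b' hb'K (by linarith) fun z hz => ?_)
  by_contra! hcon
  rcases le_or_gt z (a + ε) with h | h
  · exact absurd (hamax ⟨hz, by linarith, h⟩) (by linarith)
  rcases le_or_gt (b - ε) z with h' | h'
  · exact absurd (hbmin ⟨hz, h', by linarith⟩) (by linarith)
  · exact hK ⟨z, hz, h.le, h'.le⟩

theorem exists_gapCompatibleSet_injective {f : ℝ → X} (hf : Continuous f) :
    ∃ K ∈ gapCompatibleSets f, ∀ s ∈ K, ∀ t ∈ K, s < t → f s = f t → ∀ c ∈ K, c ≤ s ∨ t ≤ c := by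
  obtain ⟨K, -, hK⟩ := zorn_superset_nonempty (gapCompatibleSets f)
    (fun c hc hchain hne => ⟨⋂₀ c, sInter_mem_gapCompatibleSets hf hc hchain hne,
      fun s hs => sInter_subset_of_mem hs⟩) (Icc 0 1)
    ⟨isClosed_Icc, subset_rfl, by simp, by simp, fun a ha b hb hab hgap => by
      rcases hgap ((a + b) / 2) ⟨by linarith [ha.1, hb.1], by linarith [ha.2, hb.2]⟩ with h | h <;>
      linarith⟩
  refine ⟨K, hK.1, fun s hs t ht hst hfst c hc => ?_⟩
  by_contra! h
  exact (hK.2 (diff_Ioo_mem_gapCompatibleSets hK.1 hs ht hfst) sdiff_subset hc).2 h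

theorem exists_continuous_fibers_ordConnected {f : ℝ → X} (hf : Continuous f) :
    ∃ h : ℝ → X, Continuous h ∧ h 0 = f 0 ∧ h 1 = f 1 ∧
      (∀ t ∈ Icc (0 : ℝ) 1, ∃ s ∈ Icc (0 : ℝ) 1, h t = f s) ∧
      ∀ s r t, 0 ≤ s → s ≤ r → r ≤ t → t ≤ 1 → h s = h t → h r = h s := by
  obtain ⟨K, ⟨hKcl, hK01, hK0, hK1, hKgap⟩, hKinj⟩ := exists_gapCompatibleSet_injective hf
  have hρ : ∀ t : ℝ, ∃ ρ, 0 ≤ t → IsGreatest (K ∩ Icc 0 t) ρ := fun t => by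
    by_cases ht : 0 ≤ t
    · obtain ⟨ρ, hρ⟩ := (isCompact_Icc.inter_left hKcl : IsCompact (K ∩ Icc 0 t))
        |>.exists_isGreatest ⟨0, hK0, le_rfl, ht⟩
      exact ⟨ρ, fun _ => hρ⟩
    · exact ⟨0, fun h => absurd h ht⟩
  have hσ : ∀ t : ℝ, ∃ σ, t ≤ 1 → IsLeast (K ∩ Icc t 1) σ := fun t => by
    by_cases ht : t ≤ 1
    · obtain ⟨ρ, hρ⟩ := (isCompact_Icc.inter_left hKcl : IsCompact (K ∩ Icc t 1))
        |>.exists_isLeast ⟨1, hK1, ht, le_rfl⟩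
      exact ⟨ρ, fun _ => hρ⟩
    · exact ⟨0, fun h => absurd h ht⟩
  choose ρ hρ using hρ
  choose σ hσ using hσ
  have hρK : ∀ t, 0 ≤ t → ρ t ∈ K := fun t ht => (hρ t ht).1.1
  have hρle : ∀ t, 0 ≤ t → ρ t ≤ t := fun t ht => (hρ t ht).1.2.2
  have hleρ : ∀ t, 0 ≤ t → ∀ k ∈ K, k ≤ t → k ≤ ρ t := fun t ht k hk hkt =>
    (hρ t ht).2 ⟨hk, (hK01 hk).1, hkt⟩
  have hσK : ∀ t, t ≤ 1 → σ t ∈ K := fun t ht => (hσ t ht).1.1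
  have hleσ : ∀ t, t ≤ 1 → t ≤ σ t := fun t ht => (hσ t ht).1.2.1
  have hσle : ∀ t, t ≤ 1 → ∀ k ∈ K, t ≤ k → σ t ≤ k := fun t ht k hk hkt =>
    (hσ t ht).2 ⟨hk, hkt, (hK01 hk).2⟩
  have hρσ : ∀ t, 0 ≤ t → t ≤ 1 → f (ρ t) = f (σ t) := fun t h0 h1 => by
    rcases ((hρle t h0).trans (hleσ t h1)).eq_or_lt with h | h
    · rw [h]
    · refine hKgap _ (hρK t h0) _ (hσK t h1) h fun c hc => ?_
      rcases le_total c t with h | h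
      · exact Or.inl (hleρ t h0 c hc h)
      · exact Or.inr (hσle t h1 c hc h)
  have hρfix : ∀ t ∈ K, ρ t = t := fun t ht =>
    le_antisymm (hρle t (hK01 ht).1) (hleρ t (hK01 ht).1 t ht le_rfl)
  have hcont : ContinuousOn (fun t => f (ρ t)) (Icc 0 1) := by
    refine UniformContinuousOn.continuousOn (Metric.uniformContinuousOn_iff.2 fun ε hε => ?_)
    obtain ⟨δ, hδ, H⟩ := Metric.uniformContinuousOn_iff.1
      (isCompact_Icc.uniformContinuousOn_of_continuous (hf.continuousOn (s := Icc (0 : ℝ) 1))) ε hε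
    have key : ∀ s ∈ Icc (0 : ℝ) 1, ∀ t ∈ Icc (0 : ℝ) 1, s ≤ t → dist s t < δ →
        dist (f (ρ s)) (f (ρ t)) < ε := by
      intro s hs t ht hst hd
      by_cases hk : ∃ k ∈ K, s ≤ k ∧ k ≤ t
      · obtain ⟨k, hk, hsk, hkt⟩ := hk
        have h1 := hleσ s hs.2
        have h2 := hσle s hs.2 k hk hsk
        have h3 := hρle t ht.1
        have h4 := hleρ t ht.1 k hk hkt
        rw [hρσ s hs.1 hs.2]
        refine H _ (hK01 (hσK s hs.2)) _ (hK01 (hρK t ht.1)) ?_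
        rw [Real.dist_eq, abs_lt] at hd ⊢
        constructor <;> linarith
      · push Not at hk
        have : ρ s = ρ t := by
          refine le_antisymm (hleρ t ht.1 _ (hρK s hs.1) ((hρle s hs.1).trans hst))
            (hleρ s hs.1 _ (hρK t ht.1) ?_)
          by_contra! h
          exact absurd (hρle t ht.1) (not_le.2 (hk _ (hρK t ht.1) h.le))
        rw [this, dist_self]
        exact hε
    refine ⟨δ, hδ, fun s hs t ht hd => ?_⟩
    rcases le_total s t with h | h
    · exact key s hs t ht h hd
    · rw [dist_comm]
      exact key t ht s hs h (by rwa [dist_comm])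
  have hclamp : ∀ t ∈ Icc (0 : ℝ) 1, max 0 (min 1 t) = t := fun t ht => by
    rw [min_eq_right ht.2, max_eq_right ht.1]
  refine ⟨fun t => f (ρ (max 0 (min 1 t))), ?_, ?_, ?_, ?_, ?_⟩
  · exact hcont.comp_continuous (by fun_prop) fun t => ⟨le_max_left _ _, by simp⟩
  · simp [hρfix 0 hK0]
  · simp [hρfix 1 hK1]
  · intro t ht
    exact ⟨ρ t, hK01 (hρK t ht.1), by simp only [hclamp t ht]⟩
  · intro s r t h0 hsr hrt h1 heq
    have hr0 := h0.trans hsr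
    have ht0 := hr0.trans hrt
    simp only [hclamp s ⟨h0, by linarith⟩, hclamp t ⟨by linarith, h1⟩,
      hclamp r ⟨by linarith, by linarith⟩] at heq ⊢
    have h2 : ρ s ≤ ρ r := hleρ r hr0 _ (hρK s h0) ((hρle s h0).trans hsr)
    have h3 : ρ r ≤ ρ t := hleρ t ht0 _ (hρK r hr0) ((hρle r hr0).trans hrt)
    rcases (h2.trans h3).eq_or_lt with h | h
    · rw [le_antisymm (h3.trans h.ge) h2]
    · rcases hKinj _ (hρK s h0) _ (hρK t ht0) h heq _ (hρK r hr0) with h' | h'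
      · rw [le_antisymm h' h2]
      · rw [le_antisymm h3 h', heq]

theorem exists_monotone_separating [TopologicalSpace.SeparableSpace X] {h : ℝ → X}
    (hh : Continuous h)
    (hfib : ∀ s r t, 0 ≤ s → s ≤ r → r ≤ t → t ≤ 1 → h s = h t → h r = h s) :
    ∃ M : ℝ → ℝ, Continuous M ∧ (∀ s t, 0 ≤ s → s ≤ t → t ≤ 1 → M t ≤ M s) ∧
      ∀ s ∈ Icc (0 : ℝ) 1, ∀ t ∈ Icc (0 : ℝ) 1, M s = M t ↔ h s = h t := by
  have : Nonempty X := ⟨h 0⟩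
  set q := TopologicalSpace.denseSeq X with hq
  set φ : ℕ → ℝ → ℝ := fun n s => min 1 (dist (q n) (h s)) with hφ
  have hφ0 : ∀ n s, 0 ≤ φ n s := fun n s => le_min zero_le_one dist_nonneg
  have hφ1 : ∀ n s, φ n s ≤ 1 := fun n s => min_le_left _ _
  set m : ℕ → ℝ → ℝ := fun n t => sInf ((fun u => φ n (t * u)) '' Icc 0 1) with hm
  have hbdd : ∀ n (S : Set ℝ), BddBelow (φ n '' S) := fun n S =>
    ⟨0, by rintro _ ⟨u, -, rfl⟩; exact hφ0 n u⟩
  have hmeq : ∀ n t, 0 ≤ t → m n t = sInf (φ n '' Icc 0 t) := fun n t ht => by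
    simp only [hm]
    congr 1
    ext z
    constructor
    · rintro ⟨u, hu, rfl⟩
      exact ⟨t * u, ⟨mul_nonneg ht hu.1, mul_le_of_le_one_right ht hu.2⟩, rfl⟩
    · rintro ⟨s, hs, rfl⟩
      refine ⟨s / t, ⟨div_nonneg hs.1 ht, div_le_one_of_le₀ hs.2 ht⟩, ?_⟩
      rcases ht.eq_or_lt with rfl | h'
      · simp [le_antisymm hs.2 hs.1]
      · simp only [mul_div_cancel₀ s h'.ne']
  have hmcont : ∀ n, Continuous (m n) := fun n => by
    refine isCompact_Icc.continuous_sInf (f := fun t u => φ n (t * u)) ?_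
    simp only [hφ, Function.HasUncurry.uncurry, id]
    fun_prop
  have hm0 : ∀ n t, 0 ≤ m n t := fun n t =>
    Real.sInf_nonneg (by rintro _ ⟨u, -, rfl⟩; exact hφ0 _ _)
  have hm1 : ∀ n t, m n t ≤ 1 := fun n t =>
    (csInf_le ⟨0, by rintro _ ⟨u, -, rfl⟩; exact hφ0 _ _⟩
      (mem_image_of_mem _ (by simp : (0 : ℝ) ∈ Icc (0 : ℝ) 1))).trans (hφ1 _ _)
  have hmanti : ∀ n s t, 0 ≤ s → s ≤ t → m n t ≤ m n s := fun n s t h0 hst => by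
    rw [hmeq n s h0, hmeq n t (h0.trans hst)]
    exact csInf_le_csInf (hbdd n _) ((nonempty_Icc.2 h0).image _)
      (image_mono (Icc_subset_Icc_right hst))
  have hgeom : Summable fun n : ℕ => ((1 : ℝ) / 2) ^ n := summable_geometric_two
  have hbound : ∀ n t, ‖((1 : ℝ) / 2) ^ n * m n t‖ ≤ (1 / 2) ^ n := fun n t => by
    rw [Real.norm_of_nonneg (mul_nonneg (by positivity) (hm0 n t))]
    exact mul_le_of_le_one_right (by positivity) (hm1 n t)
  have hsum : ∀ t, Summable fun n => ((1 : ℝ) / 2) ^ n * m n t := fun t =>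
    hgeom.of_norm_bounded fun n => hbound n t
  have hlt : ∀ s t, 0 ≤ s → s ≤ t → t ≤ 1 → h s ≠ h t →
      ∑' n, ((1 : ℝ) / 2) ^ n * m n t < ∑' n, ((1 : ℝ) / 2) ^ n * m n s := by
    intro s t h0 hst h1 hne
    have hnot : h t ∉ h '' Icc 0 s := by
      rintro ⟨r, hr, hrt⟩
      exact hne ((hfib r s t hr.1 hr.2 hst h1 hrt).trans hrt)
    obtain ⟨ε, hε, hball⟩ := Metric.mem_nhds_iff.1
      ((isCompact_Icc.image hh).isClosed.isOpen_compl.mem_nhds hnot)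
    obtain ⟨n, hn⟩ := (TopologicalSpace.denseRange_denseSeq X).exists_dist_lt (h t)
      (show 0 < min 1 ε / 3 by positivity)
    have e1 : min 1 ε ≤ 1 := min_le_left _ _
    have e2 : min 1 ε ≤ ε := min_le_right _ _
    have e3 : 0 < min 1 ε := by positivity
    have hmt : m n t < min 1 ε / 3 := by
      rw [hmeq n t (h0.trans hst)]
      refine (csInf_le (hbdd n _) (mem_image_of_mem _ (right_mem_Icc.2 (h0.trans hst)))).trans_lt ?_
      refine (min_le_right _ _).trans_lt ?_
      rwa [dist_comm]
    have hms : min 1 ε / 3 ≤ m n s := by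
      rw [hmeq n s h0]
      refine le_csInf ((nonempty_Icc.2 h0).image _) ?_
      rintro _ ⟨r, hr, rfl⟩
      refine le_min (by linarith) ?_
      by_contra! hcon
      refine hball (?_ : h r ∈ Metric.ball (h t) ε) (mem_image_of_mem _ hr)
      rw [Metric.mem_ball]
      have := dist_triangle_left (h r) (h t) (q n)
      rw [dist_comm] at hn
      linarith
    refine Summable.tsum_lt_tsum (i := n) (fun k => ?_) ?_ (hsum t) (hsum s)
    · exact mul_le_mul_of_nonneg_left (hmanti k s t h0 hst) (by positivity)
    · exact mul_lt_mul_of_pos_left (hmt.trans_le hms) (by positivity)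
  have heq : ∀ s t, 0 ≤ s → s ≤ t → t ≤ 1 → h s = h t →
      ∑' n, ((1 : ℝ) / 2) ^ n * m n s = ∑' n, ((1 : ℝ) / 2) ^ n * m n t := by
    intro s t h0 hst h1 he
    refine tsum_congr fun n => ?_
    rw [hmeq n s h0, hmeq n t (h0.trans hst)]
    congr 2
    ext z
    constructor
    · rintro ⟨r, hr, rfl⟩
      exact ⟨r, ⟨hr.1, hr.2.trans hst⟩, rfl⟩
    · rintro ⟨r, hr, rfl⟩
      rcases le_total r s with h' | h'
      · exact ⟨r, ⟨hr.1, h'⟩, rfl⟩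
      · refine ⟨s, ⟨h0, le_rfl⟩, ?_⟩
        simp only [hφ, hfib s r t h0 h' hr.2 h1 he]
  refine ⟨fun t => ∑' n, ((1 : ℝ) / 2) ^ n * m n t,
    continuous_tsum (fun n => continuous_const.mul (hmcont n)) hgeom hbound, ?_, ?_⟩
  · intro s t h0 hst h1
    by_cases he : h s = h t
    · exact (heq s t h0 hst h1 he).ge
    · exact (hlt s t h0 hst h1 he).le
  · intro s hs t ht
    rcases le_total s t with hst | hst
    · exact ⟨fun he => by_contra fun hne => (hlt s t hs.1 hst ht.2 hne).ne' he,
        heq s t hs.1 hst ht.2⟩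
    · exact ⟨fun he => by_contra fun hne => (hlt t s ht.1 hst hs.2 (Ne.symm hne)).ne he,
        fun he => (heq t s ht.1 hst hs.2 he.symm).symm⟩

theorem exists_continuous_injOn_of_path [TopologicalSpace.SeparableSpace X] {f : ℝ → X}
    (hf : Continuous f) (hne : f 0 ≠ f 1) :
    ∃ g : ℝ → X, Continuous g ∧ g 0 = f 0 ∧ g 1 = f 1 ∧ InjOn g (Icc 0 1) ∧
      ∀ t ∈ Icc (0 : ℝ) 1, ∃ s ∈ Icc (0 : ℝ) 1, g t = f s := by
  obtain ⟨h, hh, h0, h1, hhf, hfib⟩ := exists_continuous_fibers_ordConnected hf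
  obtain ⟨M, hM, hanti, hMh⟩ := exists_monotone_separating hh hfib
  have m0 : (0 : ℝ) ∈ Icc (0 : ℝ) 1 := by simp
  have m1 : (1 : ℝ) ∈ Icc (0 : ℝ) 1 := by simp
  have hM01 : M 1 < M 0 := lt_of_le_of_ne (hanti 0 1 le_rfl zero_le_one le_rfl) fun he =>
    hne (by rw [← h0, ← h1]; exact ((hMh 1 m1 0 m0).1 he).symm)
  have hpos : 0 < M 0 - M 1 := by linarith
  set N : ℝ → ℝ := fun t => (M 0 - M t) / (M 0 - M 1) with hN
  have hNcont : Continuous N := by fun_prop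
  have hN0 : N 0 = 0 := by simp [hN]
  have hN1 : N 1 = 1 := by simp [hN, hpos.ne']
  have hNmem : ∀ t ∈ Icc (0 : ℝ) 1, N t ∈ Icc (0 : ℝ) 1 := fun t ht =>
    ⟨div_nonneg (by linarith [hanti 0 t le_rfl ht.1 ht.2]) hpos.le,
      div_le_one_of_le₀ (by linarith [hanti t 1 ht.1 ht.2 le_rfl]) hpos.le⟩
  have hNh : ∀ s ∈ Icc (0 : ℝ) 1, ∀ t ∈ Icc (0 : ℝ) 1, N s = N t ↔ h s = h t := by
    intro s hs t ht
    rw [← hMh s hs t ht]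
    simp only [hN, div_left_inj' hpos.ne', sub_right_inj]
  have hsurj : ∀ u ∈ Icc (0 : ℝ) 1, ∃ t ∈ Icc (0 : ℝ) 1, N t = u := fun u hu =>
    intermediate_value_Icc zero_le_one hNcont.continuousOn (by rwa [hN0, hN1])
  choose! τ hτ hNτ using hsurj
  have hgN : ∀ t ∈ Icc (0 : ℝ) 1, h (τ (N t)) = h t := fun t ht =>
    (hNh _ (hτ _ (hNmem t ht)) t ht).1 (hNτ _ (hNmem t ht))
  have hgcont : ContinuousOn (fun u => h (τ u)) (Icc 0 1) := by
    refine continuousOn_iff_isClosed.2 fun C hC => ⟨N '' (h ⁻¹' C ∩ Icc 0 1),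
      ((isCompact_Icc.inter_left (hC.preimage hh)).image hNcont).isClosed, ?_⟩
    ext u
    constructor
    · rintro ⟨huC, hu⟩
      exact ⟨⟨τ u, ⟨huC, hτ u hu⟩, hNτ u hu⟩, hu⟩
    · rintro ⟨⟨t, ⟨htC, ht⟩, rfl⟩, hu⟩
      refine ⟨?_, hu⟩
      rw [mem_preimage, hgN t ht]
      exact htC
  have hclamp : ∀ t ∈ Icc (0 : ℝ) 1, max 0 (min 1 t) = t := fun t ht => by
    rw [min_eq_right ht.2, max_eq_right ht.1]
  refine ⟨fun t => h (τ (max 0 (min 1 t))),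
    hgcont.comp_continuous (by fun_prop) fun t => ⟨le_max_left _ _, by simp⟩, ?_, ?_, ?_, ?_⟩
  · simp only [hclamp 0 m0]
    rw [← h0, ← hgN 0 m0, hN0]
  · simp only [hclamp 1 m1]
    rw [← h1, ← hgN 1 m1, hN1]
  · intro s hs t ht he
    simp only [hclamp s hs, hclamp t ht] at he
    rw [← hNτ s hs, ← hNτ t ht]
    exact (hNh _ (hτ s hs) _ (hτ t ht)).2 he
  · intro t ht
    simp only [hclamp t ht]
    exact hhf _ (hτ t ht)

theorem IsPathConnected.exists_continuous_injOn [TopologicalSpace.SeparableSpace X] {O : Set X}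
    (hO : IsPathConnected O) {p q : X} (hp : p ∈ O) (hq : q ∈ O) (hpq : p ≠ q) :
    ∃ g : ℝ → X, Continuous g ∧ g 0 = p ∧ g 1 = q ∧ InjOn g (Icc 0 1) ∧
      ∀ t ∈ Icc (0 : ℝ) 1, g t ∈ O := by
  obtain ⟨γ, hγ⟩ := hO.joinedIn p hp q hq
  obtain ⟨g, hg, h0, h1, hinj, hgf⟩ := exists_continuous_injOn_of_path γ.continuous_extend
    (by simpa using hpq)
  refine ⟨g, hg, by simpa using h0, by simpa using h1, hinj, fun t ht => ?_⟩
  obtain ⟨s, hs, hst⟩ := hgf t ht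
  rw [hst, γ.extend_apply hs]
  exact hγ _

end Arcs

section SimpleClosedCurves

/-- A continuous loop on `[0, 1]` which is injective on `[0, 1)` factors through an injective
continuous map on the circle. -/
theorem exists_injective_addCircle_of_loop {X : Type*} [TopologicalSpace X] {γ : ℝ → X}
    (hγ : Continuous γ) (h01 : γ 0 = γ 1) (hinj : InjOn γ (Ico 0 1)) :
    ∃ F : AddCircle (1 : ℝ) → X, Continuous F ∧ Function.Injective F := by
  have : Fact ((0 : ℝ) < 1) := ⟨zero_lt_one⟩
  refine ⟨AddCircle.liftIco 1 0 γ, AddCircle.liftIco_continuous (by simpa using h01)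
    hγ.continuousOn, fun x y hxy => ?_⟩
  obtain ⟨s, hs, rfl⟩ := (AddCircle.coe_image_Ico_eq (1 : ℝ) 0).ge (mem_univ x)
  obtain ⟨t, ht, rfl⟩ := (AddCircle.coe_image_Ico_eq (1 : ℝ) 0).ge (mem_univ y)
  rw [AddCircle.liftIco_coe_apply hs, AddCircle.liftIco_coe_apply ht] at hxy
  rw [zero_add] at hs ht
  rw [hinj hs ht hxy]

/-- Two arcs with the same endpoints and different images contain a simple closed curve. -/
theorem exists_injective_addCircle_of_arcs {X : Type*} [TopologicalSpace X] [T2Space X]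
    {α β : ℝ → X} (hα : Continuous α) (hβ : Continuous β) (hαi : InjOn α (Icc 0 1))
    (hβi : InjOn β (Icc 0 1)) (h0 : α 0 = β 0) (h1 : α 1 = β 1) {t : ℝ} (ht : t ∈ Icc (0 : ℝ) 1)
    (hαt : α t ∉ β '' Icc 0 1) :
    ∃ F : AddCircle (1 : ℝ) → X, Continuous F ∧ Function.Injective F := by
  have hcl : IsClosed (α ⁻¹' (β '' Icc 0 1)) := (isCompact_Icc.image hβ).isClosed.preimage hα
  obtain ⟨a, ⟨haS, ha0, hat⟩, hamax⟩ :=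
    (isCompact_Icc.inter_left hcl : IsCompact (α ⁻¹' (β '' Icc 0 1) ∩ Icc 0 t)).exists_isGreatest
      ⟨0, ⟨0, by simp, h0.symm⟩, le_rfl, ht.1⟩
  obtain ⟨b, ⟨hbS, htb, hb1⟩, hbmin⟩ :=
    (isCompact_Icc.inter_left hcl : IsCompact (α ⁻¹' (β '' Icc 0 1) ∩ Icc t 1)).exists_isLeast
      ⟨1, ⟨1, by simp, h1.symm⟩, ht.2, le_rfl⟩
  have hat' : a < t := lt_of_le_of_ne hat (by rintro rfl; exact hαt haS)
  have htb' : t < b := lt_of_le_of_ne htb (by rintro rfl; exact hαt hbS)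
  have hgap : ∀ s, a < s → s < b → α s ∉ β '' Icc 0 1 := fun s has hsb hs => by
    rcases le_total s t with h | h
    · exact absurd (hamax ⟨hs, by linarith, h⟩) (by linarith)
    · exact absurd (hbmin ⟨hs, h, by linarith⟩) (by linarith)
  obtain ⟨c, hc, hca⟩ := haS
  obtain ⟨d, hd, hdb⟩ := hbS
  have hab : a < b := hat'.trans htb'
  have hcd : c ≠ d := by
    rintro rfl
    exact hab.ne (hαi ⟨ha0, by linarith⟩ ⟨by linarith, hb1⟩ (hca.symm.trans hdb))
  have hαmem : ∀ s, 0 ≤ s → s ≤ 1 / 2 → a + 2 * s * (b - a) ∈ Icc a b := fun s hs0 hs1 =>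
    ⟨by nlinarith, by nlinarith⟩
  have hβmem : ∀ s, 1 / 2 ≤ s → s ≤ 1 → d + (2 * s - 1) * (c - d) ∈ Icc (0 : ℝ) 1 :=
    fun s hs0 hs1 => ⟨by nlinarith [hc.1, hd.1, hc.2, hd.2], by nlinarith [hc.1, hd.1, hc.2, hd.2]⟩
  have hcross : ∀ s t, 0 ≤ s → s ≤ 1 / 2 → 1 / 2 < t → t < 1 →
      α (a + 2 * s * (b - a)) ≠ β (d + (2 * t - 1) * (c - d)) := by
    intro s t hs0 hs1 ht0 ht1 he
    have htm := hβmem t ht0.le ht1.le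
    rcases hs0.eq_or_lt with rfl | hs0'
    · have h2 := hβi hc htm (by rw [hca, ← he]; congr 1; ring)
      have h3 : (c - d) * (2 - 2 * t) = 0 := by linarith
      rcases mul_eq_zero.1 h3 with h | h
      · exact hcd (by linarith)
      · linarith
    rcases hs1.eq_or_lt with rfl | hs1'
    · have h2 := hβi hd htm (by rw [hdb, ← he]; congr 1; ring)
      have h3 : (c - d) * (2 * t - 1) = 0 := by linarith
      rcases mul_eq_zero.1 h3 with h | h
      · exact hcd (by linarith)
      · linarith
    · exact hgap _ (by nlinarith) (by nlinarith) ⟨_, htm, he.symm⟩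
  refine exists_injective_addCircle_of_loop
    (γ := fun s => if s ≤ 1 / 2 then α (a + 2 * s * (b - a)) else β (d + (2 * s - 1) * (c - d)))
    ?_ ?_ ?_
  · refine Continuous.if_le (by fun_prop) (by fun_prop) continuous_id continuous_const ?_
    rintro s rfl
    convert hdb.symm using 2 <;> ring
  · norm_num [hca]
  · intro s hs t ht he
    simp only at he
    split_ifs at he with h2 h3 h3
    · have h4 := hαmem s hs.1 h2
      have h5 := hαmem t ht.1 h3
      have h6 := hαi ⟨by linarith [h4.1], by linarith [h4.2]⟩ ⟨by linarith [h5.1],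
        by linarith [h5.2]⟩ he
      have h7 : (s - t) * (b - a) = 0 := by linarith
      rcases mul_eq_zero.1 h7 with h | h <;> linarith
    · exact absurd he (hcross s t hs.1 h2 (not_le.1 h3) ht.2)
    · exact absurd he.symm (hcross t s ht.1 h3 (not_le.1 h2) hs.2)
    · have h6 := hβi (hβmem s (not_le.1 h2).le hs.2.le) (hβmem t (not_le.1 h3).le ht.2.le) he
      have h7 : (s - t) * (c - d) = 0 := by linarith
      rcases mul_eq_zero.1 h7 with h | h
      · linarith
      · exact absurd (by linarith) hcd

theorem exists_isSimpleClosedCurve_iff {X : Type*} [TopologicalSpace X] [T2Space X] :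
    (∃ S : Set X, IsSimpleClosedCurve S) ↔
      ∃ F : AddCircle (1 : ℝ) → X, Continuous F ∧ Function.Injective F := by
  have : Fact ((0 : ℝ) < 1) := ⟨zero_lt_one⟩
  constructor
  · rintro ⟨S, ⟨e⟩⟩
    exact ⟨fun x => (e.symm x : X), continuous_subtype_val.comp e.symm.continuous,
      Subtype.val_injective.comp e.symm.injective⟩
  · rintro ⟨F, hF, hinj⟩
    exact ⟨range F, ⟨(hF.isClosedEmbedding hinj).isEmbedding.toHomeomorph.symm⟩⟩

/-- In a compact locally connected metrizable space, a "ring" formed by two disjoint open connected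
sets bridged by two disjoint continua yields a simple closed curve. -/
theorem exists_injective_addCircle_of_ring {X : Type*} [TopologicalSpace X]
    [TopologicalSpace.MetrizableSpace X] [CompactSpace X] [LocallyConnectedSpace X]
    {U V C₁ C₂ : Set X} (hU : IsOpen U) (hV : IsOpen V) (hUc : IsPreconnected U)
    (hVc : IsPreconnected V) (hUV : Disjoint U V) (hC₁ : IsCompact C₁) (hC₂ : IsCompact C₂)
    (hC₁c : IsPreconnected C₁) (hC₂c : IsPreconnected C₂) (hC : Disjoint C₁ C₂)
    (h1U : (C₁ ∩ U).Nonempty) (h1V : (C₁ ∩ V).Nonempty)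
    (h2U : (C₂ ∩ U).Nonempty) (h2V : (C₂ ∩ V).Nonempty) :
    ∃ F : AddCircle (1 : ℝ) → X, Continuous F ∧ Function.Injective F := by
  let _ := TopologicalSpace.metrizableSpaceMetric X
  have := LocallyConnectedSpace.locallyPathConnectedSpace (X := X)
  obtain ⟨W₁, W₂, hW₁, hW₂, hCW₁, hCW₂, hW⟩ := SeparatedNhds.of_isCompact_isCompact hC₁ hC₂ hC
  obtain ⟨p, hp⟩ := h1U
  obtain ⟨q, hq⟩ := h1V
  have hpq : p ≠ q := fun h => disjoint_left.1 hUV hp.2 (h ▸ hq.2)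
  have key : ∀ C W : Set X, IsPreconnected C → C ⊆ W → IsOpen W → (C ∩ U).Nonempty →
      (C ∩ V).Nonempty → ∃ g : ℝ → X, Continuous g ∧ g 0 = p ∧ g 1 = q ∧ InjOn g (Icc 0 1) ∧
        ∀ t ∈ Icc (0 : ℝ) 1, g t ∈ U ∪ W ∪ V := by
    rintro C W hC hCW hW ⟨u, huC, huU⟩ ⟨v, hvC, hvV⟩
    set O := connectedComponentIn W u with hO
    have hCO : C ⊆ O := hC.subset_connectedComponentIn huC hCW
    have hconn : IsConnected (U ∪ O ∪ V) := ⟨⟨p, Or.inl (Or.inl hp.2)⟩,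
      (hUc.union u huU (hCO huC) isPreconnected_connectedComponentIn).union v
        (Or.inr (hCO hvC)) hvV hVc⟩
    have hopen : IsOpen (U ∪ O ∪ V) := (hU.union hW.connectedComponentIn).union hV
    obtain ⟨g, hg, h0, h1, hinj, hmem⟩ := (hopen.isConnected_iff_isPathConnected.1
      hconn).exists_continuous_injOn (Or.inl (Or.inl hp.2)) (Or.inr hq.2) hpq
    exact ⟨g, hg, h0, h1, hinj, fun t ht => union_subset_union_left _
      (union_subset_union_right _ (connectedComponentIn_subset _ _)) (hmem t ht)⟩
  obtain ⟨α, hα, hα0, hα1, hαi, hαm⟩ := key C₁ W₁ hC₁c hCW₁ hW₁ ⟨p, hp⟩ ⟨q, hq⟩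
  obtain ⟨β, hβ, hβ0, hβ1, hβi, hβm⟩ := key C₂ W₂ hC₂c hCW₂ hW₂ h2U h2V
  obtain ⟨t, ht, htU, htV⟩ : ∃ t ∈ Icc (0 : ℝ) 1, α t ∉ U ∧ α t ∉ V := by
    by_contra! hcon
    have hsub : α '' Icc 0 1 ⊆ U ∪ V := by
      rintro _ ⟨t, ht, rfl⟩
      by_cases h : α t ∈ U
      · exact Or.inl h
      · exact Or.inr (hcon t ht h)
    obtain ⟨z, -, hzU, hzV⟩ := (isPreconnected_Icc.image α hα.continuousOn) U V hU hV hsub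
      ⟨p, ⟨0, by simp, hα0⟩, hp.2⟩ ⟨q, ⟨1, by simp, hα1⟩, hq.2⟩
    exact disjoint_left.1 hUV hzU hzV
  have htW : α t ∈ W₁ := by
    rcases hαm t ht with (h | h) | h
    · exact absurd h htU
    · exact h
    · exact absurd h htV
  refine exists_injective_addCircle_of_arcs hα hβ hαi hβi (hα0.trans hβ0.symm)
    (hα1.trans hβ1.symm) ht ?_
  rintro ⟨s, hs, hst⟩
  have := hβm s hs
  rw [hst] at this
  rcases this with (h | h) | h
  · exact htU h
  · exact disjoint_left.1 hW htW h
  · exact htV h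

end SimpleClosedCurves

section Subcontinua

theorem IsDendrite.exists_nhds_not_disjoint {X : Type*} [TopologicalSpace X] {D : Set X}
    (hD : IsDendrite D) {p q : X} (hp : D ∈ 𝓝 p) (hq : D ∈ 𝓝 q) (hpq : p ≠ q) :
    ∃ U ∈ 𝓝 p, ∃ V ∈ 𝓝 q, ∀ C₁ C₂ : Set X, IsCompact C₁ → IsCompact C₂ → IsPreconnected C₁ →
      IsPreconnected C₂ → C₁ ⊆ D → C₂ ⊆ D → (C₁ ∩ U).Nonempty → (C₁ ∩ V).Nonempty →
      (C₂ ∩ U).Nonempty → (C₂ ∩ V).Nonempty → ¬ Disjoint C₁ C₂ := by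
  obtain ⟨⟨-, _, -, _⟩, _, hcurve⟩ := hD
  obtain ⟨U, V, hU, hV, hpU, hqV, hUV⟩ := t2_separation
    (show (⟨p, mem_of_mem_nhds hp⟩ : D) ≠ ⟨q, mem_of_mem_nhds hq⟩ by simpa using hpq)
  set U' := connectedComponentIn U ⟨p, mem_of_mem_nhds hp⟩ with hU'
  set V' := connectedComponentIn V ⟨q, mem_of_mem_nhds hq⟩ with hV'
  refine ⟨Subtype.val '' U', ?_, Subtype.val '' V', ?_, ?_⟩
  · rw [← map_nhds_subtype_coe_eq_nhds (mem_of_mem_nhds hp) hp]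
    exact image_mem_map (hU.connectedComponentIn.mem_nhds (mem_connectedComponentIn hpU))
  · rw [← map_nhds_subtype_coe_eq_nhds (mem_of_mem_nhds hq) hq]
    exact image_mem_map (hV.connectedComponentIn.mem_nhds (mem_connectedComponentIn hqV))
  · intro C₁ C₂ hC₁ hC₂ hC₁c hC₂c h1D h2D h1U h1V h2U h2V hdisj
    have hmeet : ∀ (C : Set X) (W : Set D), (C ∩ Subtype.val '' W).Nonempty →
        ((Subtype.val ⁻¹' C : Set D) ∩ W).Nonempty := by
      rintro C W ⟨_, hzC, z, hzW, rfl⟩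
      exact ⟨z, hzC, hzW⟩
    have hpre : ∀ C : Set X, C ⊆ D → Subtype.val '' (Subtype.val ⁻¹' C : Set D) = C :=
      fun C hC => by simpa using hC
    obtain ⟨S, hS⟩ := exists_isSimpleClosedCurve_iff.2 (exists_injective_addCircle_of_ring
      (C₁ := Subtype.val ⁻¹' C₁) (C₂ := Subtype.val ⁻¹' C₂)
      hU.connectedComponentIn hV.connectedComponentIn isPreconnected_connectedComponentIn
      isPreconnected_connectedComponentIn (hUV.mono (connectedComponentIn_subset _ _)
        (connectedComponentIn_subset _ _))
      (by rwa [Subtype.isCompact_iff, hpre _ h1D]) (by rwa [Subtype.isCompact_iff, hpre _ h2D])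
      (by rwa [← Topology.IsInducing.subtypeVal.isPreconnected_image, hpre _ h1D])
      (by rwa [← Topology.IsInducing.subtypeVal.isPreconnected_image, hpre _ h2D])
      (hdisj.preimage _) (hmeet _ _ h1U) (hmeet _ _ h1V) (hmeet _ _ h2U) (hmeet _ _ h2V))
    exact hcurve S hS

/-- Boundary bumping: in a continuum, every component of a proper closed subset meets the frontier
of that subset. -/
theorem IsClosed.connectedComponentIn_inter_frontier_nonempty {Y : Type*} [TopologicalSpace Y]
    [CompactSpace Y] [T2Space Y] [PreconnectedSpace Y] {F : Set Y} (hF : IsClosed F)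
    (hne : F ≠ univ) {z : Y} (hz : z ∈ F) :
    (connectedComponentIn F z ∩ frontier F).Nonempty := by
  by_contra hcon
  have : CompactSpace F := isCompact_iff_compactSpace.1 hF.isCompact
  set B : Set F := Subtype.val ⁻¹' frontier F with hB
  have hBc : IsCompact B := (isClosed_frontier.preimage continuous_subtype_val).isCompact
  have hempty : B ∩ ⋂ s : { s : Set F // IsClopen s ∧ (⟨z, hz⟩ : F) ∈ s }, s.1 = ∅ := by
    rw [← connectedComponent_eq_iInter_isClopen]
    refine eq_empty_iff_forall_notMem.2 fun w hw => hcon ⟨w, ?_, hw.1⟩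
    rw [connectedComponentIn_eq_image hz]
    exact mem_image_of_mem _ hw.2
  have : Nonempty { s : Set F // IsClopen s ∧ (⟨z, hz⟩ : F) ∈ s } :=
    ⟨⟨univ, isClopen_univ, trivial⟩⟩
  obtain ⟨⟨E, hE, hzE⟩, hEB⟩ := hBc.elim_directed_family_closed _
    (fun s => s.2.1.isClosed) hempty (fun s t => ⟨⟨s.1 ∩ t.1, s.2.1.inter t.2.1, s.2.2, t.2.2⟩,
      inter_subset_left, inter_subset_right⟩)
  have hEint : Subtype.val '' E ⊆ interior F := by
    rintro _ ⟨w, hw, rfl⟩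
    by_contra hwi
    have : w ∈ B ∩ E := ⟨⟨subset_closure w.2, hwi⟩, hw⟩
    rw [hEB] at this
    exact this
  have hclosed : IsClosed (Subtype.val '' E) := hF.isClosedEmbedding_subtypeVal.isClosedMap _ hE.1
  have hopen : IsOpen (Subtype.val '' E) := by
    obtain ⟨O, hO, rfl⟩ := isOpen_induced_iff.1 hE.2
    have : Subtype.val '' (Subtype.val ⁻¹' O : Set F) = O ∩ interior F := by
      refine subset_antisymm (fun w hw => ⟨?_, hEint hw⟩) fun w hw =>
        ⟨⟨w, interior_subset hw.2⟩, hw.1, rfl⟩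
      obtain ⟨v, hv, rfl⟩ := hw
      exact hv
    rw [this]
    exact hO.inter isOpen_interior
  refine hne (univ_subset_iff.1 ?_)
  rw [← (isClopen_iff.1 ⟨hclosed, hopen⟩).resolve_left (Nonempty.ne_empty ⟨z, ⟨z, hz⟩, hzE, rfl⟩)]
  exact hEint.trans interior_subset

theorem connectedComponentIn_mem_nhds_of_not_disjoint {Y : Type*} [TopologicalSpace Y]
    [CompactSpace Y] [T2Space Y] [PreconnectedSpace Y] {F : Set Y} (hF : IsClosed F) {x : Y}
    (hx : F ∈ 𝓝 x)
    (H : ∀ y ∈ F, x ≠ y → ∃ U ∈ 𝓝 x, ∃ V ∈ 𝓝 y, ∀ C₁ C₂ : Set Y, IsCompact C₁ → IsCompact C₂ →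
      IsPreconnected C₁ → IsPreconnected C₂ → C₁ ⊆ F → C₂ ⊆ F → (C₁ ∩ U).Nonempty →
      (C₁ ∩ V).Nonempty → (C₂ ∩ U).Nonempty → (C₂ ∩ V).Nonempty → ¬ Disjoint C₁ C₂) :
    connectedComponentIn F x ∈ 𝓝 x := by
  by_cases hne : F = univ
  · rw [hne, connectedComponentIn_univ, PreconnectedSpace.connectedComponent_eq_univ]
    exact univ_mem
  have hxF : x ∈ F := mem_of_mem_nhds hx
  have hcomp : ∀ z, IsClosed (connectedComponentIn F z) := fun z => by
    by_cases hz : z ∈ F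
    · rw [connectedComponentIn_eq_image hz]
      exact hF.isClosedEmbedding_subtypeVal.isClosedMap _ isClosed_connectedComponent
    · rw [connectedComponentIn_eq_empty hz]
      exact isClosed_empty
  have hG : ∀ y ∈ frontier F, ∃ G ∈ 𝓝 x, ∃ V ∈ 𝓝 y, ∀ z ∈ G, z ∈ F →
      (connectedComponentIn F z ∩ V).Nonempty → z ∈ connectedComponentIn F x := by
    intro y hy
    have hxy : x ≠ y := by
      rintro rfl
      exact hy.2 (mem_interior_iff_mem_nhds.2 hx)
    obtain ⟨U, hU, V, hV, hUV⟩ := H y (hF.frontier_subset hy) hxy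
    by_cases hz : ∃ z₀ ∈ U, z₀ ∈ F ∧ (connectedComponentIn F z₀ ∩ V).Nonempty ∧
        x ∉ connectedComponentIn F z₀
    · obtain ⟨z₀, hz₀U, hz₀F, hz₀V, hxz₀⟩ := hz
      refine ⟨U ∩ (connectedComponentIn F z₀)ᶜ,
        inter_mem hU ((hcomp z₀).isOpen_compl.mem_nhds hxz₀), V, hV, fun z hzG hzF hzV => ?_⟩
      obtain ⟨w, hw, hw₀⟩ := not_disjoint_iff.1 (hUV _ _ (hcomp z).isCompact (hcomp z₀).isCompact
        isPreconnected_connectedComponentIn isPreconnected_connectedComponentIn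
        (connectedComponentIn_subset _ _) (connectedComponentIn_subset _ _)
        ⟨z, mem_connectedComponentIn hzF, hzG.1⟩ hzV
        ⟨z₀, mem_connectedComponentIn hz₀F, hz₀U⟩ hz₀V)
      refine absurd ?_ hzG.2
      rw [connectedComponentIn_eq hw₀, ← connectedComponentIn_eq hw]
      exact mem_connectedComponentIn hzF
    · push Not at hz
      refine ⟨U, hU, V, hV, fun z hzU hzF hzV => ?_⟩
      rw [← connectedComponentIn_eq (hz z hzU hzF hzV)]
      exact mem_connectedComponentIn hzF
  choose! G hGx V hV hGV using hG
  obtain ⟨t, ht⟩ := (isClosed_frontier.isCompact : IsCompact (frontier F)).elim_nhds_subcover'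
    (fun y _ => V y) hV
  filter_upwards [hx, (Filter.biInter_finset_mem t).2 fun y _ => hGx y.1 y.2] with z hzF hzG
  obtain ⟨w, hwz, hwF⟩ := hF.connectedComponentIn_inter_frontier_nonempty hne hzF
  obtain ⟨y, hy, hwy⟩ := mem_iUnion₂.1 (ht hwF)
  exact hGV y.1 y.2 z (mem_iInter₂.1 hzG y hy) hzF ⟨w, hwz, hwy⟩

/-- A continuum that embeds in a space whose points have dendrite neighborhoods has arbitrarily
small connected closed neighborhoods which are carried into dendrites. -/
theorem exists_nhds_mapsTo_dendrite {X Y : Type*} [TopologicalSpace X] [TopologicalSpace Y]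
    [CompactSpace Y] [T2Space Y] [PreconnectedSpace Y]
    (hX : ∀ x : X, ∃ N : Set X, N ∈ 𝓝 x ∧ IsDendrite N)
    {i : Y → X} (hi : Continuous i) (hinj : Function.Injective i) (x : Y) {W : Set Y}
    (hW : W ∈ 𝓝 x) :
    ∃ C ∈ 𝓝 x, C ⊆ W ∧ IsClosed C ∧ IsConnected C ∧ ∃ D : Set X, IsDendrite D ∧ MapsTo i C D := by
  obtain ⟨D, hDx, hD⟩ := hX (i x)
  obtain ⟨F, hFx, hF, hFW⟩ := exists_mem_nhds_isClosed_subset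
    (inter_mem hW (hi.continuousAt.preimage_mem_nhds (interior_mem_nhds.2 hDx)))
  have hxF := mem_of_mem_nhds hFx
  have hFD : MapsTo i F D := fun y hy => interior_subset (hFW hy).2
  have hnhds := connectedComponentIn_mem_nhds_of_not_disjoint hF hFx fun y hy hxy => by
    obtain ⟨U, hU, V, hV, hUV⟩ := hD.exists_nhds_not_disjoint hDx
      (mem_interior_iff_mem_nhds.1 (hFW hy).2) (hinj.ne hxy)
    have himg : ∀ (C : Set Y) (O : Set X), (C ∩ i ⁻¹' O).Nonempty → (i '' C ∩ O).Nonempty := by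
      rintro C O ⟨z, hzC, hzO⟩
      exact ⟨i z, mem_image_of_mem _ hzC, hzO⟩
    refine ⟨i ⁻¹' U, hi.continuousAt.preimage_mem_nhds hU, i ⁻¹' V,
      hi.continuousAt.preimage_mem_nhds hV, ?_⟩
    intro C₁ C₂ hC₁ hC₂ hC₁c hC₂c h1F h2F h1U h1V h2U h2V hdisj
    exact hUV (i '' C₁) (i '' C₂) (hC₁.image hi) (hC₂.image hi) (hC₁c.image i hi.continuousOn)
      (hC₂c.image i hi.continuousOn) ((hFD.mono_left h1F).image_subset)
      ((hFD.mono_left h2F).image_subset) (himg _ _ h1U) (himg _ _ h1V) (himg _ _ h2U)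
      (himg _ _ h2V) ((disjoint_image_iff hinj).2 hdisj)
  have hsub := connectedComponentIn_subset F x
  refine ⟨_, hnhds, fun y hy => (hFW (hsub hy)).1, ?_, isConnected_connectedComponentIn_iff.2 hxF,
    D, hD, hFD.mono_left hsub⟩
  rw [connectedComponentIn_eq_image hxF]
  exact hF.isClosedEmbedding_subtypeVal.isClosedMap _ isClosed_connectedComponent

end Subcontinua

/-- Every subcontinuum of a local dendrite is a local dendrite. -/
theorem isLocalDendrite_subcontinuum
    {X : Type u} [TopologicalSpace X] (hX : IsLocalDendrite X)
    (A : Set X) (hA : IsContinuum A) :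
    IsLocalDendrite A := by
  refine ⟨hA, fun x => ?_⟩
  obtain ⟨-, _, _, _⟩ := hA
  obtain ⟨C, hC, -, hCcl, hCc, D, hD, hCD⟩ := exists_nhds_mapsTo_dendrite hX.2
    continuous_subtype_val Subtype.val_injective x univ_mem
  have hCcomp : CompactSpace C := isCompact_iff_compactSpace.1 hCcl.isCompact
  have hCconn : ConnectedSpace C := isConnected_iff_connectedSpace.1 hCc
  set i : C → X := fun c => c.1.1 with hi
  have hicont : Continuous i := continuous_subtype_val.comp continuous_subtype_val
  have hiinj : Function.Injective i := Subtype.val_injective.comp Subtype.val_injective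
  refine ⟨C, hC, ⟨hCc.nonempty.to_subtype, hCcomp, hCconn, inferInstance⟩, ?_, fun S hS => ?_⟩
  · refine locallyConnectedSpace_iff_connected_subsets.2 fun c W hW => ?_
    obtain ⟨E, hE, hEW, -, hEc, -⟩ := exists_nhds_mapsTo_dendrite hX.2 hicont hiinj c hW
    exact ⟨E, hE, hEc.isPreconnected, hEW⟩
  · obtain ⟨F, hF, hFinj⟩ := exists_isSimpleClosedCurve_iff.1 ⟨S, hS⟩
    obtain ⟨⟨-, -, -, _⟩, -, hDS⟩ := hD
    obtain ⟨T, hT⟩ := (exists_isSimpleClosedCurve_iff (X := D)).2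
      ⟨fun c => ⟨i (F c), hCD (F c).2⟩, (hicont.comp hF).subtype_mk _,
        fun a b hab => by
          have h := Subtype.ext_iff.1 hab
          exact hFinj (hiinj h)⟩
    exact hDS T hT
end

section
/- Let U be a nonempty connected open subset of a local dendrite. Then U is simply connected if and only if U contains no simple closed curve. -/
open Topology

open Set Filter Metric

section CoarsePaths

variable {Y : Type*} [MetricSpace Y]

/-- The jump of `f` at each point is less than `δ`. -/
def JumpLT (f : ℝ → Y) (δ : ℝ) : Prop :=
  ∀ t, ∀ᶠ s in 𝓝 t, dist (f s) (f t) < δ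

theorem JumpLT.const (y : Y) {δ : ℝ} (hδ : 0 < δ) : JumpLT (fun _ => y) δ := fun t => by
  simp [hδ]

theorem JumpLT.glue {f g : ℝ → Y} {δ b : ℝ} (hf : JumpLT f δ) (hg : JumpLT g δ)
    (h : f b = g b) : JumpLT (fun s => if s ≤ b then f s else g s) δ := by
  intro t
  rcases lt_trichotomy t b with ht | rfl | ht
  · filter_upwards [hf t, Iio_mem_nhds ht] with s hs hsb
    simpa [(show s < b from hsb).le, ht.le] using hs
  · filter_upwards [hf t, hg t] with s hs hs'
    by_cases hst : s ≤ t
    · simpa [hst] using hs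
    · simpa [hst, h] using hs'
  · filter_upwards [hg t, Ioi_mem_nhds ht] with s hs hsb
    simpa [not_le.2 (show b < s from hsb), not_le.2 ht] using hs

theorem JumpLT.step {x y : Y} {δ : ℝ} (hδ : 0 < δ) (h : dist x y < δ) (b : ℝ) :
    JumpLT (fun s => if s < b then x else y) δ := by
  intro t
  refine Eventually.of_forall fun s => ?_
  dsimp only
  split_ifs <;> simp [hδ, h, dist_comm y x]

theorem IsPreconnected.exists_jumpLT {C : Set Y} (hC : IsPreconnected C) {x y : Y} (hx : x ∈ C)
    (hy : y ∈ C) {δ : ℝ} (hδ : 0 < δ) {a b : ℝ} (hab : a < b) :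
    ∃ h : ℝ → Y, JumpLT h δ ∧ h a = x ∧ h b = y ∧ ∀ s, h s ∈ C := by
  let P : Y → Y → Prop := fun x y => ∀ a b : ℝ, a < b →
    ∃ h : ℝ → Y, JumpLT h δ ∧ h a = x ∧ h b = y ∧ ∀ s, h s ∈ C
  have base : ∀ x ∈ C, ∀ y ∈ C, dist x y < δ → P x y := by
    intro x hx y hy hxy a b hab
    refine ⟨_, JumpLT.step hδ hxy b, by simp [hab], by simp, fun s => ?_⟩
    split_ifs <;> assumption
  refine hC.induction₂' P (fun z hz => ?_) (fun x y z _ _ _ hxy hyz a b hab => ?_) hx hy a b hab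
  · filter_upwards [mem_nhdsWithin_of_mem_nhds (ball_mem_nhds z hδ), self_mem_nhdsWithin]
      with w hw hwC
    exact ⟨base z hz w hwC (by rwa [dist_comm]), base w hwC z hz hw⟩
  · obtain ⟨m, ham, hmb⟩ := exists_between hab
    obtain ⟨f, hf, hfa, hfm, hfC⟩ := hxy a m ham
    obtain ⟨g, hg, hgm, hgb, hgC⟩ := hyz m b hmb
    refine ⟨_, hf.glue hg (hfm.trans hgm.symm), by simp [ham.le, hfa], by simp [hmb, hgb], ?_⟩
    intro s
    split_ifs <;> simp_all

/-- If `δ`-balls lie in connected sets of size `ε`, a coarse path with jumps less than `δ` can be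
approximated by coarse paths with arbitrarily small jumps. -/
theorem JumpLT.refine {δ ε δ' : ℝ} (hδ' : 0 < δ')
    (hC : ∀ w : Y, ∃ C, IsPreconnected C ∧ ball w δ ⊆ C ∧ C ⊆ ball w ε)
    {f : ℝ → Y} (hf : JumpLT f δ) :
    ∃ g, JumpLT g δ' ∧ g 0 = f 0 ∧ g 1 = f 1 ∧ ∀ s ∈ Icc (0 : ℝ) 1, dist (g s) (f s) < 2 * ε := by
  have hε : 0 < ε := by
    obtain ⟨C, -, h2, h3⟩ := hC (f 0)
    exact pos_of_mem_ball (h3 (h2 (mem_ball.2 (hf 0).self_of_nhds)))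
  have hloc : ∀ t : ℝ, ∃ V, IsOpen V ∧ t ∈ V ∧ ∀ s ∈ V, dist (f s) (f t) < δ := by
    intro t
    obtain ⟨V, h1, h2, h3⟩ := _root_.eventually_nhds_iff.1 (hf t)
    exact ⟨V, h2, h3, h1⟩
  choose V hVo hVm hV using hloc
  obtain ⟨t, ht0, htm, ⟨m, hm⟩, hsub⟩ := exists_monotone_Icc_subset_open_cover_Icc
    (zero_le_one (α := ℝ)) (c := fun i : ℝ => ((↑) : Icc (0 : ℝ) 1 → ℝ) ⁻¹' V i)
    (fun i => (hVo i).preimage continuous_subtype_val)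
    (fun s _ => mem_iUnion.2 ⟨s, hVm s⟩)
  have key : ∀ n, ∃ g, JumpLT g δ' ∧ g 0 = f 0 ∧ g (t n) = f (t n) ∧
      ∀ s ∈ Icc (0 : ℝ) (t n), dist (g s) (f s) < 2 * ε := by
    intro n
    induction n with
    | zero =>
      refine ⟨fun _ => f 0, JumpLT.const _ hδ', rfl, by rw [ht0], fun s hs => ?_⟩
      have : s = 0 := le_antisymm (ht0 ▸ hs.2) hs.1
      simp [this, hε]
    | succ n ih =>
      obtain ⟨g, hg, hg0, hgn, hgd⟩ := ih
      rcases (htm n.le_succ).eq_or_lt with heq | hlt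
      · exact ⟨g, hg, hg0, by rw [← heq, hgn], by rwa [← heq]⟩
      obtain ⟨i, hi⟩ := hsub n
      obtain ⟨C, hCc, hC1, hC2⟩ := hC (f i)
      have hfC : ∀ s ∈ Icc (t n : ℝ) (t (n + 1)), f s ∈ C := fun s hs =>
        hC1 (hV i s (@hi ⟨s, (t n).2.1.trans hs.1, hs.2.trans (t (n + 1)).2.2⟩ hs))
      have hlt' : (t n : ℝ) < t (n + 1) := hlt
      obtain ⟨h, hh, hha, hhb, hhC⟩ := hCc.exists_jumpLT
        (hfC _ (left_mem_Icc.2 hlt'.le)) (hfC _ (right_mem_Icc.2 hlt'.le)) hδ' hlt'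
      refine ⟨_, hg.glue hh (hgn.trans hha.symm), by simp [(t n).2.1, hg0],
        by simp [hlt, hhb], fun s hs => ?_⟩
      split_ifs with hsn
      · exact hgd s ⟨hs.1, hsn⟩
      · have h1 := hC2 (hhC s)
        have h2 := hC2 (hfC s ⟨(not_le.1 hsn).le, hs.2⟩)
        rw [mem_ball] at h1 h2
        linarith [dist_triangle_right (h s) (f s) (f i)]
  obtain ⟨g, hg, hg0, hg1, hgd⟩ := key m
  rw [hm m le_rfl] at hg1 hgd
  exact ⟨g, hg, hg0, hg1, hgd⟩

theorem exists_ball_subset_preconnected [CompactSpace Y] [LocallyConnectedSpace Y] {ε : ℝ}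
    (hε : 0 < ε) :
    ∃ δ > 0, ∀ w : Y, ∃ C, IsPreconnected C ∧ ball w δ ⊆ C ∧ C ⊆ ball w ε := by
  have h : ∀ z : Y, ∃ V ⊆ ball z (ε / 2), IsOpen V ∧ z ∈ V ∧ IsConnected V := fun z =>
    locallyConnectedSpace_iff_subsets_isOpen_isConnected.1 inferInstance z _
      (ball_mem_nhds z (half_pos hε))
  choose V hVb hVo hVm hVc using h
  obtain ⟨δ, hδ, H⟩ := lebesgue_number_lemma_of_metric isCompact_univ hVo
    (fun z _ => mem_iUnion.2 ⟨z, hVm z⟩)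
  refine ⟨δ, hδ, fun w => ?_⟩
  obtain ⟨i, hi⟩ := H w trivial
  refine ⟨V i, (hVc i).isPreconnected, hi, fun y hy => ?_⟩
  have h1 := hVb i hy
  have h2 := hVb i (hi (mem_ball_self hδ))
  rw [mem_ball] at *
  linarith [dist_triangle_right y w i]

/-- Points close to `x` in a locally connected compact metric space are joined to `x` by a path
near `x`. -/
theorem exists_ball_joinedIn [CompactSpace Y] [LocallyConnectedSpace Y] (x : Y) {ε : ℝ}
    (hε : 0 < ε) : ∃ δ > 0, ∀ y ∈ ball x δ, JoinedIn (ball x ε) x y := by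
  have hεk : ∀ k : ℕ, 0 < ε / 16 / 2 ^ k := fun k => by positivity
  choose δ hδ hδC using fun k => exists_ball_subset_preconnected (Y := Y) (hεk k)
  refine ⟨min (δ 0) (ε / 2), lt_min (hδ 0) (half_pos hε), fun y hy => ?_⟩
  have hy0 : dist x y < δ 0 := by
    rw [dist_comm]; exact (mem_ball.1 hy).trans_le (min_le_left _ _)
  have hyε : dist y x < ε / 2 := (mem_ball.1 hy).trans_le (min_le_right _ _)
  have step : ∀ k (f : ℝ → Y), ∃ g : ℝ → Y, JumpLT f (δ k) → (JumpLT g (δ (k + 1)) ∧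
      g 0 = f 0 ∧ g 1 = f 1 ∧ ∀ s ∈ Icc (0 : ℝ) 1, dist (g s) (f s) < 2 * (ε / 16 / 2 ^ k)) := by
    intro k f
    by_cases hf : JumpLT f (δ k)
    · obtain ⟨g, hg⟩ := hf.refine (hδ (k + 1)) (hδC k)
      exact ⟨g, fun _ => hg⟩
    · exact ⟨f, fun h => absurd h hf⟩
  choose G hG using step
  let F : ℕ → ℝ → Y := fun n => Nat.rec (fun s => if s < 1 then x else y) (fun k f => G k f) n
  have hFj : ∀ n, JumpLT (F n) (δ n) := by
    intro n
    induction n with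
    | zero => exact JumpLT.step (hδ 0) hy0 1
    | succ n ih => exact (hG n (F n) ih).1
  have hF0 : ∀ n, F n 0 = x := by
    intro n
    induction n with
    | zero => simp [F]
    | succ n ih => exact ((hG n (F n) (hFj n)).2.1).trans ih
  have hF1 : ∀ n, F n 1 = y := by
    intro n
    induction n with
    | zero => simp [F]
    | succ n ih => exact ((hG n (F n) (hFj n)).2.2.1).trans ih
  have hFd : ∀ s ∈ Icc (0 : ℝ) 1, ∀ n, dist (F n s) (F (n + 1) s) ≤ ε / 4 / 2 / 2 ^ n := by
    intro s hs n
    rw [dist_comm]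
    refine ((hG n (F n) (hFj n)).2.2.2 s hs).le.trans (le_of_eq ?_)
    ring
  have hlim : ∀ s : ℝ, ∃ l, s ∈ Icc (0 : ℝ) 1 → Tendsto (fun n => F n s) atTop (𝓝 l) := by
    intro s
    by_cases hs : s ∈ Icc (0 : ℝ) 1
    · obtain ⟨l, hl⟩ := cauchySeq_tendsto_of_complete (cauchySeq_of_le_geometric_two (hFd s hs))
      exact ⟨l, fun _ => hl⟩
    · exact ⟨x, fun h => absurd h hs⟩
  choose L hL using hlim
  have hLd : ∀ s ∈ Icc (0 : ℝ) 1, ∀ n, dist (F n s) (L s) ≤ ε / 4 / 2 ^ n := fun s hs n =>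
    dist_le_of_le_geometric_two_of_tendsto (hFd s hs) (hL s hs) n
  have hLx : L 0 = x := tendsto_nhds_unique (hL 0 (by simp)) (by simp [hF0])
  have hLy : L 1 = y := tendsto_nhds_unique (hL 1 (by simp)) (by simp [hF1])
  have hLc : ContinuousOn L (Icc 0 1) := by
    intro t ht
    rw [ContinuousWithinAt, Metric.tendsto_nhds]
    intro η hη
    have hpow : Tendsto (fun n : ℕ => ε / 2 ^ n) atTop (𝓝 0) := by
      have := (tendsto_pow_atTop_nhds_zero_of_lt_one (r := (1 / 2 : ℝ)) (by norm_num)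
        (by norm_num)).const_mul ε
      simpa [div_eq_mul_inv] using this
    obtain ⟨n, hn⟩ := (hpow.eventually (gt_mem_nhds hη)).exists
    filter_upwards [self_mem_nhdsWithin, mem_nhdsWithin_of_mem_nhds (hFj n t)] with s hs hst
    obtain ⟨C, -, h1, h2⟩ := hδC n (F n t)
    have h3 : dist (F n s) (F n t) < ε / 16 / 2 ^ n := h2 (h1 (mem_ball.2 hst))
    have h4 := hLd s hs n
    have h5 := hLd t ht n
    have h6 := dist_triangle4 (L s) (F n s) (F n t) (L t)
    rw [dist_comm (L s) (F n s)] at h6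
    have h7 : ε / 16 / 2 ^ n = ε / 2 ^ n / 16 := by ring
    have h8 : ε / 4 / 2 ^ n = ε / 2 ^ n / 4 := by ring
    have h9 : 0 < ε / 2 ^ n := by positivity
    linarith
  refine JoinedIn.ofLine hLc hLx hLy ?_
  rintro _ ⟨s, hs, rfl⟩
  have h1 : dist (F 0 s) (L s) ≤ ε / 4 := by simpa using hLd s hs 0
  have h2 : dist (F 0 s) x < ε / 2 := by
    change dist (if s < 1 then x else y) x < ε / 2
    split_ifs
    · simpa using half_pos hε
    · exact hyε
  rw [mem_ball]
  linarith [dist_triangle_left (L s) x (F 0 s)]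

theorem LocallyPathConnectedSpace.of_compact_metrizable (Y : Type*) [TopologicalSpace Y]
    [CompactSpace Y] [TopologicalSpace.MetrizableSpace Y] [LocallyConnectedSpace Y] :
    LocallyPathConnectedSpace Y := by
  let := TopologicalSpace.metrizableSpaceMetric Y
  refine ⟨fun x => hasBasis_self.2 fun t ht => ?_⟩
  obtain ⟨ε, hε, hεt⟩ := Metric.mem_nhds_iff.1 ht
  obtain ⟨δ, hδ, h⟩ := exists_ball_joinedIn x hε
  exact ⟨pathComponentIn t x, mem_of_superset (ball_mem_nhds x hδ) fun y hy => (h y hy).mono hεt,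
    isPathConnected_pathComponentIn (mem_of_mem_nhds ht), pathComponentIn_subset⟩

end CoarsePaths

theorem LocallyPathConnectedSpace.of_nhds {X : Type*} [TopologicalSpace X]
    (h : ∀ x : X, ∃ N ∈ 𝓝 x, LocallyPathConnectedSpace N) : LocallyPathConnectedSpace X := by
  refine ⟨fun x => hasBasis_self.2 fun t ht => ?_⟩
  obtain ⟨N, hN, hlpc⟩ := h x
  have hx : x ∈ N := mem_of_mem_nhds hN
  obtain ⟨V, ⟨hV, hVp⟩, hVt⟩ := (path_connected_basis (⟨x, hx⟩ : N)).mem_iff.1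
    (continuous_subtype_val.continuousAt.preimage_mem_nhds ht)
  refine ⟨(↑) '' V, ?_, hVp.image continuous_subtype_val,
    image_subset_iff.2 (show V ⊆ ((↑) ⁻¹' t : Set N) from hVt)⟩
  rw [← map_nhds_subtype_coe_eq_nhds hx hN]
  exact image_mem_map hV

section SizeFunction

variable {Y : Type*} [MetricSpace Y] [TopologicalSpace.SeparableSpace Y] [Nonempty Y]

/-- A size function: strictly monotone on nonempty closed sets and continuous for the Hausdorff
distance. -/
noncomputable def setSize (A : Set Y) : ℝ :=
  ∑' n : ℕ, (1 / 2 : ℝ) ^ n * (1 + infDist (TopologicalSpace.denseSeq Y n) A)⁻¹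

theorem setSize_summable (A : Set Y) :
    Summable fun n : ℕ => (1 / 2 : ℝ) ^ n * (1 + infDist (TopologicalSpace.denseSeq Y n) A)⁻¹ := by
  refine Summable.of_nonneg_of_le (fun n => ?_) (fun n => ?_) summable_geometric_two
  · have := infDist_nonneg (x := TopologicalSpace.denseSeq Y n) (s := A)
    positivity
  · have := infDist_nonneg (x := TopologicalSpace.denseSeq Y n) (s := A)
    exact mul_le_of_le_one_right (by positivity) (inv_le_one_of_one_le₀ (by linarith))

theorem setSize_le_add {A B : Set Y} (hA : A.Nonempty) {ε : ℝ} (hε : 0 ≤ ε)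
    (h : ∀ a ∈ A, ∃ b ∈ B, dist a b ≤ ε) : setSize A ≤ setSize B + 2 * ε := by
  have h2 : setSize B + 2 * ε = ∑' n : ℕ, ((1 / 2 : ℝ) ^ n *
      (1 + infDist (TopologicalSpace.denseSeq Y n) B)⁻¹ + (1 / 2 : ℝ) ^ n * ε) := by
    rw [(setSize_summable B).tsum_add (summable_geometric_two.mul_right ε), tsum_mul_right,
      tsum_geometric_two, setSize]
  rw [h2]
  refine (setSize_summable A).tsum_le_tsum (fun n => ?_)
    ((setSize_summable B).add (summable_geometric_two.mul_right ε))
  rw [← mul_add]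
  refine mul_le_mul_of_nonneg_left ?_ (by positivity)
  set q := TopologicalSpace.denseSeq Y n
  have hu := infDist_nonneg (x := q) (s := A)
  have hv := infDist_nonneg (x := q) (s := B)
  have huv : infDist q B ≤ infDist q A + ε := by
    rw [← sub_le_iff_le_add]
    refine (le_infDist hA).2 fun a ha => ?_
    obtain ⟨b, hb, hab⟩ := h a ha
    have := infDist_le_dist_of_mem (x := q) hb
    linarith [dist_triangle q a b]
  set u := infDist q A
  set v := infDist q B
  rw [← sub_le_iff_le_add', inv_sub_inv (by positivity) (by positivity),
    div_le_iff₀ (by positivity)]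
  nlinarith [mul_nonneg hε hu, mul_nonneg hε hv, mul_nonneg (mul_nonneg hε hu) hv]

theorem setSize_mono {A B : Set Y} (hA : A.Nonempty) (h : A ⊆ B) : setSize A ≤ setSize B := by
  simpa using setSize_le_add hA le_rfl fun a ha => ⟨a, h ha, (dist_self a).le⟩

theorem setSize_lt {A B : Set Y} (hA : A.Nonempty) (hAc : IsClosed A) (h : A ⊆ B) {b : Y}
    (hb : b ∈ B) (hbA : b ∉ A) : setSize A < setSize B := by
  have hr : 0 < infDist b A := (hAc.notMem_iff_infDist_pos hA).1 hbA
  obtain ⟨n, hn⟩ := (TopologicalSpace.denseRange_denseSeq Y).exists_dist_lt b (half_pos hr)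
  have hanti : ∀ q : Y, infDist q B ≤ infDist q A := fun q => infDist_le_infDist_of_subset h hA
  refine (setSize_summable A).tsum_lt_tsum (i := n) (fun n => ?_) ?_ (setSize_summable B)
  · have := infDist_nonneg (x := TopologicalSpace.denseSeq Y n) (s := B)
    have := hanti (TopologicalSpace.denseSeq Y n)
    gcongr
  · set q := TopologicalSpace.denseSeq Y n
    have h0 := infDist_nonneg (x := q) (s := B)
    have h1 : infDist q B ≤ dist q b := infDist_le_dist_of_mem hb
    have h2 : infDist b A ≤ infDist q A + dist b q := infDist_le_infDist_add_dist
    rw [dist_comm] at h1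
    have : infDist q B < infDist q A := by linarith
    gcongr

end SizeFunction

section Arcs

/-- A minimal closed set of parameters over whose gaps a path takes equal values at both ends. -/
theorem exists_closed_gaps {Y : Type*} [TopologicalSpace Y] [T2Space Y] {γ : ℝ → Y}
    (hγ : ContinuousOn γ (Icc 0 1)) :
    ∃ C ⊆ Icc (0 : ℝ) 1, IsClosed C ∧ 0 ∈ C ∧ 1 ∈ C ∧ ∀ s ∈ C, ∀ t ∈ C, s < t →
      (γ s = γ t ↔ ∀ c ∈ C, c ≤ s ∨ t ≤ c) := by
  let S : Set (Set ℝ) := {C | C ⊆ Icc (0 : ℝ) 1 ∧ IsClosed C ∧ 0 ∈ C ∧ 1 ∈ C ∧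
    ∀ s ∈ C, ∀ t ∈ C, s < t → (∀ c ∈ C, c ≤ s ∨ t ≤ c) → γ s = γ t}
  obtain ⟨C, ⟨hC01, hCc, h0, h1, hgap⟩, hmin⟩ : ∃ C, Minimal (· ∈ S) C := by
    refine zorn_superset S fun c hcS hc => ?_
    rcases c.eq_empty_or_nonempty with rfl | hcne
    · refine ⟨Icc 0 1, ⟨Subset.rfl, isClosed_Icc, by simp, by simp, fun s hs t ht hst h => ?_⟩,
        by simp⟩
      obtain ⟨m, h1, h2⟩ := exists_between hst
      rcases h m ⟨hs.1.trans h1.le, h2.le.trans ht.2⟩ with h | h <;> linarith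
    · obtain ⟨C₀, hC₀⟩ := hcne
      refine ⟨⋂₀ c, ⟨(sInter_subset_of_mem hC₀).trans (hcS hC₀).1,
        isClosed_sInter fun C hC => (hcS hC).2.1, fun C hC => (hcS hC).2.2.1,
        fun C hC => (hcS hC).2.2.2.1, fun a ha b hb hab hg => ?_⟩, fun C hC => sInter_subset_of_mem hC⟩
      by_contra hne
      have ha01 := (hcS hC₀).1 (ha _ hC₀)
      have hb01 := (hcS hC₀).1 (hb _ hC₀)
      obtain ⟨U, V, hU, hV, haU, hbV, hUV⟩ := t2_separation hne
      obtain ⟨ε₁, hε₁, hUε⟩ := Metric.mem_nhdsWithin_iff.1 (hγ a ha01 (hU.mem_nhds haU))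
      obtain ⟨ε₂, hε₂, hVε⟩ := Metric.mem_nhdsWithin_iff.1 (hγ b hb01 (hV.mem_nhds hbV))
      obtain ⟨m, ham, hmb⟩ := exists_between hab
      obtain ⟨a₁, haa₁, ha₁⟩ := exists_between (lt_min ham (lt_add_of_pos_right a hε₁))
      obtain ⟨b₁, hb₁, hbb₁⟩ := exists_between (max_lt hmb (sub_lt_self b hε₂))
      rw [lt_min_iff] at ha₁
      rw [max_lt_iff] at hb₁
      obtain ⟨C, hC, hCe⟩ : ∃ C ∈ c, Icc a₁ b₁ ∩ C = ∅ := by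
        by_contra! hcon
        have : Nonempty c := ⟨⟨C₀, hC₀⟩⟩
        obtain ⟨x, hx⟩ := IsCompact.nonempty_iInter_of_directed_nonempty_isCompact_isClosed
          (fun C : c => Icc a₁ b₁ ∩ C)
          (fun C D => by
            rcases hc.total C.2 D.2 with h | h
            · exact ⟨C, Subset.rfl, inter_subset_inter_right _ h⟩
            · exact ⟨D, inter_subset_inter_right _ h, Subset.rfl⟩)
          (fun C => hcon C C.2)
          (fun C => isCompact_Icc.inter_right (hcS C.2).2.1)
          (fun C => isClosed_Icc.inter (hcS C.2).2.1)
        simp only [mem_iInter, mem_inter_iff, mem_Icc] at hx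
        have hxa := (hx ⟨C₀, hC₀⟩).1
        rcases hg x (fun C hC => (hx ⟨C, hC⟩).2) with h | h <;> linarith
      obtain ⟨hC01, hCc, -, -, hCg⟩ := hcS hC
      obtain ⟨a', ⟨ha'C, ha'⟩, ha'max⟩ := (isCompact_Icc (a := a) (b := a₁)).inter_left hCc
        |>.exists_isGreatest ⟨a, ha C hC, le_rfl, haa₁.le⟩
      obtain ⟨b', ⟨hb'C, hb'⟩, hb'min⟩ := (isCompact_Icc (a := b₁) (b := b)).inter_left hCc
        |>.exists_isLeast ⟨b, hb C hC, hbb₁.le, le_rfl⟩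
      have hab' : γ a' = γ b' := by
        refine hCg a' ha'C b' hb'C (by linarith [ha'.2, hb'.1]) fun x hx => ?_
        by_contra! hx'
        rcases le_or_gt x a₁ with h | h
        · linarith [ha'max ⟨hx, ha'.1.trans hx'.1.le, h⟩]
        rcases le_or_gt b₁ x with h' | h'
        · linarith [hb'min ⟨hx, h', hx'.2.le.trans hb'.2⟩]
        · exact (hCe ▸ (⟨⟨h.le, h'.le⟩, hx⟩ : x ∈ Icc a₁ b₁ ∩ C) : x ∈ (∅ : Set ℝ))
      refine disjoint_left.1 hUV (hUε ⟨?_, hC01 ha'C⟩) (hab' ▸ hVε ⟨?_, hC01 hb'C⟩)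
      · rw [mem_ball, Real.dist_eq, abs_lt]
        constructor <;> linarith [ha'.1, ha'.2]
      · rw [mem_ball, Real.dist_eq, abs_lt]
        constructor <;> linarith [hb'.1, hb'.2]
  refine ⟨C, hC01, hCc, h0, h1, fun s hs t ht hst => ⟨fun heq c hc => ?_, hgap s hs t ht hst⟩⟩
  have hC' : C \ Ioo s t ∈ S := by
    refine ⟨sdiff_subset.trans hC01, hCc.sdiff isOpen_Ioo, ⟨h0, fun h => ?_⟩,
      ⟨h1, fun h => ?_⟩, fun a ha b hb hab hg => ?_⟩
    · exact absurd h.1 (not_lt.2 (hC01 hs).1)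
    · exact absurd h.2 (not_lt.2 (hC01 ht).2)
    · by_cases hgC : ∀ c ∈ C, c ≤ a ∨ b ≤ c
      · exact hgap a ha.1 b hb.1 hab hgC
      push Not at hgC
      obtain ⟨c, hc, hac, hcb⟩ := hgC
      have hcst : c ∈ Ioo s t := by
        by_contra hcn
        rcases hg c ⟨hc, hcn⟩ with h | h <;> linarith
      have hs' := hg s ⟨hs, fun h => lt_irrefl _ h.1⟩
      have ht' := hg t ⟨ht, fun h => lt_irrefl _ h.2⟩
      have h1 : s ≤ a := hs'.resolve_right (not_le.2 (hcst.1.trans hcb))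
      have h2 : b ≤ t := ht'.resolve_left (not_le.2 (hac.trans hcst.2))
      have h3 : a = s := by
        by_contra hn
        exact ha.2 ⟨lt_of_le_of_ne h1 (Ne.symm hn), hac.trans hcst.2⟩
      have h4 : b = t := by
        by_contra hn
        exact hb.2 ⟨hcst.1.trans hcb, lt_of_le_of_ne h2 hn⟩
      rw [h3, h4, heq]
  have := (hmin hC' sdiff_subset hc).2
  by_contra! h
  exact this h

/-- The image of a path between distinct points contains an arc between these points. -/
theorem exists_arc_of_path {Y : Type*} [MetricSpace Y] [TopologicalSpace.SeparableSpace Y]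
    {γ : ℝ → Y} (hγ : ContinuousOn γ (Icc 0 1)) (hne : γ 0 ≠ γ 1) :
    ∃ α : ℝ → Y, ContinuousOn α (Icc 0 1) ∧ InjOn α (Icc 0 1) ∧ α 0 = γ 0 ∧ α 1 = γ 1 ∧
      MapsTo α (Icc 0 1) (γ '' Icc 0 1) := by
  obtain ⟨C, hC01, hCc, h0, h1, hC⟩ := exists_closed_gaps hγ
  have : Nonempty Y := ⟨γ 0⟩
  have hCk : IsCompact C := isCompact_Icc.of_isClosed_subset hCc hC01
  let A : ℝ → Set Y := fun c => γ '' (C ∩ Icc 0 c)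
  let g : ℝ → ℝ := fun c => setSize (A c)
  have hAne : ∀ c ∈ C, (A c).Nonempty := fun c hc => ⟨γ 0, 0, ⟨h0, le_rfl, (hC01 hc).1⟩, rfl⟩
  have hAc : ∀ c, IsClosed (A c) := fun c =>
    ((hCk.inter_right isClosed_Icc).image_of_continuousOn
      (hγ.mono (inter_subset_left.trans hC01))).isClosed
  have hAmono : ∀ s t, s ≤ t → A s ⊆ A t := fun s t hst =>
    image_mono (inter_subset_inter_right _ (Icc_subset_Icc_right hst))
  have hgeq : ∀ s ∈ C, ∀ t ∈ C, s < t → γ s = γ t → g s = g t := by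
    intro s hs t ht hst h
    have hgap := (hC s hs t ht hst).1 h
    suffices A s = A t by simp only [g, this]
    refine (hAmono s t hst.le).antisymm ?_
    rintro _ ⟨c, ⟨hc, hc0, hct⟩, rfl⟩
    rcases hgap c hc with h' | h'
    · exact ⟨c, ⟨hc, hc0, h'⟩, rfl⟩
    · exact ⟨s, ⟨hs, (hC01 hs).1, le_rfl⟩, by rw [h, le_antisymm hct h']⟩
  have hglt : ∀ s ∈ C, ∀ t ∈ C, s < t → γ s ≠ γ t → g s < g t := by
    intro s hs t ht hst h
    refine setSize_lt (hAne s hs) (hAc s) (hAmono s t hst.le)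
      ⟨t, ⟨ht, (hC01 ht).1, le_rfl⟩, rfl⟩ ?_
    rintro ⟨s', ⟨hs', -, hs's⟩, heq⟩
    rcases (hC s' hs' t ht (hs's.trans_lt hst)).1 heq s hs with h' | h'
    · exact h (by rw [← heq, le_antisymm hs's h'])
    · linarith
  have hgmono : ∀ s ∈ C, ∀ t ∈ C, s ≤ t → g s ≤ g t := fun s hs t _ hst =>
    setSize_mono (hAne s hs) (hAmono s t hst)
  have hinj : ∀ s ∈ C, ∀ t ∈ C, γ s = γ t → g s = g t := by
    intro s hs t ht h
    rcases lt_trichotomy s t with hst | rfl | hst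
    · exact hgeq s hs t ht hst h
    · rfl
    · exact (hgeq t ht s hs hst h.symm).symm
  have hsep : ∀ s ∈ C, ∀ t ∈ C, g s = g t → γ s = γ t := by
    intro s hs t ht h
    by_contra hne
    rcases lt_trichotomy s t with hst | rfl | hst
    · exact (hglt s hs t ht hst hne).ne h
    · exact hne rfl
    · exact (hglt t ht s hs hst (Ne.symm hne)).ne h.symm
  have hgc : ContinuousOn g C := by
    have huc := isCompact_Icc.uniformContinuousOn_of_continuous hγ
    rw [Metric.uniformContinuousOn_iff] at huc
    rw [Metric.continuousOn_iff]
    intro t ht ε hε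
    obtain ⟨δ, hδ, hδε⟩ := huc (ε / 4) (by positivity)
    have key : ∀ s ∈ C, ∀ t ∈ C, s ≤ t → t - s < δ → g t ≤ g s + 2 * (ε / 4) := by
      intro s hs t ht hst hd
      refine setSize_le_add (hAne t ht) (by positivity) ?_
      rintro _ ⟨c, ⟨hc, hc0, hct⟩, rfl⟩
      rcases le_total c s with h | h
      · exact ⟨γ c, ⟨c, ⟨hc, hc0, h⟩, rfl⟩, by simp; positivity⟩
      · refine ⟨γ s, ⟨s, ⟨hs, (hC01 hs).1, le_rfl⟩, rfl⟩, (hδε _ (hC01 hc) _ (hC01 hs) ?_).le⟩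
        rw [Real.dist_eq, abs_lt]
        constructor <;> linarith
    refine ⟨δ, hδ, fun s hs hst => ?_⟩
    rw [Real.dist_eq, abs_lt] at hst ⊢
    rcases le_total s t with h | h
    · have := hgmono s hs t ht h
      have := key s hs t ht h (by linarith)
      constructor <;> linarith
    · have := hgmono t ht s hs h
      have := key t ht s hs h (by linarith)
      constructor <;> linarith
  have hsurj : ∀ v ∈ Icc (g 0) (g 1), ∃ c ∈ C, g c = v := by
    intro v hv
    obtain ⟨c, ⟨hcC, hcv⟩, hcmax⟩ := (hCk.of_isClosed_subset
      (hgc.preimage_isClosed_of_isClosed hCc isClosed_Iic) inter_subset_left).exists_isGreatest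
      ⟨0, h0, hv.1⟩
    obtain ⟨d, ⟨hdC, hdv⟩, hdmin⟩ := (hCk.of_isClosed_subset
      (hgc.preimage_isClosed_of_isClosed hCc isClosed_Ici) inter_subset_left).exists_isLeast
      ⟨1, h1, hv.2⟩
    refine ⟨c, hcC, le_antisymm hcv ?_⟩
    rcases le_or_gt d c with h | h
    · exact le_trans hdv (hgmono d hdC c hcC h)
    · refine le_trans hdv (hgeq c hcC d hdC h ((hC c hcC d hdC h).2 fun x hx => ?_)).ge
      rcases le_total (g x) v with h' | h'
      · exact Or.inl (hcmax ⟨hx, h'⟩)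
      · exact Or.inr (hdmin ⟨hx, h'⟩)
  have hg01 : g 0 < g 1 := hglt 0 h0 1 h1 one_pos hne
  choose! σ hσC hσ using hsurj
  have hαc : ContinuousOn (γ ∘ σ) (Icc (g 0) (g 1)) := by
    rw [continuousOn_iff_isClosed]
    intro F hF
    refine ⟨g '' (C ∩ γ ⁻¹' F), ?_, ?_⟩
    · exact ((hCk.of_isClosed_subset ((hγ.mono hC01).preimage_isClosed_of_isClosed hCc hF)
        inter_subset_left).image_of_continuousOn (hgc.mono inter_subset_left)).isClosed
    · ext v
      refine and_congr_left fun hv => ⟨fun h => ⟨σ v, ⟨hσC v hv, h⟩, hσ v hv⟩, ?_⟩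
      rintro ⟨c, ⟨hc, hcF⟩, rfl⟩
      change γ (σ (g c)) ∈ F
      rwa [hsep _ (hσC _ hv) c hc (hσ _ hv)]
  let ρ : ℝ → ℝ := fun u => g 0 + u * (g 1 - g 0)
  have hρ : MapsTo ρ (Icc 0 1) (Icc (g 0) (g 1)) := fun u hu => by
    simp only [ρ, mem_Icc]
    constructor <;> nlinarith [hu.1, hu.2]
  have hρ0 : ρ 0 = g 0 := by simp [ρ]
  have hρ1 : ρ 1 = g 1 := by simp [ρ]
  refine ⟨(γ ∘ σ) ∘ ρ, hαc.comp (by fun_prop) hρ, ?_, ?_, ?_, ?_⟩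
  · intro u hu v hv huv
    have := hinj _ (hσC _ (hρ hu)) _ (hσC _ (hρ hv)) huv
    rw [hσ _ (hρ hu), hσ _ (hρ hv)] at this
    have h2 : u * (g 1 - g 0) = v * (g 1 - g 0) := by simpa [ρ] using this
    exact mul_right_cancel₀ (sub_pos.2 hg01).ne' h2
  · have h := left_mem_Icc.2 hg01.le
    simpa [hρ0] using hsep _ (hσC _ h) 0 h0 (hσ _ h)
  · have h := right_mem_Icc.2 hg01.le
    simpa [hρ1] using hsep _ (hσC _ h) 1 h1 (hσ _ h)
  · exact fun u hu => ⟨_, hC01 (hσC _ (hρ hu)), rfl⟩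

end Arcs

section Circles

theorem isSimpleClosedCurve_range {X : Type*} [TopologicalSpace X] [T2Space X]
    {f : AddCircle (1 : ℝ) → X} (hf : Continuous f) (hinj : Function.Injective f) :
    IsSimpleClosedCurve (range f) := by
  have : Fact ((0 : ℝ) < 1) := ⟨one_pos⟩
  exact ⟨(hf.isClosedEmbedding hinj).isEmbedding.toHomeomorph.symm⟩

/-- Two arcs with common endpoints and disjoint interiors form a simple closed curve. -/
theorem exists_isSimpleClosedCurve_of_arcs {X : Type*} [TopologicalSpace X] [T2Space X]
    {α β : ℝ → X} (hα : ContinuousOn α (Icc 0 1)) (hβ : ContinuousOn β (Icc 0 1))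
    (hαi : InjOn α (Icc 0 1)) (hβi : InjOn β (Icc 0 1)) (h0 : α 0 = β 0) (h1 : α 1 = β 1)
    (hd : ∀ u ∈ Ioo (0 : ℝ) 1, ∀ v ∈ Icc (0 : ℝ) 1, α u ≠ β v) :
    ∃ S ⊆ α '' Icc 0 1 ∪ β '' Icc 0 1, IsSimpleClosedCurve S := by
  have : Fact ((0 : ℝ) < 1) := ⟨one_pos⟩
  let φ : ℝ → X := fun t => if t ≤ 1 / 2 then α (2 * t) else β (2 - 2 * t)
  have hφ1 : ∀ t ≤ 1 / 2, φ t = α (2 * t) := fun t ht => if_pos ht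
  have hφ2 : ∀ t, 1 / 2 < t → φ t = β (2 - 2 * t) := fun t ht => if_neg (not_le.2 ht)
  have hφ2' : ∀ t, 1 / 2 ≤ t → φ t = β (2 - 2 * t) := fun t ht => by
    rcases ht.eq_or_lt with rfl | ht
    · rw [hφ1 _ le_rfl]; norm_num [h1]
    · exact hφ2 t ht
  have hφc : ContinuousOn φ (Icc 0 1) := by
    have : Icc (0 : ℝ) 1 = Icc 0 (1 / 2) ∪ Icc (1 / 2) 1 :=
      (Icc_union_Icc_eq_Icc (by norm_num) (by norm_num)).symm
    rw [this]
    refine ContinuousOn.union_of_isClosed ?_ ?_ isClosed_Icc isClosed_Icc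
    · refine (hα.comp (f := fun t : ℝ => 2 * t) (by fun_prop) fun t ht => ?_).congr
        fun t ht => hφ1 t ht.2
      constructor <;> linarith [ht.1, ht.2]
    · refine (hβ.comp (f := fun t : ℝ => 2 - 2 * t) (by fun_prop) fun t ht => ?_).congr
        fun t ht => hφ2' t ht.1
      constructor <;> linarith [ht.1, ht.2]
  have hφi : InjOn φ (Ico 0 1) := by
    have hmix : ∀ s ∈ Ico (0 : ℝ) 1, ∀ t ∈ Ico (0 : ℝ) 1, s ≤ 1 / 2 → 1 / 2 < t →
        φ s ≠ φ t := by
      intro s hs t ht hs2 ht2 h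
      rw [hφ1 s hs2, hφ2 t ht2] at h
      have htm : 2 - 2 * t ∈ Icc (0 : ℝ) 1 := by constructor <;> linarith [ht.2]
      rcases hs.1.eq_or_lt with rfl | hs0
      · rw [mul_zero, h0] at h
        have := hβi (by simp) htm h
        linarith [ht.2]
      rcases hs2.eq_or_lt with rfl | hs2
      · norm_num [h1] at h
        have := hβi (by simp) htm h
        linarith
      · exact hd _ ⟨by linarith, by linarith⟩ _ htm h
    intro s hs t ht h
    rcases le_or_gt s (1 / 2) with hs2 | hs2 <;> rcases le_or_gt t (1 / 2) with ht2 | ht2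
    · rw [hφ1 s hs2, hφ1 t ht2] at h
      have := hαi ⟨by linarith [hs.1], by linarith⟩ ⟨by linarith [ht.1], by linarith⟩ h
      linarith
    · exact absurd h (hmix s hs t ht hs2 ht2)
    · exact absurd h.symm (hmix t ht s hs ht2 hs2)
    · rw [hφ2 s hs2, hφ2 t ht2] at h
      have := hβi ⟨by linarith [hs.2], by linarith⟩ ⟨by linarith [ht.2], by linarith⟩ h
      linarith
  have hφe : φ 0 = φ 1 := by
    rw [hφ1 0 (by norm_num), hφ2 1 (by norm_num)]; norm_num [h0]
  have hc : Continuous (AddCircle.liftIco 1 0 φ) := AddCircle.liftIco_zero_continuous hφe hφc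
  have hrep : ∀ x : AddCircle (1 : ℝ), ∃ t ∈ Ico (0 : ℝ) 1, (t : AddCircle (1 : ℝ)) = x :=
    fun x => by
      obtain ⟨t, ht, rfl⟩ := AddCircle.eq_coe_Ico x
      exact ⟨t, ht, rfl⟩
  have hi : Function.Injective (AddCircle.liftIco 1 0 φ) := by
    intro x y h
    obtain ⟨s, hs, rfl⟩ := hrep x
    obtain ⟨t, ht, rfl⟩ := hrep y
    rw [AddCircle.liftIco_zero_coe_apply hs, AddCircle.liftIco_zero_coe_apply ht] at h
    rw [hφi hs ht h]
  refine ⟨_, ?_, isSimpleClosedCurve_range hc hi⟩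
  rintro _ ⟨x, rfl⟩
  obtain ⟨t, ht, rfl⟩ := hrep x
  rw [AddCircle.liftIco_zero_coe_apply ht]
  rcases le_or_gt t (1 / 2) with ht2 | ht2
  · rw [hφ1 t ht2]
    exact Or.inl ⟨_, ⟨by linarith [ht.1], by linarith⟩, rfl⟩
  · rw [hφ2 t ht2]
    exact Or.inr ⟨_, ⟨by linarith [ht.2], by linarith⟩, rfl⟩

/-- In the absence of simple closed curves, an arc lies in every path-connected set containing its
endpoints. -/
theorem IsPathConnected.image_arc_subset {X : Type*} [MetricSpace X]
    [TopologicalSpace.SeparableSpace X] {D A : Set X}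
    (hD : ∀ S ⊆ D, ¬ IsSimpleClosedCurve S) (hA : IsPathConnected A) (hAD : A ⊆ D)
    {α : ℝ → X} {a b : ℝ} (hα : ContinuousOn α (Icc a b)) (hαi : InjOn α (Icc a b))
    (hαD : MapsTo α (Icc a b) D) (ha : α a ∈ A) (hb : α b ∈ A) : α '' Icc a b ⊆ A := by
  rintro _ ⟨s₀, hs₀, rfl⟩
  by_contra hs₀A
  obtain ⟨β, hβ⟩ := hA.joinedIn _ ha _ hb
  have : PathConnectedSpace unitInterval :=
    isPathConnected_iff_pathConnectedSpace.1
      ((convex_Icc 0 1).isPathConnected (nonempty_Icc.2 zero_le_one))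
  have hBA : range β ⊆ A := range_subset_iff.2 hβ
  have hBp : IsPathConnected (range β) := isPathConnected_range β.continuous
  have hs₀B : α s₀ ∉ range β := fun h => hs₀A (hBA h)
  have hBc : IsClosed (range β) := (isCompact_range β.continuous).isClosed
  obtain ⟨s₁, ⟨hs₁, hs₁B⟩, hs₁max⟩ := (isCompact_Icc (a := a) (b := s₀)).of_isClosed_subset
    ((hα.mono (Icc_subset_Icc_right hs₀.2)).preimage_isClosed_of_isClosed isClosed_Icc hBc)
    inter_subset_left |>.exists_isGreatest ⟨a, ⟨le_rfl, hs₀.1⟩, 0, β.source⟩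
  obtain ⟨s₂, ⟨hs₂, hs₂B⟩, hs₂min⟩ := (isCompact_Icc (a := s₀) (b := b)).of_isClosed_subset
    ((hα.mono (Icc_subset_Icc_left hs₀.1)).preimage_isClosed_of_isClosed isClosed_Icc hBc)
    inter_subset_left |>.exists_isLeast ⟨b, ⟨hs₀.2, le_rfl⟩, 1, β.target⟩
  have h1 : s₁ < s₀ := lt_of_le_of_ne hs₁.2 (by rintro rfl; exact hs₀B hs₁B)
  have h2 : s₀ < s₂ := lt_of_le_of_ne hs₂.1 (by rintro rfl; exact hs₀B hs₂B)
  have hs₁' : s₁ ∈ Icc a b := ⟨hs₁.1, hs₁.2.trans hs₀.2⟩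
  have hs₂' : s₂ ∈ Icc a b := ⟨hs₀.1.trans hs₂.1, hs₂.2⟩
  have hne : α s₁ ≠ α s₂ := fun h => (h1.trans h2).ne (hαi hs₁' hs₂' h)
  obtain ⟨γ, hγ⟩ := hBp.joinedIn _ hs₁B _ hs₂B
  obtain ⟨δ, hδc, hδi, hδ0, hδ1, hδm⟩ := exists_arc_of_path (γ := γ.extend)
    γ.continuous_extend.continuousOn (by simpa using hne)
  rw [γ.extend_zero] at hδ0
  rw [γ.extend_one] at hδ1
  have hδB : MapsTo δ (Icc 0 1) (range β) := fun u hu => by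
    obtain ⟨t, ht, h⟩ := hδm hu
    rw [← h, γ.extend_apply ht]
    exact hγ _
  let ρ : ℝ → ℝ := fun u => s₁ + u * (s₂ - s₁)
  have hρ : MapsTo ρ (Icc 0 1) (Icc a b) := fun u hu => by
    simp only [ρ, mem_Icc]
    constructor <;> nlinarith [hu.1, hu.2, hs₁'.1, hs₂'.2]
  have hαρ : InjOn (α ∘ ρ) (Icc 0 1) := fun u hu v hv huv => by
    have h3 := hαi (hρ hu) (hρ hv) huv
    have h4 : u * (s₂ - s₁) = v * (s₂ - s₁) := by simpa [ρ] using h3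
    exact mul_right_cancel₀ (sub_pos.2 (h1.trans h2)).ne' h4
  have hdisj : ∀ u ∈ Ioo (0 : ℝ) 1, ∀ v ∈ Icc (0 : ℝ) 1, (α ∘ ρ) u ≠ δ v := by
    intro u hu v hv huv
    have hB : α (ρ u) ∈ range β := by
      rw [show α (ρ u) = δ v from huv]
      exact hδB hv
    have hu1 : s₁ < ρ u := by simp only [ρ]; nlinarith [hu.1]
    have hu2 : ρ u < s₂ := by simp only [ρ]; nlinarith [hu.2]
    rcases le_total (ρ u) s₀ with h | h
    · linarith [hs₁max ⟨⟨hs₁'.1.trans hu1.le, h⟩, hB⟩]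
    · linarith [hs₂min ⟨⟨h, hu2.le.trans hs₂'.2⟩, hB⟩]
  obtain ⟨S, hS, hScc⟩ := exists_isSimpleClosedCurve_of_arcs (α := α ∘ ρ) (β := δ)
    (hα.comp (by fun_prop) hρ) hδc hαρ hδi (by simp [ρ, hδ0]) (by simp [ρ, hδ1]) hdisj
  refine hD S (hS.trans (union_subset ?_ ?_)) hScc
  · exact image_subset_iff.2 fun u hu => hαD (hρ hu)
  · exact image_subset_iff.2 fun u hu => hAD (hBA (hδB hu))

end Circles

section Contraction

variable {Y : Type*}

/-- The points lying in every path-connected set that contains both `p` and `x`. -/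
def pathHull [TopologicalSpace Y] (p x : Y) : Set Y :=
  {z | ∀ A : Set Y, IsPathConnected A → p ∈ A → x ∈ A → z ∈ A}

theorem left_mem_pathHull [TopologicalSpace Y] (p x : Y) : p ∈ pathHull p x := fun _ _ h _ => h

theorem right_mem_pathHull [TopologicalSpace Y] (p x : Y) : x ∈ pathHull p x := fun _ _ _ h => h

theorem pathHull_subset_of_mem [TopologicalSpace Y] {p x z : Y} (hz : z ∈ pathHull p x) :
    pathHull p z ⊆ pathHull p x := fun _ hw A hA hp hx => hw A hA hp (hz A hA hp hx)

theorem pathHull_self [TopologicalSpace Y] (p : Y) : pathHull p p = {p} :=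
  Subset.antisymm (fun _ hz => hz {p} (isPathConnected_singleton p) rfl rfl)
    (singleton_subset_iff.2 (left_mem_pathHull p p))

variable [MetricSpace Y] [TopologicalSpace.SeparableSpace Y]

theorem exists_pathHull_eq_image [PathConnectedSpace Y] (hY : ∀ S : Set Y, ¬ IsSimpleClosedCurve S)
    {p x : Y} (hpx : p ≠ x) : ∃ α : ℝ → Y, ContinuousOn α (Icc 0 1) ∧ InjOn α (Icc 0 1) ∧
      ∀ s ∈ Icc (0 : ℝ) 1, pathHull p (α s) = α '' Icc 0 s ∧ (s = 1 → α s = x) := by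
  let γ : Path p x := PathConnectedSpace.somePath p x
  obtain ⟨α, hα, hαi, h0, h1, -⟩ := exists_arc_of_path (γ := γ.extend)
    γ.continuous_extend.continuousOn (by simpa using hpx)
  rw [γ.extend_zero] at h0
  rw [γ.extend_one] at h1
  refine ⟨α, hα, hαi, fun s hs => ⟨Subset.antisymm ?_ ?_, by rintro rfl; exact h1⟩⟩
  · intro z hz
    refine hz _ ?_ ⟨0, ⟨le_rfl, hs.1⟩, h0⟩ ⟨s, ⟨hs.1, le_rfl⟩, rfl⟩
    exact ((convex_Icc 0 s).isPathConnected (nonempty_Icc.2 hs.1)).image'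
      (hα.mono (Icc_subset_Icc_right hs.2))
  · intro z hz A hA hpA hsA
    exact IsPathConnected.image_arc_subset (D := univ) (fun S _ => hY S) hA (subset_univ _)
      (hα.mono (Icc_subset_Icc_right hs.2)) (hαi.mono (Icc_subset_Icc_right hs.2))
      (mapsTo_univ _ _) (h0.symm ▸ hpA) hsA hz

theorem isCompact_isPathConnected_pathHull [PathConnectedSpace Y]
    (hY : ∀ S : Set Y, ¬ IsSimpleClosedCurve S) (p x : Y) :
    IsCompact (pathHull p x) ∧ IsPathConnected (pathHull p x) := by
  rcases eq_or_ne p x with rfl | hpx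
  · rw [pathHull_self]
    exact ⟨isCompact_singleton, isPathConnected_singleton p⟩
  · obtain ⟨α, hα, -, h⟩ := exists_pathHull_eq_image hY hpx
    obtain ⟨h1, h2⟩ := h 1 (by simp)
    rw [← h2 rfl, h1]
    exact ⟨isCompact_Icc.image_of_continuousOn hα,
      ((convex_Icc 0 1).isPathConnected (nonempty_Icc.2 zero_le_one)).image' hα⟩

theorem setSize_pathHull_injOn [PathConnectedSpace Y]
    (hY : ∀ S : Set Y, ¬ IsSimpleClosedCurve S) (p x : Y) :
    InjOn (fun z => setSize (pathHull p z)) (pathHull p x) := by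
  rcases eq_or_ne p x with rfl | hpx
  · rw [pathHull_self]
    exact injOn_singleton _ _
  · obtain ⟨α, hα, hαi, h⟩ := exists_pathHull_eq_image hY hpx
    obtain ⟨h1, h2⟩ := h 1 (by simp)
    rw [← h2 rfl, h1]
    have hlt : ∀ s ∈ Icc (0 : ℝ) 1, ∀ t ∈ Icc (0 : ℝ) 1, s < t →
        setSize (pathHull p (α s)) < setSize (pathHull p (α t)) := by
      intro s hs t ht hst
      refine setSize_lt ⟨p, left_mem_pathHull _ _⟩
        (isCompact_isPathConnected_pathHull hY p _).1.isClosed ?_ (right_mem_pathHull p (α t)) ?_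
      · rw [(h s hs).1, (h t ht).1]
        exact image_mono (Icc_subset_Icc_right hst.le)
      · rw [(h s hs).1]
        rintro ⟨r, hr, hrt⟩
        have := hαi ⟨hr.1, hr.2.trans hs.2⟩ ht hrt
        linarith [hr.2]
    rintro _ ⟨s, hs, rfl⟩ _ ⟨t, ht, rfl⟩ hst
    rcases lt_trichotomy s t with hlt' | rfl | hlt'
    · exact absurd hst (hlt s hs t ht hlt').ne
    · rfl
    · exact absurd hst (hlt t ht s hs hlt').ne'

theorem pathHull_subset_union [PathConnectedSpace Y]
    (hY : ∀ S : Set Y, ¬ IsSimpleClosedCurve S) {p x x' : Y} {C : Set Y}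
    (hC : IsPathConnected C) (hx : x ∈ C) (hx' : x' ∈ C) : pathHull p x' ⊆ pathHull p x ∪ C := fun _ hz =>
  hz _ ((isCompact_isPathConnected_pathHull hY p x).2.union hC ⟨x, right_mem_pathHull p x, hx⟩)
    (Or.inl (left_mem_pathHull p x)) (Or.inr hx')

theorem continuous_setSize_pathHull [PathConnectedSpace Y] [LocallyPathConnectedSpace Y]
    (hY : ∀ S : Set Y, ¬ IsSimpleClosedCurve S) (p : Y) :
    Continuous fun x => setSize (pathHull p x) := by
  have : Nonempty Y := ⟨p⟩
  rw [continuous_iff_continuousAt]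
  intro x
  rw [ContinuousAt, Metric.tendsto_nhds]
  intro ε hε
  obtain ⟨C, ⟨hCx, hC⟩, hCb⟩ := (path_connected_basis x).mem_iff.1
    (ball_mem_nhds x (show 0 < ε / 16 by linarith))
  filter_upwards [hCx] with x' hx'
  have hx := mem_of_mem_nhds hCx
  have key : ∀ y ∈ C, ∀ y' ∈ C, setSize (pathHull p y') ≤ setSize (pathHull p y) + 2 * (ε / 8) := by
    intro y hy y' hy'
    refine setSize_le_add ⟨p, left_mem_pathHull _ _⟩ (by linarith) fun a ha => ?_
    rcases pathHull_subset_union hY hC hy hy' ha with ha | ha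
    · exact ⟨a, ha, by rw [dist_self]; linarith⟩
    · refine ⟨y, right_mem_pathHull p y, ?_⟩
      have h1 := mem_ball.1 (hCb ha)
      have h2 := mem_ball.1 (hCb hy)
      linarith [dist_triangle_right a y x]
  rw [Real.dist_eq, abs_lt]
  have h1 := key x hx x' hx'
  have h2 := key x' hx' x hx
  constructor <;> linarith

/-- A point of the hull of `p` and `x` at an intermediate height. -/
theorem exists_mem_pathHull_setSize_eq [PathConnectedSpace Y] [LocallyPathConnectedSpace Y]
    (hY : ∀ S : Set Y, ¬ IsSimpleClosedCurve S) (p x : Y) (t : unitInterval) : ∃ z ∈ pathHull p x, setSize (pathHull p z) =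
      (1 - (t : ℝ)) * setSize (pathHull p p) + t * setSize (pathHull p x) := by
  have : Nonempty Y := ⟨p⟩
  have hle : setSize (pathHull p p) ≤ setSize (pathHull p x) :=
    setSize_mono ⟨p, left_mem_pathHull _ _⟩ (pathHull_subset_of_mem (left_mem_pathHull p x))
  have := (isCompact_isPathConnected_pathHull hY p x).2.isConnected.isPreconnected.intermediate_value
    (left_mem_pathHull p x) (right_mem_pathHull p x)
    (continuous_setSize_pathHull hY p).continuousOn
  exact this (show (1 - (t : ℝ)) * setSize (pathHull p p) + t * setSize (pathHull p x) ∈ Icc _ _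
    from ⟨by nlinarith [t.2.1, t.2.2], by nlinarith [t.2.1, t.2.2]⟩)

/-- A path-connected, locally path-connected separable metric space without simple closed curves is
contractible. -/
theorem contractibleSpace_of_forall_not_isSimpleClosedCurve [PathConnectedSpace Y]
    [LocallyPathConnectedSpace Y] (hY : ∀ S : Set Y, ¬ IsSimpleClosedCurve S) :
    ContractibleSpace Y := by
  obtain ⟨p⟩ : Nonempty Y := PathConnectedSpace.nonempty
  set h : Y → ℝ := fun x => setSize (pathHull p x) with h_def
  have hh : Continuous h := continuous_setSize_pathHull hY p
  choose H hH hHh using fun tx : unitInterval × Y => exists_mem_pathHull_setSize_eq hY p tx.2 tx.1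
  have hHc : Continuous H := by
    rw [continuous_iff_continuousAt]
    intro tx O' hO'
    obtain ⟨O, hOO', hO, hzO⟩ := _root_.mem_nhds_iff.1 hO'
    have hK : IsCompact (pathHull p tx.2 \ O) :=
      (isCompact_isPathConnected_pathHull hY p tx.2).1.diff hO
    obtain ⟨η, hη, hη'⟩ : ∃ η > 0, ∀ y ∈ pathHull p tx.2 \ O, η < |h y - h (H tx)| := by
      rcases (pathHull p tx.2 \ O).eq_empty_or_nonempty with he | hne
      · exact ⟨1, one_pos, by simp [he]⟩
      · obtain ⟨y₀, hy₀, hmin⟩ := hK.exists_isMinOn hne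
          (f := fun y => |h y - h (H tx)|) (by fun_prop)
        have hpos : 0 < |h y₀ - h (H tx)| := by
          rw [abs_pos, sub_ne_zero]
          intro heq
          exact hy₀.2 (setSize_pathHull_injOn hY p tx.2 hy₀.1 (hH tx) heq ▸ hzO)
        exact ⟨_, half_pos hpos, fun y hy => (half_lt_self hpos).trans_le (hmin hy)⟩
    have hQ : IsOpen (O ∪ {y | η < |h y - h (H tx)|}) :=
      hO.union (isOpen_lt continuous_const (by fun_prop))
    have hIQ : pathHull p tx.2 ⊆ O ∪ {y | η < |h y - h (H tx)|} := fun y hy =>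
      or_iff_not_imp_left.2 fun hyO => hη' y ⟨hy, hyO⟩
    obtain ⟨C, ⟨hCx, hC⟩, hCQ⟩ := (path_connected_basis tx.2).mem_iff.1
      (hQ.mem_nhds (hIQ (right_mem_pathHull p tx.2)))
    have hhH : Continuous fun ty => h (H ty) := by
      simp only [h_def, hHh]
      exact ((continuous_const.sub (continuous_subtype_val.comp continuous_fst)).mul
        continuous_const).add ((continuous_subtype_val.comp continuous_fst).mul
          (hh.comp continuous_snd))
    have h1 : ∀ᶠ ty in 𝓝 tx, |h (H ty) - h (H tx)| < η := by
      have := (hhH.tendsto tx).eventually (ball_mem_nhds _ hη)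
      simpa [Real.dist_eq] using this
    have h2 : ∀ᶠ ty in 𝓝 tx, ty.2 ∈ C := continuous_snd.continuousAt.eventually hCx
    rw [mem_map]
    filter_upwards [h1, h2] with ty h1 h2
    refine hOO' ?_
    rcases union_subset hIQ hCQ
      (pathHull_subset_union hY hC (mem_of_mem_nhds hCx) h2 (hH ty)) with h3 | h3
    · exact h3
    · exact absurd h1 (not_lt.2 (le_of_lt h3))
  rw [contractible_iff_id_nullhomotopic]
  refine ⟨p, ContinuousMap.Homotopic.symm ⟨⟨⟨H, hHc⟩, fun x => ?_, fun x => ?_⟩⟩⟩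
  · refine setSize_pathHull_injOn hY p x (hH (0, x)) (left_mem_pathHull p x) ?_
    simpa using hHh (0, x)
  · refine setSize_pathHull_injOn hY p x (hH (1, x)) (right_mem_pathHull p x) ?_
    simpa using hHh (1, x)

end Contraction

section Loops

theorem IsSimpleClosedCurve.exists_eq_range {X : Type*} [TopologicalSpace X] {S : Set X}
    (hS : IsSimpleClosedCurve S) : ∃ e : AddCircle (1 : ℝ) → X, Continuous e ∧
      Function.Injective e ∧ range e = S := by
  obtain ⟨g⟩ := hS
  refine ⟨fun c => g.symm c, continuous_subtype_val.comp g.symm.continuous,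
    Subtype.val_injective.comp g.symm.injective, ?_⟩
  rw [range_comp' Subtype.val g.symm, g.symm.surjective.range_eq, image_univ, Subtype.range_coe]

theorem IsSimpleClosedCurve.preimage_val {X : Type*} [TopologicalSpace X] [T2Space X]
    {S N : Set X} (hS : IsSimpleClosedCurve S) (hSN : S ⊆ N) :
    IsSimpleClosedCurve (Subtype.val ⁻¹' S : Set N) := by
  obtain ⟨e, he, hei, rfl⟩ := hS.exists_eq_range
  have hN : ∀ c, e c ∈ N := fun c => hSN (mem_range_self c)
  have : (Subtype.val ⁻¹' range e : Set N) = range fun c => (⟨e c, hN c⟩ : N) := by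
    ext x
    simp [Subtype.ext_iff]
  rw [this]
  exact isSimpleClosedCurve_range (he.subtype_mk hN) fun c d h => hei (congrArg Subtype.val h)

theorem IsSimpleClosedCurve.image_val {X : Type*} [TopologicalSpace X] [T2Space X] {N : Set X}
    {S : Set N} (hS : IsSimpleClosedCurve S) : IsSimpleClosedCurve (Subtype.val '' S) := by
  obtain ⟨e, he, hei, rfl⟩ := hS.exists_eq_range
  rw [← range_comp]
  exact isSimpleClosedCurve_range (continuous_subtype_val.comp he)
    (Subtype.val_injective.comp hei)

theorem AddCircle.exists_int_of_coe_eq {a b : ℝ} (h : (a : AddCircle (1 : ℝ)) = b) :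
    ∃ n : ℤ, (n : ℝ) = a - b := by
  have : ((a - b : ℝ) : AddCircle (1 : ℝ)) = 0 := by rw [AddCircle.coe_sub, h, sub_self]
  simpa using (AddCircle.coe_eq_zero_iff (1 : ℝ)).1 this

/-- Two continuous real functions on a preconnected set that agree modulo `1` differ by a
constant. -/
theorem IsPreconnected.sub_eq_sub_of_coe_eq {X : Type*} [TopologicalSpace X] {s : Set X}
    (hs : IsPreconnected s) {f g : X → ℝ} (hf : ContinuousOn f s) (hg : ContinuousOn g s)
    (h : ∀ x ∈ s, (f x : AddCircle (1 : ℝ)) = g x) {x y : X} (hx : x ∈ s) (hy : y ∈ s) :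
    f x - g x = f y - g y := by
  refine hs.constant_of_mapsTo (T := range ((↑) : ℤ → ℝ)) ?_ (hf.sub hg)
    (fun z hz => AddCircle.exists_int_of_coe_eq (h z hz)) hx hy
  exact Int.isClosedEmbedding_coe_real.isEmbedding.isDiscrete_range

/-- A simply connected open set of a locally path-connected metric space contains no simple closed
curve through a point having a neighborhood without simple closed curves. -/
theorem not_isSimpleClosedCurve_of_simplyConnectedSpace {X : Type*} [MetricSpace X]
    [TopologicalSpace.SeparableSpace X] [LocallyPathConnectedSpace X] {U : Set X} (hU : IsOpen U)
    [SimplyConnectedSpace U] (hN : ∀ x ∈ U, ∃ N ∈ 𝓝 x, ∀ S ⊆ N, ¬ IsSimpleClosedCurve S)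
    {S : Set X} (hSU : S ⊆ U) : ¬ IsSimpleClosedCurve S := by
  intro hS
  obtain ⟨e, he, hei, rfl⟩ := hS.exists_eq_range
  have heU : ∀ c, e c ∈ U := fun c => hSU (mem_range_self c)
  have : LocallyPathConnectedSpace U := hU.isOpenEmbedding_subtypeVal.locallyPathConnectedSpace
  set q := e 0 with hq
  obtain ⟨N, hNq, hNS⟩ := hN q (heU 0)
  -- a path-connected neighborhood `W` of `q`, cut at `q`
  set W := pathComponentIn (interior N ∩ U) q
  have hWo : IsOpen W := (isOpen_interior.inter hU).pathComponentIn q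
  have hqO : q ∈ interior N ∩ U := ⟨mem_interior_iff_mem_nhds.2 hNq, heU 0⟩
  have hqW : q ∈ W := mem_pathComponentIn_self hqO
  have hWp : IsPathConnected W := isPathConnected_pathComponentIn hqO
  have hWN : W ⊆ N := fun x hx => interior_subset (pathComponentIn_subset hx).1
  have hWU : W ⊆ U := fun x hx => (pathComponentIn_subset hx).2
  have hec : Continuous fun t : ℝ => e t := he.comp (AddCircle.continuous_mk' 1)
  obtain ⟨η, hη, hη4, hηW⟩ : ∃ η > 0, η < 1 / 4 ∧ ∀ t ∈ Icc (-η) η, e (t : ℝ) ∈ W := by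
    have h0 : (fun t : ℝ => e t) ⁻¹' W ∈ 𝓝 (0 : ℝ) :=
      hec.continuousAt.preimage_mem_nhds (hWo.mem_nhds (by simpa using hqW))
    obtain ⟨r, hr, hrW⟩ := Metric.mem_nhds_iff.1 h0
    refine ⟨min r (1 / 4) / 2, by positivity, ?_, fun t ht => hrW ?_⟩
    · linarith [min_le_right r (1 / 4)]
    · rw [mem_ball, Real.dist_eq, sub_zero, abs_lt]
      have : 0 < min r (1 / 4) := by positivity
      constructor <;> linarith [min_le_left r (1 / 4), ht.1, ht.2]
  have heinj : ∀ s t : ℝ, |s - t| < 1 → e s = e t → s = t := by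
    intro s t hst h
    obtain ⟨n, hn⟩ := AddCircle.exists_int_of_coe_eq (hei h)
    rw [← hn, ← Int.cast_abs] at hst
    have : |n| < 1 := by exact_mod_cast hst
    rw [Int.abs_lt_one_iff.1 this] at hn
    simp only [Int.cast_zero] at hn
    linarith
  have heq : ∀ t : ℝ, |t| < 1 → t ≠ 0 → e t ≠ q := fun t ht ht0 h =>
    ht0 (heinj t 0 (by simpa using ht) (by simpa using h))
  have hqo : IsOpen ({q}ᶜ : Set X) := isOpen_compl_singleton
  set R := pathComponentIn (W ∩ {q}ᶜ) (e η) with hR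
  have hηR : e η ∈ W ∩ {q}ᶜ :=
    ⟨hηW η ⟨by linarith, le_rfl⟩, heq η (by rw [abs_lt]; constructor <;> linarith) hη.ne'⟩
  have hRo : IsOpen R := (hWo.inter hqo).pathComponentIn _
  have hRW : R ⊆ W ∩ {q}ᶜ := pathComponentIn_subset
  have hRc : IsOpen ((W ∩ {q}ᶜ) \ R) := by
    rw [isOpen_iff_mem_nhds]
    intro y hy
    refine mem_of_superset (((hWo.inter hqo).pathComponentIn y).mem_nhds
      (mem_pathComponentIn_self hy.1)) fun z hz => ⟨pathComponentIn_subset hz, fun hzR => hy.2 ?_⟩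
    rw [hR, ← pathComponentIn_congr hzR, pathComponentIn_congr hz]
    exact mem_pathComponentIn_self hy.1
  have hnR : e ((-η : ℝ) : AddCircle (1 : ℝ)) ∉ R := by
    intro h
    have := (isPathConnected_pathComponentIn hηR).image_arc_subset (D := N)
      (α := fun t : ℝ => e t) (a := -η) (b := η) hNS (fun x hx => hWN (hRW hx).1)
      hec.continuousOn (fun s hs t ht hst => heinj s t (by
        rw [abs_lt]; constructor <;> linarith [hs.1, hs.2, ht.1, ht.2]) hst)
      (fun t ht => hWN (hηW t ht)) h (mem_pathComponentIn_self hηR)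
    exact (hRW (this ⟨0, ⟨by linarith, hη.le⟩, by simp [hq]⟩)).2 rfl
  -- a circle-valued function winding once around `q` through `R`
  obtain ⟨r, hr, hrW⟩ := Metric.isOpen_iff.1 hWo q hqW
  set φ : X → ℝ := fun x => max 0 (1 - dist x q / r) with hφ
  have hφc : Continuous φ := by fun_prop
  have hφq : φ q = 1 := by simp [hφ]
  have hφW : ∀ x ∉ W, φ x = 0 := by
    intro x hx
    refine max_eq_left ?_
    have : r ≤ dist x q := not_lt.1 fun h => hx (hrW h)
    rw [sub_nonpos, le_div_iff₀ hr]
    linarith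
  set f₁ : X → ℝ := R.indicator φ with hf₁
  set f₂ : X → ℝ := R.indicator fun x => φ x - 1 with hf₂
  have hfR : ∀ x ∈ R, ∀ g : X → ℝ, Continuous g → ContinuousAt (R.indicator g) x :=
    fun x hx g hg => hg.continuousAt.congr <| by
      filter_upwards [hRo.mem_nhds hx] with y hy
      exact (indicator_of_mem hy g).symm
  have hfRc : ∀ x ∈ (W ∩ {q}ᶜ) \ R, ∀ g : X → ℝ, ContinuousAt (R.indicator g) x :=
    fun x hx g => (continuousAt_const (y := (0 : ℝ))).congr <| by
      filter_upwards [hRc.mem_nhds hx] with y hy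
      exact (indicator_of_notMem hy.2 g).symm
  have hf0 : ∀ x ∉ R, ∀ g : X → ℝ, Continuous g → g x = 0 → ContinuousAt (R.indicator g) x := by
    intro x hx g hg hgx
    rw [ContinuousAt, indicator_of_notMem hx]
    refine squeeze_zero_norm (norm_indicator_le_norm_self g) ?_
    simpa [hgx] using hg.norm.tendsto x
  have hf₁c : ∀ x ≠ q, ContinuousAt f₁ x := by
    intro x hxq
    by_cases hxR : x ∈ R
    · exact hfR x hxR _ hφc
    by_cases hxW : x ∈ W
    · exact hfRc x ⟨⟨hxW, hxq⟩, hxR⟩ _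
    · exact hf0 x hxR _ hφc (hφW x hxW)
  have hf₂c : ∀ x ∈ W, ContinuousAt f₂ x := by
    intro x hxW
    by_cases hxR : x ∈ R
    · exact hfR x hxR _ (hφc.sub continuous_const)
    rcases eq_or_ne x q with rfl | hxq
    · exact hf0 _ hxR _ (hφc.sub continuous_const) (by rw [hφq, sub_self])
    · exact hfRc x ⟨⟨hxW, hxq⟩, hxR⟩ _
  have hf₁₂ : ∀ x, (f₁ x : AddCircle (1 : ℝ)) = f₂ x := by
    intro x
    by_cases hxR : x ∈ R
    · simp [hf₁, hf₂, hxR, AddCircle.coe_period]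
    · simp [hf₁, hf₂, hxR]
  have hcoe : Continuous ((↑) : ℝ → AddCircle (1 : ℝ)) := AddCircle.continuous_mk' 1
  have hf : Continuous fun x => (f₁ x : AddCircle (1 : ℝ)) := by
    rw [continuous_iff_continuousAt]
    intro x
    rcases eq_or_ne x q with rfl | hxq
    · simp only [hf₁₂]
      exact hcoe.continuousAt.comp (hf₂c _ hqW)
    · exact hcoe.continuousAt.comp (hf₁c x hxq)
  obtain ⟨F, ⟨-, hF⟩, -⟩ := (AddCircle.isCoveringMap_coe (1 : ℝ)).existsUnique_continuousMap_lifts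
    ⟨fun x : U => (f₁ x : AddCircle (1 : ℝ)), hf.comp continuous_subtype_val⟩ ⟨q, heU 0⟩ (f₁ q) rfl
  have hF' : ∀ x : U, (F x : AddCircle (1 : ℝ)) = f₁ x := fun x => congrFun hF x
  have h1 := (isPreconnected_Ioo (a := (0 : ℝ)) (b := 1)).sub_eq_sub_of_coe_eq
    (f := fun t => F ⟨e t, heU t⟩) (g := fun t => f₁ (e t)) (x := η) (y := 1 - η)
    (F.continuous.comp (hec.subtype_mk _)).continuousOn
    (fun t ht => ((hf₁c _ (heq t (by rw [abs_lt]; constructor <;> linarith [ht.1, ht.2])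
      ht.1.ne')).comp (f := fun t : ℝ => e t) hec.continuousAt).continuousWithinAt)
    (fun t _ => hF' _) ⟨hη, by linarith⟩ ⟨by linarith, by linarith⟩
  have hcirc : ((1 - η : ℝ) : AddCircle (1 : ℝ)) = ((-η : ℝ) : AddCircle (1 : ℝ)) := by
    rw [AddCircle.coe_sub, AddCircle.coe_period, zero_sub, AddCircle.coe_neg]
  have hnW : e ((-η : ℝ) : AddCircle (1 : ℝ)) ∈ W := hηW _ ⟨le_rfl, by linarith⟩
  have : PreconnectedSpace W := isPreconnected_iff_preconnectedSpace.1 hWp.isConnected.isPreconnected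
  have h2 := (isPreconnected_univ (α := W)).sub_eq_sub_of_coe_eq
    (f := fun x => F ⟨x, hWU x.2⟩) (g := fun x => f₂ x) (x := ⟨e η, hηR.1⟩) (y := ⟨_, hnW⟩)
    (F.continuous.comp (continuous_subtype_val.subtype_mk _)).continuousOn
    (fun x _ => ((hf₂c x x.2).comp continuousAt_subtype_val).continuousWithinAt)
    (fun x _ => (hF' _).trans (hf₁₂ x)) (mem_univ _) (mem_univ _)
  have hηR' : e η ∈ R := mem_pathComponentIn_self hηR
  simp only [hcirc, hf₁, hf₂, indicator_of_mem hηR', indicator_of_notMem hnR] at h1 h2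
  linarith

end Loops

theorem LocallyPathConnectedSpace.of_isLocalDendrite {X : Type*} [TopologicalSpace X]
    (hX : IsLocalDendrite X) : LocallyPathConnectedSpace X :=
  LocallyPathConnectedSpace.of_nhds fun x => by
    obtain ⟨N, hN, ⟨-, hNc, -, hNm⟩, hNl, -⟩ := hX.2 x
    exact ⟨N, hN, LocallyPathConnectedSpace.of_compact_metrizable N⟩

/-- A nonempty connected open subset of a local dendrite is simply connected
iff it contains no simple closed curve. -/
theorem simplyConnected_iff_no_simpleClosedCurve
    {X : Type u} [TopologicalSpace X] (hX : IsLocalDendrite X)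
    (U : Set X) (hne : U.Nonempty) (hconn : IsConnected U) (hopen : IsOpen U) :
    SimplyConnectedSpace U ↔ ¬ ∃ S : Set X, S ⊆ U ∧ IsSimpleClosedCurve S := by
  have hlpc := LocallyPathConnectedSpace.of_isLocalDendrite hX
  obtain ⟨⟨-, hXc, -, hXm⟩, hXd⟩ := hX
  let _ : MetricSpace X := TopologicalSpace.metrizableSpaceMetric X
  constructor
  · rintro hU ⟨S, hSU, hS⟩
    refine not_isSimpleClosedCurve_of_simplyConnectedSpace hopen (fun x _ => ?_) hSU hS
    obtain ⟨N, hN, -, -, hNS⟩ := hXd x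
    exact ⟨N, hN, fun T hT hTc => hNS _ (hTc.preimage_val hT)⟩
  · intro hS
    have : LocallyPathConnectedSpace U :=
      hopen.isOpenEmbedding_subtypeVal.locallyPathConnectedSpace
    have : PathConnectedSpace U :=
      isPathConnected_iff_pathConnectedSpace.1 (hopen.isConnected_iff_isPathConnected.1 hconn)
    have := contractibleSpace_of_forall_not_isSimpleClosedCurve (Y := U)
      fun T hT => hS ⟨_, Subtype.coe_image_subset U T, hT.image_val⟩
    exact SimplyConnectedSpace.ofContractible U
end

section
/- A topological space X is a dendrite if and only if X is a simply connected local dendrite. -/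
open Topology

section LocallyConnected

open Set Filter

theorem exists_isOpen_isPreconnected_closure_subset {X : Type*} [MetricSpace X]
    [LocallyConnectedSpace X] {V : Set X} (hV : IsOpen V) {x : X} (hx : x ∈ V) {ε : ℝ}
    (hε : 0 < ε) :
    ∃ W : Set X, IsOpen W ∧ IsPreconnected W ∧ x ∈ W ∧ closure W ⊆ V ∧
      ∀ y ∈ W, ∀ z ∈ W, dist y z ≤ ε := by
  obtain ⟨r, hr, hrV⟩ := Metric.isOpen_iff.1 hV x hx
  set ρ := min (r / 2) (ε / 2) with hρ
  have hρ0 : 0 < ρ := lt_min (by linarith) (by linarith)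
  obtain ⟨W, hWb, hWo, hxW, hWc⟩ :=
    locallyConnectedSpace_iff_subsets_isOpen_isConnected.1 ‹_› x _ (Metric.ball_mem_nhds x hρ0)
  refine ⟨W, hWo, hWc.isPreconnected, hxW, ?_, fun y hy z hz => ?_⟩
  · refine (closure_mono hWb).trans (Metric.closure_ball_subset_closedBall.trans
      ((Metric.closedBall_subset_ball ?_).trans hrV))
    exact (min_le_left _ _).trans_lt (by linarith)
  · have h1 := Metric.mem_ball.1 (hWb hy)
    have h2 := Metric.mem_ball'.1 (hWb hz)
    have h3 : ρ ≤ ε / 2 := min_le_right _ _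
    linarith [dist_triangle y x z]

/-- In a locally connected metric space, any two points of a connected open set `V` are joined
by chains, of every sufficiently large length, of small connected open sets whose closures lie
in `V`. -/
theorem IsPreconnected.exists_chain {X : Type*} [MetricSpace X] [LocallyConnectedSpace X]
    {V : Set X} (hVc : IsPreconnected V) (hV : IsOpen V) {x y : X} (hx : x ∈ V) (hy : y ∈ V)
    {ε : ℝ} (hε : 0 < ε) :
    ∃ n₀ : ℕ, ∀ n ≥ n₀, ∃ (c : ℕ → X) (W : ℕ → Set X), c 0 = x ∧ c n = y ∧
      ∀ j < n, IsOpen (W j) ∧ IsPreconnected (W j) ∧ c j ∈ W j ∧ c (j + 1) ∈ W j ∧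
        closure (W j) ⊆ V ∧ ∀ u ∈ W j, ∀ v ∈ W j, dist u v ≤ ε := by
  set u : Set X := {y | y ∈ V ∧ ∃ n₀ : ℕ, ∀ n ≥ n₀, ∃ (c : ℕ → X) (W : ℕ → Set X), c 0 = x ∧
      c n = y ∧ ∀ j < n, IsOpen (W j) ∧ IsPreconnected (W j) ∧ c j ∈ W j ∧ c (j + 1) ∈ W j ∧
        closure (W j) ⊆ V ∧ ∀ u ∈ W j, ∀ v ∈ W j, dist u v ≤ ε} with hu
  have step : ∀ y ∈ u, ∀ W : Set X, IsOpen W → IsPreconnected W → closure W ⊆ V →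
      (∀ u ∈ W, ∀ v ∈ W, dist u v ≤ ε) → y ∈ W → W ⊆ u := by
    rintro y ⟨hyV, n₀, hn₀⟩ W hWo hWc hWV hWd hyW z hz
    refine ⟨hWV (subset_closure hz), n₀ + 1, fun n hn => ?_⟩
    obtain ⟨k, rfl⟩ : ∃ k, n = k + 1 := ⟨n - 1, by omega⟩
    obtain ⟨c, U, hc0, hck, hc⟩ := hn₀ k (by omega)
    refine ⟨fun j => if j ≤ k then c j else z, fun j => if j < k then U j else W, by simp [hc0],
      by simp, fun j hj => ?_⟩
    rcases Nat.lt_succ_iff_lt_or_eq.1 hj with h | rfl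
    · simpa [h, h.le, Nat.succ_le_of_lt h] using hc j h
    · simp only [le_refl, if_true, lt_irrefl, if_false, hck]
      exact ⟨hWo, hWc, hyW, by simpa using hz, hWV, hWd⟩
  have hxu : x ∈ u := by
    obtain ⟨W, h1, h2, h3, h4, h5⟩ := exists_isOpen_isPreconnected_closure_subset hV hx hε
    exact ⟨hx, 0, fun n _ => ⟨fun _ => x, fun _ => W, rfl, rfl, fun j _ => ⟨h1, h2, h3, h3, h4, h5⟩⟩⟩
  have huo : IsOpen u := by
    refine isOpen_iff_mem_nhds.2 fun y hy => ?_
    obtain ⟨W, h1, h2, h3, h4, h5⟩ := exists_isOpen_isPreconnected_closure_subset hV hy.1 hε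
    exact mem_of_superset (h1.mem_nhds h3) (step y hy W h1 h2 h4 h5 h3)
  refine (hVc.subset_of_closure_inter_subset huo ⟨x, hx, hxu⟩ ?_ hy).2
  rintro z ⟨hzc, hz⟩
  obtain ⟨W, h1, h2, h3, h4, h5⟩ := exists_isOpen_isPreconnected_closure_subset hV hz hε
  obtain ⟨y, hyW, hyu⟩ := mem_closure_iff.1 hzc W h1 h3
  exact step y hyu W h1 h2 h4 h5 hyW h3

/-- `IsOpenChain N p V` says that `V 0, …, V (N - 1)` are connected open sets linking the
consecutive points `p 0, …, p N`. -/
def IsOpenChain {X : Type*} [TopologicalSpace X] (N : ℕ) (p : ℕ → X) (V : ℕ → Set X) : Prop :=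
  0 < N ∧ ∀ i < N, IsOpen (V i) ∧ IsPreconnected (V i) ∧ p i ∈ V i ∧ p (i + 1) ∈ V i

theorem IsOpenChain.exists_refinement {X : Type*} [MetricSpace X] [LocallyConnectedSpace X]
    {N : ℕ} {p : ℕ → X} {V : ℕ → Set X} (h : IsOpenChain N p V) {ε : ℝ} (hε : 0 < ε) :
    ∃ (m : ℕ) (p' : ℕ → X) (V' : ℕ → Set X), 0 < m ∧ IsOpenChain (N * m) p' V' ∧
      p' 0 = p 0 ∧ p' (N * m) = p N ∧
      ∀ k < N * m, closure (V' k) ⊆ V (k / m) ∧ ∀ u ∈ V' k, ∀ v ∈ V' k, dist u v ≤ ε := by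
  have : Nonempty X := ⟨p 0⟩
  obtain ⟨hN, h⟩ := h
  have key := fun (i : ℕ) (hi : i < N) =>
    (h i hi).2.1.exists_chain (h i hi).1 (h i hi).2.2.1 (h i hi).2.2.2 hε
  choose! n hn using key
  set m := (Finset.range N).sup n + 1 with hm
  have hm0 : 0 < m := Nat.succ_pos _
  have key := fun (i : ℕ) (hi : i < N) => hn i hi m
    ((Finset.le_sup (f := n) (Finset.mem_range.2 hi)).trans (Nat.le_succ _))
  choose! c W hc0 hcm hc using key
  have hdiv : ∀ k < N * m, k / m < N := fun k hk => Nat.div_lt_of_lt_mul (by rwa [mul_comm])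
  have hNm : 0 < N * m := Nat.mul_pos hN hm0
  refine ⟨m, fun k => if k < N * m then c (k / m) (k % m) else p N,
    fun k => W (k / m) (k % m), hm0, ⟨hNm, fun k hk => ?_⟩, ?_, by simp, fun k hk => ?_⟩
  · obtain ⟨h1, h2, h3, h4, -, -⟩ := hc _ (hdiv k hk) _ (Nat.mod_lt k hm0)
    refine ⟨h1, h2, by simpa [hk] using h3, ?_⟩
    suffices hs : (if k + 1 < N * m then c ((k + 1) / m) ((k + 1) % m) else p N) =
        c (k / m) (k % m + 1) by simpa [hs] using h4
    have hk' := Nat.div_add_mod k m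
    have hkm := Nat.mod_lt k hm0
    set q := k / m
    set r := k % m
    have hq : q < N := hdiv k hk
    rcases Nat.lt_or_ge (r + 1) m with hr | hr
    · have e : k + 1 = m * q + (r + 1) := by omega
      have e1 : (k + 1) / m = q := by
        rw [e, Nat.mul_add_div hm0, Nat.div_eq_of_lt hr, add_zero]
      have e2 : (k + 1) % m = r + 1 := by rw [e, Nat.mul_add_mod, Nat.mod_eq_of_lt hr]
      have : k + 1 < N * m := by
        rw [mul_comm]
        exact (Nat.div_lt_iff_lt_mul hm0).1 (e1 ▸ hq) |>.trans_eq (mul_comm _ _)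
      rw [if_pos this, e1, e2]
    · have hr' : r + 1 = m := by omega
      have e : k + 1 = m * (q + 1) := by rw [mul_add, mul_one]; omega
      rw [hr', hcm q hq]
      split_ifs with hlt
      · have e1 : (k + 1) / m = q + 1 := by rw [e, Nat.mul_div_cancel_left _ hm0]
        have e2 : (k + 1) % m = 0 := by rw [e, Nat.mul_mod_right]
        rw [e1, e2, hc0 _ (e1 ▸ hdiv _ hlt)]
      · have : q + 1 = N := by
          refine le_antisymm hq (le_of_mul_le_mul_left (a := m) ?_ hm0)
          rw [← e, mul_comm]; omega
        rw [this]
  · simp only [hNm, if_true, Nat.zero_div, Nat.zero_mod]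
    exact hc0 0 hN
  · obtain ⟨-, -, -, -, h5, h6⟩ := hc _ (hdiv k hk) _ (Nat.mod_lt k hm0)
    exact ⟨h5, h6⟩

/-- The index of the interval of length `1 / N` containing `t ∈ [0, 1]`. -/
noncomputable def gridIndex (N : ℕ) (t : ℝ) : ℕ := min ⌊t * N⌋₊ (N - 1)

theorem gridIndex_lt {N : ℕ} (hN : 0 < N) (t : ℝ) : gridIndex N t < N :=
  (min_le_right _ _).trans_lt (by omega)

theorem gridIndex_mul_div {N m : ℕ} (hN : 0 < N) (hm : 0 < m) (t : ℝ) :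
    gridIndex (N * m) t / m = gridIndex N t := by
  have hmono : Monotone fun k : ℕ => k / m := fun a b hab => Nat.div_le_div_right hab
  have h1 := hmono.map_min (a := ⌊t * (N * m : ℕ)⌋₊) (b := N * m - 1)
  have h2 : ⌊t * (N * m : ℕ)⌋₊ / m = ⌊t * N⌋₊ := by
    rw [← Nat.floor_div_natCast]
    congr 1
    have : (m : ℝ) ≠ 0 := by positivity
    push_cast
    field_simp
  have h3 : (N * m - 1) / m = N - 1 := by
    obtain ⟨M, rfl⟩ : ∃ M, N = M + 1 := ⟨N - 1, by omega⟩
    have e : (M + 1) * m - 1 = m * M + (m - 1) := by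
      rw [add_mul, one_mul, mul_comm]; omega
    rw [e, Nat.mul_add_div hm, Nat.div_eq_of_lt (by omega)]; rfl
  simp only [h2, h3] at h1
  exact h1

theorem gridIndex_le_succ {N : ℕ} (hN : 0 < N) {s t : ℝ} (hs : 0 ≤ s) (hst : s ≤ t)
    (h : t < s + 1 / N) :
    gridIndex N t = gridIndex N s ∨ gridIndex N t = gridIndex N s + 1 := by
  have hN' : (0 : ℝ) < N := by exact_mod_cast hN
  have h1 : ⌊s * N⌋₊ ≤ ⌊t * N⌋₊ := Nat.floor_mono (by gcongr)
  have h2 : ⌊t * N⌋₊ ≤ ⌊s * N⌋₊ + 1 := by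
    rw [← Nat.floor_add_one (by positivity)]
    refine Nat.floor_mono ?_
    have := mul_le_mul_of_nonneg_right h.le hN'.le
    rw [add_mul, one_div_mul_cancel hN'.ne'] at this
    exact this
  unfold gridIndex
  omega

/-- In a complete locally connected metric space, connected open sets are path connected. -/
theorem IsPreconnected.joinedIn_of_isOpen {X : Type*} [MetricSpace X] [CompleteSpace X]
    [LocallyConnectedSpace X] {U : Set X} (hUc : IsPreconnected U) (hU : IsOpen U) {a b : X}
    (ha : a ∈ U) (hb : b ∈ U) : JoinedIn U a b := by
  let S := {s : ℕ × (ℕ → X) × (ℕ → Set X) // IsOpenChain s.1 s.2.1 s.2.2}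
  have hstep : ∀ (n : ℕ) (s : S), ∃ s' : S, ∃ m, 0 < m ∧ s'.1.1 = s.1.1 * m ∧
      s'.1.2.1 0 = s.1.2.1 0 ∧ s'.1.2.1 s'.1.1 = s.1.2.1 s.1.1 ∧
      ∀ k < s'.1.1, closure (s'.1.2.2 k) ⊆ s.1.2.2 (k / m) ∧
        ∀ u ∈ s'.1.2.2 k, ∀ v ∈ s'.1.2.2 k, dist u v ≤ (1 / 2 : ℝ) ^ n := by
    rintro n ⟨⟨N, p, V⟩, h⟩
    obtain ⟨m, p', V', h1, h2, h3, h4, h5⟩ :=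
      h.exists_refinement (ε := (1 / 2 : ℝ) ^ n) (by positivity)
    exact ⟨⟨⟨N * m, p', V'⟩, h2⟩, m, h1, rfl, h3, h4, h5⟩
  choose next m hm hN h0 h1 hV using hstep
  let s₀ : S := ⟨⟨1, fun i => if i = 0 then a else b, fun _ => U⟩, Nat.one_pos, fun i hi => by
    obtain rfl : i = 0 := by omega
    exact ⟨hU, hUc, by simpa using ha, by simpa using hb⟩⟩
  let s : ℕ → S := fun n => Nat.rec s₀ (fun n s => next n s) n
  have hs : ∀ n, s (n + 1) = next n (s n) := fun n => rfl
  set N : ℕ → ℕ := fun n => (s n).1.1 with hNdef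
  set p : ℕ → ℕ → X := fun n => (s n).1.2.1 with hpdef
  set V : ℕ → ℕ → Set X := fun n => (s n).1.2.2 with hVdef
  have hchain : ∀ n, IsOpenChain (N n) (p n) (V n) := fun n => (s n).2
  have hNpos : ∀ n, 0 < N n := fun n => (hchain n).1
  have hp0 : ∀ n, p n 0 = a := by
    intro n
    induction n with
    | zero => simp [hpdef, s, s₀]
    | succ n ih => rw [← ih]; exact h0 n (s n)
  have hpN : ∀ n, p n (N n) = b := by
    intro n
    induction n with
    | zero => simp [hpdef, hNdef, s, s₀]
    | succ n ih => rw [← ih]; exact h1 n (s n)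
  have hnest : ∀ n t, closure (V (n + 1) (gridIndex (N (n + 1)) t)) ⊆ V n (gridIndex (N n) t) := by
    intro n t
    have e : N (n + 1) = N n * m n (s n) := hN n (s n)
    have := (hV n (s n) _ (gridIndex_lt (hNpos (n + 1)) t)).1
    have e2 : gridIndex (N (n + 1)) t / m n (s n) = gridIndex (N n) t := by
      rw [e]; exact gridIndex_mul_div (hNpos n) (hm n (s n)) t
    rw [e2] at this
    exact this
  have hdiam : ∀ n, ∀ k < N (n + 1), ∀ u ∈ V (n + 1) k, ∀ v ∈ V (n + 1) k,
      dist u v ≤ (1 / 2 : ℝ) ^ n := fun n k hk => (hV n (s n) k hk).2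
  have hanti : ∀ t, Antitone fun n => V n (gridIndex (N n) t) := fun t =>
    antitone_nat_of_succ_le fun n => subset_closure.trans (hnest n t)
  have hmem : ∀ t n k, n ≤ k → p k (gridIndex (N k) t) ∈ V n (gridIndex (N n) t) := fun t n k hnk =>
    hanti t hnk ((hchain k).2 _ (gridIndex_lt (hNpos k) t)).2.2.1
  have hlim : ∀ t, ∃ x, Tendsto (fun n => p n (gridIndex (N n) t)) atTop (𝓝 x) := by
    intro t
    refine cauchySeq_tendsto_of_complete ((cauchySeq_shift 1).1 ?_)
    refine cauchySeq_of_le_tendsto_0' (fun n => (1 / 2 : ℝ) ^ n) (fun n k hnk => ?_)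
      (tendsto_pow_atTop_nhds_zero_of_lt_one (by norm_num) (by norm_num))
    exact hdiam n _ (gridIndex_lt (hNpos (n + 1)) t) _ (hmem t (n + 1) _ le_rfl) _
      (hmem t _ _ (Nat.succ_le_succ hnk))
  choose f hf using hlim
  have hfV : ∀ t n, f t ∈ V n (gridIndex (N n) t) := fun t n =>
    hnest n t (mem_closure_of_tendsto (hf t) ((eventually_ge_atTop (n + 1)).mono fun k hk =>
      hmem t _ _ hk))
  have hf0 : f 0 = a := by
    refine tendsto_nhds_unique (hf 0) ?_
    simp [gridIndex, hp0]
  have hf1 : f 1 = b := by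
    refine eq_of_forall_dist_le fun ε hε => ?_
    obtain ⟨n, hn⟩ := exists_pow_lt_of_lt_one hε (by norm_num : (1 / 2 : ℝ) < 1)
    refine le_trans (hdiam n _ (gridIndex_lt (hNpos (n + 1)) 1) _ (hfV 1 (n + 1)) _ ?_) hn.le
    have h2 := ((hchain (n + 1)).2 _ (gridIndex_lt (hNpos (n + 1)) 1)).2.2.2
    have e : gridIndex (N (n + 1)) 1 + 1 = N (n + 1) := by
      have := hNpos (n + 1)
      simp only [gridIndex, one_mul, Nat.floor_natCast]
      omega
    rw [e] at h2
    have h3 : p (n + 1) (N (n + 1)) = b := hpN (n + 1)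
    rw [← h3]
    exact h2
  have hclose : ∀ n, ∀ s t : ℝ, 0 ≤ s → s ≤ t → t < s + 1 / N (n + 1) →
      dist (f s) (f t) ≤ 2 * (1 / 2 : ℝ) ^ n := by
    intro n s t hs hst h
    have hks := gridIndex_lt (hNpos (n + 1)) s
    have hkt := gridIndex_lt (hNpos (n + 1)) t
    have hS := hfV s (n + 1)
    have hT := hfV t (n + 1)
    have hpow : (0 : ℝ) < (1 / 2 : ℝ) ^ n := by positivity
    rcases gridIndex_le_succ (hNpos (n + 1)) hs hst h with e | e
    · rw [e] at hT
      linarith [hdiam n _ hks _ hS _ hT]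
    · have h1 := ((hchain (n + 1)).2 _ hks).2.2.2
      have h2 := ((hchain (n + 1)).2 _ hkt).2.2.1
      rw [← e] at h1
      have d1 := hdiam n _ hks _ hS _ h1
      have d2 := hdiam n _ hkt _ h2 _ hT
      linarith [dist_triangle (f s) (p (n + 1) (gridIndex (N (n + 1)) t)) (f t)]
  have hcont : ContinuousOn f (Icc 0 1) := by
    refine Metric.continuousOn_iff.2 fun t ht ε hε => ?_
    obtain ⟨n, hn⟩ := exists_pow_lt_of_lt_one (half_pos hε) (by norm_num : (1 / 2 : ℝ) < 1)
    refine ⟨1 / N (n + 1), by have := hNpos (n + 1); positivity, fun s hs hst => ?_⟩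
    rw [Real.dist_eq, abs_lt] at hst
    rcases le_total s t with h | h
    · linarith [hclose n s t hs.1 h (by linarith)]
    · rw [dist_comm]; linarith [hclose n t s ht.1 h (by linarith)]
  refine JoinedIn.ofLine hcont hf0 hf1 ?_
  rintro _ ⟨t, -, rfl⟩
  exact hfV t 0

theorem locallyPathConnectedSpace_of_locallyConnectedSpace (X : Type*) [MetricSpace X]
    [CompleteSpace X] [LocallyConnectedSpace X] : LocallyPathConnectedSpace X :=
  LocallyPathConnectedSpace.of_bases
    (p := fun x s => IsOpen s ∧ x ∈ s ∧ IsConnected s) (s := fun _ => id)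
    (fun x => LocallyConnectedSpace.open_connected_basis x)
    (fun _ _ hs => isPathConnected_iff.2
      ⟨hs.2.2.nonempty, fun _ ha _ hb => hs.2.2.isPreconnected.joinedIn_of_isOpen hs.1 ha hb⟩)

end LocallyConnected

section Arcs

open Set Filter unitInterval

/-- A closed set `K` of parameters containing both endpoints such that `f` takes equal values
at the two ends of every gap of `K`. -/
def IsCollapsing {X : Type*} (f : I → X) (K : Set I) : Prop :=
  IsClosed K ∧ 0 ∈ K ∧ 1 ∈ K ∧ ∀ a ∈ K, ∀ b ∈ K, a < b → Disjoint (Ioo a b) K → f a = f b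

theorem IsCollapsing.sInter {X : Type*} [TopologicalSpace X] [T2Space X] {f : I → X}
    (hf : Continuous f) {c : Set (Set I)} (hc : ∀ K ∈ c, IsCollapsing f K)
    (hchain : IsChain (· ⊆ ·) c) (hne : c.Nonempty) : IsCollapsing f (⋂₀ c) := by
  refine ⟨isClosed_sInter fun K hK => (hc K hK).1, fun K hK => (hc K hK).2.1,
    fun K hK => (hc K hK).2.2.1, fun a ha b hb hab hd => ?_⟩
  by_contra hne'
  obtain ⟨U, V, hU, hV, haU, hbV, hUV⟩ := t2_separation hne'
  obtain ⟨u, hau, hu⟩ := exists_Ico_subset_of_mem_nhds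
    (hf.continuousAt.preimage_mem_nhds (hU.mem_nhds haU)) ⟨b, hab⟩
  obtain ⟨l, hlb, hl⟩ := exists_Ioc_subset_of_mem_nhds
    (hf.continuousAt.preimage_mem_nhds (hV.mem_nhds hbV)) ⟨a, hab⟩
  obtain ⟨m, ham, hmb⟩ := exists_between hab
  obtain ⟨a₁, ha₁, ha₁'⟩ := exists_between (lt_min hau ham)
  obtain ⟨b₁, hb₁', hb₁⟩ := exists_between (max_lt hlb hmb)
  have hab₁ : a₁ < b₁ :=
    (ha₁'.trans_le (min_le_right _ _)).trans ((le_max_right _ _).trans_lt hb₁')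
  have : Nonempty c := hne.to_subtype
  obtain ⟨⟨K, hK⟩, hKd⟩ := (isCompact_Icc (a := a₁) (b := b₁)).elim_directed_family_closed
    (fun K : c => (K : Set I)) (fun K => (hc K K.2).1)
    (by
      rw [← sInter_eq_iInter, ← disjoint_iff_inter_eq_empty]
      exact hd.mono_left (Icc_subset_Ioo ha₁ hb₁))
    (by
      intro K L
      rcases hchain.total K.2 L.2 with h | h
      · exact ⟨K, subset_rfl, h⟩
      · exact ⟨L, h, subset_rfl⟩)
  obtain ⟨hKc, -, -, hKgap⟩ := hc K hK
  obtain ⟨a₂, ⟨ha₂K, ha₂⟩, ha₂m⟩ :=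
    (hKc.inter isClosed_Iic).isCompact.exists_isGreatest (s := K ∩ Iic a₁) ⟨a, ha K hK, ha₁.le⟩
  obtain ⟨b₂, ⟨hb₂K, hb₂⟩, hb₂m⟩ :=
    (hKc.inter isClosed_Ici).isCompact.exists_isLeast (s := K ∩ Ici b₁) ⟨b, hb K hK, hb₁.le⟩
  have h1 : f a₂ ∈ U := hu ⟨ha₂m ⟨ha K hK, ha₁.le⟩,
    (mem_Iic.1 ha₂).trans_lt (ha₁'.trans_le (min_le_left _ _))⟩
  have h2 : f b₂ ∈ V := hl ⟨((le_max_left _ _).trans_lt hb₁').trans_le hb₂,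
    hb₂m ⟨hb K hK, hb₁.le⟩⟩
  have h3 : f a₂ = f b₂ := by
    refine hKgap a₂ ha₂K b₂ hb₂K ((mem_Iic.1 ha₂).trans_lt (hab₁.trans_le hb₂)) ?_
    refine disjoint_left.2 fun x hx hxK => ?_
    have hx1 : a₁ ≤ x := by
      by_contra! h
      exact hx.1.not_ge (ha₂m ⟨hxK, h.le⟩)
    have hx2 : x ≤ b₁ := by
      by_contra! h
      exact hx.2.not_ge (hb₂m ⟨hxK, h.le⟩)
    exact (hKd ▸ (⟨⟨hx1, hx2⟩, hxK⟩ : x ∈ Icc a₁ b₁ ∩ K) : x ∈ (∅ : Set I))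
  exact disjoint_left.1 hUV h1 (h3 ▸ h2)

theorem exists_isCollapsing_forall_disjoint {X : Type*} [TopologicalSpace X] [T2Space X]
    {f : I → X} (hf : Continuous f) :
    ∃ K, IsCollapsing f K ∧ ∀ a ∈ K, ∀ b ∈ K, a < b → f a = f b → Disjoint (Ioo a b) K := by
  obtain ⟨K, hK⟩ := zorn_superset {K | IsCollapsing f K} fun c hcS hc => by
    rcases c.eq_empty_or_nonempty with rfl | hne
    · refine ⟨univ, ⟨isClosed_univ, trivial, trivial, fun a _ b _ hab hd => ?_⟩, by simp⟩
      obtain ⟨m, hm⟩ := exists_between hab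
      exact (disjoint_left.1 hd hm trivial).elim
    · exact ⟨⋂₀ c, IsCollapsing.sInter hf hcS hc hne, fun s hs => sInter_subset_of_mem hs⟩
  obtain ⟨hKc, h0, h1, hgap⟩ := hK.prop
  refine ⟨K, hK.prop, fun a ha b hb hab hfab => ?_⟩
  have hmem : IsCollapsing f (K \ Ioo a b) := by
    refine ⟨hKc.sdiff isOpen_Ioo, ⟨h0, fun h => not_lt_bot h.1⟩, ⟨h1, fun h => not_top_lt h.2⟩, ?_⟩
    rintro c ⟨hcK, hc⟩ d ⟨hdK, hd⟩ hcd hdis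
    have hac : ¬ (c < a ∧ a < d) := fun h =>
      disjoint_left.1 hdis h ⟨ha, fun h => lt_irrefl _ h.1⟩
    have hbc : ¬ (c < b ∧ b < d) := fun h =>
      disjoint_left.1 hdis h ⟨hb, fun h => lt_irrefl _ h.2⟩
    rw [mem_Ioo] at hc hd
    by_cases hcase : c = a ∧ d = b
    · rw [hcase.1, hcase.2, hfab]
    · refine hgap c hcK d hdK hcd (disjoint_left.2 fun x hx hxK => ?_)
      refine disjoint_left.1 hdis hx ⟨hxK, fun hxab => ?_⟩
      have := hx.1
      have := hx.2
      have := hxab.1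
      have := hxab.2
      grind
  have := hK.le_of_le hmem sdiff_subset
  exact disjoint_left.2 fun x hx hxK => (this hxK).2 hx

/-- Every path can be replaced by one running in the same set whose fibres are order-convex. -/
theorem exists_path_ordConnected_fibers {X : Type*} [TopologicalSpace X] [T2Space X] {x y : X}
    (γ : Path x y) :
    ∃ δ : Path x y, range δ ⊆ range γ ∧ ∀ s t u : I, s ≤ t → t ≤ u → δ s = δ u → δ t = δ s := by
  obtain ⟨K, ⟨hKc, h0, h1, hgap⟩, hK⟩ := exists_isCollapsing_forall_disjoint γ.continuous
  have hlo : ∀ t : I, ∃ k, IsGreatest (K ∩ Iic t) k := fun t =>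
    (hKc.inter isClosed_Iic).isCompact.exists_isGreatest ⟨0, h0, bot_le (a := t)⟩
  have hhi : ∀ t : I, ∃ k, IsLeast (K ∩ Ici t) k := fun t =>
    (hKc.inter isClosed_Ici).isCompact.exists_isLeast ⟨1, h1, le_top (a := t)⟩
  choose lo hlo using hlo
  choose hi hhi using hhi
  have loK : ∀ t, lo t ∈ K := fun t => (hlo t).1.1
  have lo_le : ∀ t, lo t ≤ t := fun t => (hlo t).1.2
  have le_lo : ∀ t, ∀ k ∈ K, k ≤ t → k ≤ lo t := fun t k hk hkt => (hlo t).2 ⟨hk, hkt⟩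
  have hiK : ∀ t, hi t ∈ K := fun t => (hhi t).1.1
  have le_hi : ∀ t, t ≤ hi t := fun t => (hhi t).1.2
  have hi_le : ∀ t, ∀ k ∈ K, t ≤ k → hi t ≤ k := fun t k hk hkt => (hhi t).2 ⟨hk, hkt⟩
  have lo_mono : ∀ s t, s ≤ t → lo s ≤ lo t := fun s t hst =>
    le_lo t _ (loK s) ((lo_le s).trans hst)
  have lo_self : ∀ t ∈ K, lo t = t := fun t ht => (lo_le t).antisymm (le_lo t t ht le_rfl)
  have between : ∀ t, ∀ k ∈ K, lo t ≤ k → k ≤ hi t → k = lo t ∨ k = hi t := by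
    intro t k hk h1 h2
    rcases le_total k t with h | h
    · exact Or.inl ((le_lo t k hk h).antisymm h1)
    · exact Or.inr (h2.antisymm (hi_le t k hk h))
  have hlohi : ∀ t, γ (lo t) = γ (hi t) := by
    intro t
    rcases ((lo_le t).trans (le_hi t)).eq_or_lt with h | h
    · rw [h]
    · refine hgap _ (loK t) _ (hiK t) h (disjoint_left.2 fun k hk hkK => ?_)
      rcases between t k hkK hk.1.le hk.2.le with rfl | rfl
      · exact lt_irrefl _ hk.1
      · exact lt_irrefl _ hk.2
  have hcont : Continuous fun t => γ (lo t) := by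
    refine continuous_iff_continuousAt.2 fun t => ?_
    intro W hW
    obtain ⟨ε, hε, hεa⟩ := Metric.mem_nhds_iff.1 (γ.continuous.continuousAt.preimage_mem_nhds hW)
    obtain ⟨η, hη, hηb⟩ := Metric.mem_nhds_iff.1
      (γ.continuous.continuousAt.preimage_mem_nhds (hlohi t ▸ hW : W ∈ 𝓝 (γ (hi t))))
    refine mem_map.2 (Metric.mem_nhds_iff.2 ⟨min ε η, lt_min hε hη, fun s hs => ?_⟩)
    have hst : |(s : ℝ) - t| < min ε η := hs
    rw [abs_lt] at hst
    have hWa : γ (lo t) ∈ W := mem_of_mem_nhds hW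
    have hlt : (lo t : ℝ) ≤ t := lo_le t
    have hht : (t : ℝ) ≤ hi t := le_hi t
    rcases le_total t s with h | h
    · by_cases hcase : lo s ≤ hi t
      · change γ (lo s) ∈ W
        rcases between t _ (loK s) (lo_mono _ _ h) hcase with e | e
        · rwa [e]
        · rwa [e, ← hlohi]
      · refine hηb ?_
        have h1 : (hi t : ℝ) < lo s := not_le.1 hcase
        have h2 : (lo s : ℝ) ≤ s := lo_le s
        change |(lo s : ℝ) - hi t| < η
        rw [abs_lt]
        have := min_le_right ε η
        constructor <;> linarith
    · change γ (lo s) ∈ W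
      rw [hlohi]
      have hhh : hi s ≤ hi t := hi_le _ _ (hiK t) (h.trans (le_hi t))
      by_cases hcase : lo t ≤ hi s
      · rcases between t _ (hiK s) hcase hhh with e | e
        · rwa [e]
        · rwa [e, ← hlohi]
      · refine hεa ?_
        have h1 : (hi s : ℝ) < lo t := not_le.1 hcase
        have h2 : (s : ℝ) ≤ hi s := le_hi s
        change |(hi s : ℝ) - lo t| < ε
        rw [abs_lt]
        have := min_le_left ε η
        constructor <;> linarith
  refine ⟨⟨⟨_, hcont⟩, by simp [lo_self 0 h0], by simp [lo_self 1 h1]⟩, ?_, ?_⟩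
  · rintro _ ⟨t, rfl⟩
    exact mem_range_self _
  · intro s t u hst htu hsu
    change γ (lo s) = γ (lo u) at hsu
    change γ (lo t) = γ (lo s)
    rcases (lo_mono _ _ (hst.trans htu)).eq_or_lt with h | h
    · rw [(lo_mono _ _ hst).antisymm (h ▸ lo_mono _ _ htu)]
    · have hd := hK _ (loK s) _ (loK u) h hsu
      rcases (lo_mono _ _ hst).eq_or_lt with h1 | h1
      · rw [h1]
      rcases (lo_mono _ _ htu).eq_or_lt with h2 | h2
      · rw [h2, hsu]
      exact (disjoint_left.1 hd ⟨h1, h2⟩ (loK t)).elim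

/-- The largest distance from `δ q` to a point `δ u` with `q ≤ u ≤ s`; it is zero if `s ≤ q`. -/
noncomputable def excursion {X : Type*} [MetricSpace X] (δ : I → X) (q s : I) : ℝ :=
  sSup ((fun t : I => dist (δ q) (δ (max q (min t s)))) '' univ)

theorem continuous_excursion {X : Type*} [MetricSpace X] {δ : I → X} (hδ : Continuous δ) (q : I) :
    Continuous (excursion δ q) :=
  isCompact_univ.continuous_sSup (f := fun s t : I => dist (δ q) (δ (max q (min t s))))
    (by fun_prop)

theorem dist_le_excursion {X : Type*} [MetricSpace X] {δ : I → X} (hδ : Continuous δ)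
    {q u s : I} (hqu : q ≤ u) (hus : u ≤ s) : dist (δ q) (δ u) ≤ excursion δ q s := by
  refine le_csSup ?_ ⟨u, trivial, by simp [hus, hqu]⟩
  exact (isCompact_univ.image (by fun_prop)).bddAbove

theorem excursion_nonneg {X : Type*} [MetricSpace X] (δ : I → X) (q s : I) :
    0 ≤ excursion δ q s :=
  Real.sSup_nonneg (by rintro _ ⟨t, -, rfl⟩; exact dist_nonneg)

theorem excursion_le {X : Type*} [MetricSpace X] {δ : I → X} {q s : I} {C : ℝ} (hC : 0 ≤ C)
    (h : ∀ u, q ≤ u → u ≤ s → dist (δ q) (δ u) ≤ C) : excursion δ q s ≤ C := by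
  refine csSup_le (univ_nonempty.image _) ?_
  rintro _ ⟨t, -, rfl⟩
  rcases le_total q s with hqs | hsq
  · exact h _ (le_max_left _ _) (max_le hqs (min_le_right _ _))
  · simpa [max_eq_left ((min_le_right t s).trans hsq)] using hC

theorem excursion_eq_zero {X : Type*} [MetricSpace X] {δ : I → X} {q s : I} (h : s ≤ q) :
    excursion δ q s = 0 := by
  refine le_antisymm (excursion_le le_rfl fun u hqu hus => ?_) (excursion_nonneg δ q s)
  rw [hqu.antisymm (hus.trans h), dist_self]

theorem excursion_mono {X : Type*} [MetricSpace X] {δ : I → X} (hδ : Continuous δ) (q : I) :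
    Monotone (excursion δ q) := fun _ _ h =>
  excursion_le (excursion_nonneg δ q _) fun _ hqu hus => dist_le_excursion hδ hqu (hus.trans h)

/-- A path with order-convex fibres has the same fibres as a continuous monotone real function. -/
theorem exists_monotone_same_fibers {X : Type*} [MetricSpace X] {δ : I → X} (hδ : Continuous δ)
    (hfib : ∀ s t u : I, s ≤ t → t ≤ u → δ s = δ u → δ t = δ s) :
    ∃ φ : I → ℝ, Continuous φ ∧ Monotone φ ∧ φ 0 = 0 ∧ ∀ s t, φ s = φ t ↔ δ s = δ t := by
  obtain ⟨C, hC⟩ := (isCompact_range hδ).isBounded.subset_closedBall (δ 0)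
  have hdist : ∀ s t : I, dist (δ s) (δ t) ≤ C + C := fun s t =>
    (dist_triangle_right _ _ (δ 0)).trans (add_le_add (hC (mem_range_self s))
      (hC (mem_range_self t)))
  have hCC : 0 ≤ C + C := dist_nonneg.trans (hdist 0 0)
  set q := TopologicalSpace.denseSeq I with hq
  have hbound : ∀ n s, ‖(1 / 2 : ℝ) ^ n * excursion δ (q n) s‖ ≤ (1 / 2 : ℝ) ^ n * (C + C) := by
    intro n s
    rw [Real.norm_of_nonneg (mul_nonneg (by positivity) (excursion_nonneg _ _ _))]
    gcongr
    exact excursion_le hCC fun u _ _ => hdist _ _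
  have hsumC : Summable fun n : ℕ => (1 / 2 : ℝ) ^ n * (C + C) :=
    (summable_geometric_of_lt_one (by norm_num) (by norm_num)).mul_right _
  have hsum : ∀ s, Summable fun n => (1 / 2 : ℝ) ^ n * excursion δ (q n) s := fun s =>
    hsumC.of_norm_bounded fun n => hbound n s
  have hterm : ∀ n, Monotone fun s => (1 / 2 : ℝ) ^ n * excursion δ (q n) s := fun n s t h =>
    mul_le_mul_of_nonneg_left (excursion_mono hδ (q n) h) (by positivity)
  have hmono : Monotone fun s => ∑' n, (1 / 2 : ℝ) ^ n * excursion δ (q n) s := fun s t h =>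
    (hsum s).tsum_le_tsum (fun n => hterm n h) (hsum t)
  refine ⟨fun s => ∑' n, (1 / 2 : ℝ) ^ n * excursion δ (q n) s, ?_, hmono, ?_, ?_⟩
  · exact continuous_tsum (fun n => (continuous_excursion hδ (q n)).const_mul _) hsumC hbound
  · have : ∀ n, excursion δ (q n) 0 = 0 := fun n => excursion_eq_zero bot_le
    simp [this]
  · have key : ∀ s t : I, s ≤ t →
        ((∑' n, (1 / 2 : ℝ) ^ n * excursion δ (q n) s =
          ∑' n, (1 / 2 : ℝ) ^ n * excursion δ (q n) t) ↔ δ s = δ t) := by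
      intro s t hst
      constructor
      · intro h
        by_contra hne
        have hlt : s < t := hst.lt_of_ne fun h => hne (h ▸ rfl)
        obtain ⟨u, hsu, hu⟩ := exists_Ico_subset_of_mem_nhds
          (hδ.continuousAt.preimage_mem_nhds (isOpen_ne.mem_nhds hne)) ⟨t, hlt⟩
        obtain ⟨n, hn1, hn2⟩ := (TopologicalSpace.denseRange_denseSeq I).exists_mem_open
          isOpen_Ioo (nonempty_Ioo.2 (lt_min hsu hlt))
        have hne' : δ (q n) ≠ δ t := hu ⟨hn1.le, hn2.trans_le (min_le_left _ _)⟩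
        refine ((hsum s).tsum_lt_tsum (fun n => hterm n hst) (i := n) ?_ (hsum t)).ne h
        beta_reduce
        rw [excursion_eq_zero (hn1.le : s ≤ q n), mul_zero]
        exact mul_pos (by positivity) ((dist_pos.2 hne').trans_le
          (dist_le_excursion hδ (hn2.le.trans (min_le_right _ _)) le_rfl))
      · intro h
        congr 1
        ext n
        congr 1
        refine (excursion_mono hδ (q n) hst).antisymm
          (excursion_le (excursion_nonneg _ _ _) fun u hqu hut => ?_)
        rcases le_total u s with hus | hsu
        · exact dist_le_excursion hδ hqu hus
        · rw [hfib s u t hsu hut h]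
          rcases le_total (q n) s with hqs | hsq
          · exact dist_le_excursion hδ hqs le_rfl
          · rw [hfib s (q n) t hsq (hqu.trans hut) h, dist_self]
            exact excursion_nonneg _ _ _
    intro s t
    rcases le_total s t with h | h
    · exact key s t h
    · rw [eq_comm, key t s h, eq_comm]

/-- Two distinct points joined by a path in a metric space are joined by an injective path running
in the same set. -/
theorem Path.exists_injective {X : Type*} [MetricSpace X] {x y : X} (γ : Path x y) (hxy : x ≠ y) :
    ∃ α : Path x y, Function.Injective α ∧ range α ⊆ range γ := by
  obtain ⟨δ, hδγ, hfib⟩ := exists_path_ordConnected_fibers γ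
  obtain ⟨φ, hφ, hmono, hφ0, hφδ⟩ := exists_monotone_same_fibers δ.continuous hfib
  have hφ1 : 0 < φ 1 := by
    refine lt_of_le_of_ne (hφ0 ▸ hmono bot_le) fun h => hxy ?_
    have := (hφδ 0 1).1 (hφ0.trans h)
    simpa using this
  let Φ : I → I := fun s => ⟨φ s / φ 1, div_nonneg (hφ0 ▸ hmono bot_le) hφ1.le,
    (div_le_one hφ1).2 (hmono le_top)⟩
  have hΦ : Continuous Φ := (hφ.div_const _).subtype_mk _
  have hΦeq : ∀ s t, Φ s = Φ t ↔ δ s = δ t := fun s t => by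
    rw [← hφδ, Subtype.ext_iff]
    exact div_left_inj' hφ1.ne'
  have hΦ0 : Φ 0 = 0 := Subtype.ext (by simp [Φ, hφ0])
  have hΦ1 : Φ 1 = 1 := Subtype.ext (by simp [Φ, hφ1.ne'])
  have hsurj : Function.Surjective Φ := fun t => by
    have := intermediate_value_univ 0 1 hΦ
    rw [hΦ0, hΦ1] at this
    exact this ⟨bot_le, le_top⟩
  have hquot : IsQuotientMap Φ := hΦ.isClosedMap.isQuotientMap hΦ hsurj
  choose ρ hρ using hsurj
  have hδρ : ∀ s, δ (ρ (Φ s)) = δ s := fun s => (hΦeq _ _).1 (hρ _)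
  refine ⟨⟨⟨fun t => δ (ρ t), hquot.continuous_iff.2 ?_⟩, ?_, ?_⟩, ?_, ?_⟩
  · simpa [Function.comp_def, hδρ] using δ.continuous
  · simpa [hΦ0] using hδρ 0
  · simpa [hΦ1] using hδρ 1
  · intro s t h
    rw [← hρ s, ← hρ t]
    exact (hΦeq _ _).2 h
  · rintro _ ⟨t, rfl⟩
    exact hδγ (mem_range_self _)

end Arcs

section Circles

open Set unitInterval

theorem exists_isSimpleClosedCurve_of_injective {X : Type*} [TopologicalSpace X] [T2Space X]
    {c : AddCircle (1 : ℝ) → X} (hc : Continuous c) (hinj : Function.Injective c) :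
    IsSimpleClosedCurve (range c) :=
  ⟨(hc.isClosedEmbedding hinj).isEmbedding.toHomeomorph.symm⟩

theorem Path.extend_injOn {X : Type*} [TopologicalSpace X] {x y : X} {α : Path x y}
    (hα : Function.Injective α) {a b : ℝ} (ha : a ∈ Icc (0 : ℝ) 1) (hb : b ∈ Icc (0 : ℝ) 1)
    (h : α.extend a = α.extend b) : a = b := by
  rw [α.extend_apply ha, α.extend_apply hb] at h
  exact congrArg Subtype.val (hα h)

/-- Two arcs that meet only in their common endpoints form a simple closed curve. -/
theorem exists_isSimpleClosedCurve_of_arcs_s8 {X : Type*} [TopologicalSpace X] [T2Space X]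
    {x y : X} (α β : Path x y) (hα : Function.Injective α) (hβ : Function.Injective β)
    (hαβ : ∀ s t, α s = β t → α s = x ∨ α s = y) :
    ∃ S ⊆ range α ∪ range β, IsSimpleClosedCurve S := by
  let F : ℝ → X := fun a => if a ≤ 1 / 2 then α.extend (2 * a) else β.extend (2 - 2 * a)
  have hF : Continuous F := by
    refine Continuous.if_le (by fun_prop) (by fun_prop) continuous_id continuous_const ?_
    rintro a rfl
    norm_num
  have hF01 : F 0 = F 1 := by norm_num [F]
  have hlift : ∀ a ∈ Ico (0 : ℝ) 1, AddCircle.liftIco 1 0 F a = F a := fun a ha =>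
    AddCircle.liftIco_zero_coe_apply ha
  have hsurj : ∀ u : AddCircle (1 : ℝ), ∃ a ∈ Ico (0 : ℝ) 1, (a : AddCircle (1 : ℝ)) = u := by
    intro u
    have hu : u ∈ QuotientAddGroup.mk '' Ico (0 : ℝ) (0 + 1) := by
      rw [AddCircle.coe_image_Ico_eq]
      trivial
    simpa using hu
  have key : ∀ a ∈ Ico (0 : ℝ) 1, ∀ b ∈ Ico (0 : ℝ) 1, a ≤ b → F a = F b → a = b := by
    rintro a ⟨ha0, ha1⟩ b ⟨hb0, hb1⟩ hab h
    by_cases hb : b ≤ 1 / 2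
    · have ha : a ≤ 1 / 2 := hab.trans hb
      simp only [F, if_pos ha, if_pos hb] at h
      have := Path.extend_injOn hα ⟨by linarith, by linarith⟩ ⟨by linarith, by linarith⟩ h
      linarith
    by_cases ha : a ≤ 1 / 2
    · simp only [F, if_pos ha, if_neg hb] at h
      rw [not_le] at hb
      have hma : 2 * a ∈ Icc (0 : ℝ) 1 := ⟨by linarith, by linarith⟩
      have hmb : 2 - 2 * b ∈ Icc (0 : ℝ) 1 := ⟨by linarith, by linarith⟩
      have h' := h
      rw [α.extend_apply hma, β.extend_apply hmb] at h'
      rcases hαβ _ _ h' with h1 | h1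
      · rw [← α.extend_apply hma, h] at h1
        have := Path.extend_injOn hβ hmb (by simp) (h1.trans β.extend_zero.symm)
        linarith
      · rw [← α.extend_apply hma, h] at h1
        have := Path.extend_injOn hβ hmb (by simp) (h1.trans β.extend_one.symm)
        linarith
    · simp only [F, if_neg ha, if_neg hb] at h
      rw [not_le] at ha hb
      have := Path.extend_injOn hβ ⟨by linarith, by linarith⟩ ⟨by linarith, by linarith⟩ h
      linarith
  refine ⟨_, ?_, exists_isSimpleClosedCurve_of_injective
    (AddCircle.liftIco_zero_continuous hF01 hF.continuousOn) ?_⟩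
  · rintro _ ⟨u, rfl⟩
    obtain ⟨a, ha, rfl⟩ := hsurj u
    rw [hlift a ha]
    by_cases ha' : a ≤ 1 / 2
    · left
      rw [← α.extend_range]
      simp only [F, if_pos ha']
      exact mem_range_self _
    · right
      rw [← β.extend_range]
      simp only [F, if_neg ha']
      exact mem_range_self _
  · intro u v h
    obtain ⟨a, ha, rfl⟩ := hsurj u
    obtain ⟨b, hb, rfl⟩ := hsurj v
    rw [hlift a ha, hlift b hb] at h
    rcases le_total a b with hab | hab
    · rw [key a ha b hb hab h]
    · rw [key b hb a ha hab h.symm]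

theorem Path.injective_subpath {X : Type*} [TopologicalSpace X] {x y : X} {α : Path x y}
    (hα : Function.Injective α) {s t : I} (hst : s ≠ t) : Function.Injective (α.subpath s t) := by
  refine hα.comp fun a b h => ?_
  have h' := congrArg Subtype.val h
  simp only [Icc.coe_convexComb] at h'
  have hne : (t : ℝ) - s ≠ 0 := sub_ne_zero.2 fun h => hst (Subtype.ext h.symm)
  refine Subtype.ext (mul_left_cancel₀ hne ?_)
  linarith

/-- An arc and a path with the same endpoints contain a simple closed curve in their union,
provided that the path misses a point of the arc. -/
theorem exists_isSimpleClosedCurve_of_notMem_range {X : Type*} [MetricSpace X]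
    {x y : X} (α β : Path x y) (hα : Function.Injective α) {s₀ : I} (hs₀ : α s₀ ∉ range β) :
    ∃ S ⊆ range α ∪ range β, IsSimpleClosedCurve S := by
  have hxy : x ≠ y := by
    intro h
    have : (0 : I) = 1 := hα (by simp [h])
    exact zero_ne_one this
  obtain ⟨β', hβ', hβ'β⟩ := β.exists_injective hxy
  set T : Set I := α ⁻¹' range β' with hT
  have hTc : IsClosed T := (isCompact_range β'.continuous).isClosed.preimage α.continuous
  obtain ⟨s₁, ⟨hs₁T, hs₁⟩, hs₁max⟩ := (hTc.inter isClosed_Iic).isCompact.exists_isGreatest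
    (s := T ∩ Iic s₀) ⟨0, ⟨0, by simp⟩, mem_Iic.2 bot_le⟩
  obtain ⟨s₂, ⟨hs₂T, hs₂⟩, hs₂min⟩ := (hTc.inter isClosed_Ici).isCompact.exists_isLeast
    (s := T ∩ Ici s₀) ⟨1, ⟨1, by simp⟩, mem_Ici.2 le_top⟩
  have hs₀T : s₀ ∉ T := fun h => hs₀ (hβ'β h)
  have h12 : s₁ < s₂ := (lt_of_le_of_ne hs₁ fun h : s₁ = s₀ => hs₀T (h ▸ hs₁T)).trans_le hs₂
  obtain ⟨t₁, ht₁⟩ := hs₁T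
  obtain ⟨t₂, ht₂⟩ := hs₂T
  have ht : t₁ ≠ t₂ := by
    rintro rfl
    exact h12.ne (hα (ht₁.symm.trans ht₂))
  obtain ⟨S, hS, hSc⟩ := exists_isSimpleClosedCurve_of_arcs_s8 (α.subpath s₁ s₂)
    ((β'.subpath t₁ t₂).cast ht₁.symm ht₂.symm) (Path.injective_subpath hα h12.ne)
    (by simpa using Path.injective_subpath hβ' ht) (by
      intro s t h
      have hs : α.subpath s₁ s₂ s ∈ α '' Icc s₁ s₂ := by
        rw [← Path.range_subpath_of_le _ _ _ h12.le]
        exact mem_range_self _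
      obtain ⟨a, ha, hae⟩ := hs
      have haT : a ∈ T := by
        change α a ∈ range β'
        rw [hae, h]
        exact mem_range_self (f := β') _
      rw [← hae]
      rcases le_total a s₀ with has | has
      · left
        rw [le_antisymm (hs₁max ⟨haT, has⟩) ha.1]
      · right
        rw [le_antisymm ha.2 (hs₂min ⟨haT, has⟩)])
  refine ⟨S, hS.trans (union_subset_union ?_ ?_), hSc⟩
  · rw [Path.range_subpath]
    exact image_subset_range _ _
  · rw [Path.cast_coe, Path.range_subpath]
    exact (image_subset_range _ _).trans hβ'β

end Circles

section FirstPoint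

open Set unitInterval

/-- The point `z` of `D` is the first point of `D` on some path starting at `x`. -/
def IsFirstPoint {X : Type*} [TopologicalSpace X] (D : Set X) (x z : X) : Prop :=
  z ∈ D ∧ JoinedIn (insert z Dᶜ) x z

theorem IsFirstPoint.of_mem {X : Type*} [TopologicalSpace X] {D : Set X} {x : X} (hx : x ∈ D) :
    IsFirstPoint D x x :=
  ⟨hx, JoinedIn.refl (mem_insert _ _)⟩

theorem JoinedIn.exists_isFirstPoint {X : Type*} [TopologicalSpace X] {D K : Set X} {x y : X}
    (h : JoinedIn K x y) (hD : IsClosed D) (hy : y ∈ D) : ∃ z ∈ K, IsFirstPoint D x z := by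
  obtain ⟨γ, hγ⟩ := h
  obtain ⟨t, ht, hmin⟩ := (hD.preimage γ.continuous).isCompact.exists_isLeast ⟨1, by simpa using hy⟩
  refine ⟨γ t, hγ t, ht, (γ.subpath 0 t).cast γ.source.symm rfl, fun s => ?_⟩
  have hs : γ.subpath 0 t s ∈ γ '' Icc 0 t := by
    rw [← Path.range_subpath_of_le _ _ _ nonneg']
    exact mem_range_self _
  obtain ⟨a, ha, hae⟩ := hs
  rw [Path.cast_coe, ← hae]
  by_cases haD : γ a ∈ D
  · left
    rw [le_antisymm ha.2 (hmin haD)]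
  · exact Or.inr haD

theorem IsFirstPoint.eq {X : Type*} [MetricSpace X] (hX : ∀ S : Set X, ¬ IsSimpleClosedCurve S)
    {D : Set X} (hD : IsPathConnected D) {x z₁ z₂ : X} (h₁ : IsFirstPoint D x z₁)
    (h₂ : IsFirstPoint D x z₂) : z₁ = z₂ := by
  by_contra hne
  obtain ⟨hz₁, γ₁, hγ₁⟩ := h₁
  obtain ⟨hz₂, γ₂, hγ₂⟩ := h₂
  obtain ⟨α, hα, hαγ⟩ := (γ₁.symm.trans γ₂).exists_injective hne
  obtain ⟨β, hβ⟩ := hD.joinedIn z₁ hz₁ z₂ hz₂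
  let m : I := ⟨1 / 2, by norm_num, by norm_num⟩
  have h0 : α m ≠ z₁ := fun h => by
    have := congrArg Subtype.val (hα (h.trans α.source.symm))
    norm_num [m] at this
  have h1 : α m ≠ z₂ := fun h => by
    have := congrArg Subtype.val (hα (h.trans α.target.symm))
    norm_num [m] at this
  have hm : α m ∉ D := by
    have hmem := hαγ (mem_range_self m)
    rw [Path.trans_range, Path.symm_range] at hmem
    rcases hmem with ⟨t, ht⟩ | ⟨t, ht⟩
    · rcases hγ₁ t with h | h
      · exact absurd (ht.symm.trans h) h0
      · rwa [← ht]
    · rcases hγ₂ t with h | h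
      · exact absurd (ht.symm.trans h) h1
      · rwa [← ht]
  obtain ⟨S, -, hS⟩ := exists_isSimpleClosedCurve_of_notMem_range α β hα (s₀ := m) (by
    rintro ⟨t, ht⟩
    exact hm (ht ▸ hβ t))
  exact hX S hS

theorem exists_isFirstPoint {X : Type*} [TopologicalSpace X] [PathConnectedSpace X] {D : Set X}
    (hD : IsClosed D) (hne : D.Nonempty) (x : X) : ∃ z, IsFirstPoint D x z := by
  obtain ⟨y, hy⟩ := hne
  obtain ⟨z, -, hz⟩ :=
    (joinedIn_univ.2 (PathConnectedSpace.joined x y)).exists_isFirstPoint hD hy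
  exact ⟨z, hz⟩

open Classical in
/-- A chosen first point of `D` on a path starting at `x`. In a path connected space without
simple closed curves this is a retraction onto `D` whenever `D` is closed and path connected. -/
noncomputable def firstPoint {X : Type*} [TopologicalSpace X] (D : Set X) (x : X) : X :=
  if h : ∃ z, IsFirstPoint D x z then h.choose else x

theorem isFirstPoint_firstPoint {X : Type*} [TopologicalSpace X] [PathConnectedSpace X]
    {D : Set X} (hD : IsClosed D) (hne : D.Nonempty) (x : X) :
    IsFirstPoint D x (firstPoint D x) := by
  have h := exists_isFirstPoint hD hne x
  rw [firstPoint, dif_pos h]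
  exact h.choose_spec

theorem IsFirstPoint.firstPoint_eq {X : Type*} [MetricSpace X]
    (hX : ∀ S : Set X, ¬ IsSimpleClosedCurve S) {D : Set X} (hD : IsPathConnected D) {x z : X}
    (h : IsFirstPoint D x z) : firstPoint D x = z := by
  have h' : ∃ z, IsFirstPoint D x z := ⟨z, h⟩
  rw [firstPoint, dif_pos h']
  exact h'.choose_spec.eq hX hD h

theorem JoinedIn.firstPoint_eq_or_mem {X : Type*} [MetricSpace X] [PathConnectedSpace X]
    (hX : ∀ S : Set X, ¬ IsSimpleClosedCurve S) {D : Set X} (hD : IsPathConnected D)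
    (hDc : IsClosed D) {K : Set X} {x y : X} (h : JoinedIn K x y) :
    firstPoint D x = firstPoint D y ∨ firstPoint D x ∈ K ∧ firstPoint D y ∈ K := by
  by_cases hhit : ∃ w ∈ D, JoinedIn K x w
  · obtain ⟨w, hw, hxw⟩ := hhit
    obtain ⟨z, hzK, hz⟩ := hxw.exists_isFirstPoint hDc hw
    obtain ⟨z', hzK', hz'⟩ := (h.symm.trans hxw).exists_isFirstPoint hDc hw
    right
    rw [hz.firstPoint_eq hX hD, hz'.firstPoint_eq hX hD]
    exact ⟨hzK, hzK'⟩
  · left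
    have hy := isFirstPoint_firstPoint hDc hD.nonempty y
    obtain ⟨γ, hγ⟩ := h
    refine IsFirstPoint.firstPoint_eq hX hD ⟨hy.1, JoinedIn.trans ⟨γ, fun t => ?_⟩ hy.2⟩
    refine Or.inr fun ht => hhit ⟨γ t, ht, ?_⟩
    refine ⟨(γ.subpath 0 t).cast γ.source.symm rfl, fun s => ?_⟩
    exact hγ _

theorem firstPoint_firstPoint {X : Type*} [MetricSpace X] [PathConnectedSpace X]
    (hX : ∀ S : Set X, ¬ IsSimpleClosedCurve S) {D D' : Set X} (hD : IsPathConnected D)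
    (hDc : IsClosed D) (hDc' : IsClosed D') (hDD' : D ⊆ D') (x : X) :
    firstPoint D (firstPoint D' x) = firstPoint D x := by
  have h' := isFirstPoint_firstPoint hDc' (hD.nonempty.mono hDD') x
  have h := isFirstPoint_firstPoint hDc hD.nonempty (firstPoint D' x)
  refine (IsFirstPoint.firstPoint_eq hX hD ⟨h.1, JoinedIn.trans (h'.2.mono ?_) h.2⟩).symm
  exact insert_subset h.2.source_mem
    ((compl_subset_compl.2 hDD').trans (subset_insert _ _))

theorem Path.isPathConnected_image_Iic {X : Type*} [TopologicalSpace X] {x y : X} (γ : Path x y)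
    (t : I) : IsPathConnected (γ '' Iic t) := by
  refine ⟨γ 0, mem_image_of_mem _ (mem_Iic.2 bot_le), ?_⟩
  rintro _ ⟨s, hs, rfl⟩
  refine ⟨γ.subpath 0 s, fun u => ?_⟩
  have hu : γ.subpath 0 s u ∈ γ '' Icc 0 s := by
    rw [← Path.range_subpath_of_le _ _ _ nonneg']
    exact mem_range_self _
  exact image_mono (fun a ha => ha.2.trans hs) hu

theorem Path.isClosed_image_Iic {X : Type*} [TopologicalSpace X] [T2Space X] {x y : X}
    (γ : Path x y) (t : I) : IsClosed (γ '' Iic t) :=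
  (isClosed_Iic.isCompact.image γ.continuous).isClosed

theorem Path.firstPoint_image_Iic_eq_or_mem {X : Type*} [MetricSpace X] [PathConnectedSpace X]
    (hX : ∀ S : Set X, ¬ IsSimpleClosedCurve S) {p q : X} (γ : Path p q) {a b : I} (hab : a ≤ b)
    {U : Set X} (hU : IsPathConnected U) (hγU : ∀ s ∈ Icc a b, γ s ∈ U) (x : X) :
    firstPoint (γ '' Iic a) x = firstPoint (γ '' Iic b) x ∨
      firstPoint (γ '' Iic a) x ∈ U ∧ firstPoint (γ '' Iic b) x ∈ U := by
  have hpa := γ.isPathConnected_image_Iic a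
  have hca := γ.isClosed_image_Iic a
  have hcb := γ.isClosed_image_Iic b
  have hcomp := firstPoint_firstPoint hX hpa hca hcb (image_mono (Iic_subset_Iic.2 hab)) x
  rw [← hcomp]
  obtain ⟨s, hs, hsx⟩ := (isFirstPoint_firstPoint hcb (γ.isPathConnected_image_Iic b).nonempty x).1
  rw [← hsx]
  rcases le_total s a with hsa | hsa
  · left
    exact (IsFirstPoint.of_mem (mem_image_of_mem γ (mem_Iic.2 hsa))).firstPoint_eq hX hpa
  · right
    have hsU := hγU s ⟨hsa, hs⟩
    have haU := hγU a ⟨le_rfl, hab⟩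
    have hfa : firstPoint (γ '' Iic a) (γ a) = γ a :=
      (IsFirstPoint.of_mem (mem_image_of_mem _ self_mem_Iic)).firstPoint_eq hX hpa
    refine ⟨?_, hsU⟩
    rcases (hU.joinedIn _ hsU _ haU).firstPoint_eq_or_mem hX hpa hca with h | h
    · rwa [h, hfa]
    · exact h.1

theorem Path.continuous_firstPoint_image_Iic {X : Type*} [MetricSpace X] [PathConnectedSpace X]
    [LocallyPathConnectedSpace X] (hX : ∀ S : Set X, ¬ IsSimpleClosedCurve S) {p q : X}
    (γ : Path p q) : Continuous fun z : I × X => firstPoint (γ '' Iic z.1) z.2 := by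
  have hnhds : ∀ (x : X) {ε : ℝ}, 0 < ε → ∃ U ∈ 𝓝 x, IsPathConnected U ∧ U ⊆ Metric.ball x ε :=
    fun x ε hε => by
      obtain ⟨U, ⟨hU, hUp⟩, hUs⟩ :=
        (pathConnected_subset_basis Metric.isOpen_ball (Metric.mem_ball_self hε)).mem_iff.1
          (Metric.ball_mem_nhds x hε)
      exact ⟨U, hU, hUp.1, hUs⟩
  have hdist : ∀ {x y z : X} {ε : ℝ} {U : Set X}, 0 < ε → U ⊆ Metric.ball x ε →
      (y = z ∨ y ∈ U ∧ z ∈ U) → dist y z < ε + ε := by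
    rintro x y z ε U hε hU (rfl | ⟨hy, hz⟩)
    · simpa using hε
    · exact (dist_triangle_right y z x).trans_lt (add_lt_add (hU hy) (hU hz))
  refine continuous_iff_continuousAt.2 fun ⟨t₀, x₀⟩ => Metric.tendsto_nhds.2 fun ε hε => ?_
  obtain ⟨U, hU, hUp, hUs⟩ := hnhds x₀ (ε := ε / 4) (by positivity)
  obtain ⟨V, hV, hVp, hVs⟩ := hnhds (γ t₀) (ε := ε / 4) (by positivity)
  obtain ⟨δ, hδ, hδV⟩ := Metric.mem_nhds_iff.1 (γ.continuous.continuousAt hV)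
  rw [nhds_prod_eq]
  filter_upwards [Filter.prod_mem_prod (Metric.ball_mem_nhds t₀ hδ) hU]
  rintro ⟨t, x⟩ ⟨ht, hx⟩
  have h1 : dist (firstPoint (γ '' Iic t) x) (firstPoint (γ '' Iic t) x₀) < ε / 4 + ε / 4 :=
    hdist (by positivity) hUs ((hUp.joinedIn _ hx _ (mem_of_mem_nhds hU)).firstPoint_eq_or_mem hX
      (γ.isPathConnected_image_Iic t) (γ.isClosed_image_Iic t))
  have hicc : ∀ s ∈ uIcc t t₀, γ s ∈ V := fun s hs => by
    refine hδV ?_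
    have ht' : |(t : ℝ) - t₀| < δ := ht
    rw [abs_lt] at ht'
    change |(s : ℝ) - t₀| < δ
    rw [abs_lt]
    have hs' : (s : ℝ) ∈ uIcc (t : ℝ) t₀ := hs
    rw [mem_uIcc] at hs'
    constructor <;> rcases hs' with hs' | hs' <;> linarith [hs'.1, hs'.2]
  have h2 : dist (firstPoint (γ '' Iic t) x₀) (firstPoint (γ '' Iic t₀) x₀) < ε / 4 + ε / 4 := by
    rcases le_total t t₀ with h | h
    · rw [uIcc_of_le h] at hicc
      exact hdist (by positivity) hVs (γ.firstPoint_image_Iic_eq_or_mem hX h hVp hicc x₀)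
    · rw [uIcc_of_ge h] at hicc
      rw [dist_comm]
      exact hdist (by positivity) hVs (γ.firstPoint_image_Iic_eq_or_mem hX h hVp hicc x₀)
  linarith [dist_triangle (firstPoint (γ '' Iic t) x) (firstPoint (γ '' Iic t) x₀)
    (firstPoint (γ '' Iic t₀) x₀)]

theorem simplyConnectedSpace_of_forall_not_isSimpleClosedCurve {X : Type*} [MetricSpace X]
    [PathConnectedSpace X] [LocallyPathConnectedSpace X]
    (hX : ∀ S : Set X, ¬ IsSimpleClosedCurve S) : SimplyConnectedSpace X := by
  refine simply_connected_iff_loops_nullhomotopic.2 ⟨inferInstance, fun p γ => ?_⟩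
  have hmem : ∀ {t s : I}, s ≤ t → firstPoint (γ '' Iic t) (γ s) = γ s := fun {t s} hst =>
    (IsFirstPoint.of_mem (mem_image_of_mem γ (mem_Iic.2 hst))).firstPoint_eq hX (γ.isPathConnected_image_Iic t)
  refine Path.Homotopic.symm ⟨?_⟩
  refine
    { toFun := fun z => firstPoint (γ '' Iic z.1) (γ z.2)
      continuous_toFun := (γ.continuous_firstPoint_image_Iic hX).comp
        (continuous_fst.prodMk (γ.continuous.comp continuous_snd))
      map_zero_left := fun s => ?_
      map_one_left := fun s => hmem le_top
      prop' := fun t s hs => ?_ }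
  · obtain ⟨u, hu, hue⟩ := (isFirstPoint_firstPoint (γ.isClosed_image_Iic 0)
      (γ.isPathConnected_image_Iic 0).nonempty (γ s)).1
    have hu0 : u = 0 := le_antisymm hu bot_le
    rw [hu0, γ.source] at hue
    exact hue.symm
  · have h0 := hmem (t := t) (s := 0) bot_le
    rw [γ.source] at h0
    rcases hs with rfl | hs
    · simpa using h0
    · rw [mem_singleton_iff] at hs
      subst hs
      simpa using h0

end FirstPoint

section LocalDendrites

open Set unitInterval

theorem IsSimpleClosedCurve.exists_circle {X : Type*} [TopologicalSpace X] {S : Set X}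
    (hS : IsSimpleClosedCurve S) :
    ∃ c : AddCircle (1 : ℝ) → X, Continuous c ∧ Function.Injective c ∧ range c = S := by
  obtain ⟨e⟩ := hS
  refine ⟨fun u => (e.symm u : X), continuous_subtype_val.comp e.symm.continuous,
    Subtype.val_injective.comp e.symm.injective, ?_⟩
  change range (Subtype.val ∘ e.symm) = S
  rw [range_comp, e.symm.surjective.range_eq, image_univ, Subtype.range_coe]

theorem not_isSimpleClosedCurve_of_subset {X : Type*} [TopologicalSpace X] [T2Space X] {N S : Set X}
    (hN : ∀ S : Set N, ¬ IsSimpleClosedCurve S) (hSN : S ⊆ N) : ¬ IsSimpleClosedCurve S := by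
  intro hS
  obtain ⟨c, hc, hinj, hcS⟩ := hS.exists_circle
  have hcN : ∀ u, c u ∈ N := fun u => hSN (hcS ▸ mem_range_self u)
  exact hN _ (exists_isSimpleClosedCurve_of_injective (c := fun u => (⟨c u, hcN u⟩ : N))
    (hc.subtype_mk hcN) fun u v h => hinj (congrArg Subtype.val h))

theorem AddCircle.coe_one_injOn {a b : ℝ} (hab : |a - b| < 1)
    (h : (a : AddCircle (1 : ℝ)) = b) : a = b := by
  rw [← sub_eq_zero, ← AddCircle.coe_sub, AddCircle.coe_eq_zero_iff] at h
  obtain ⟨n, hn⟩ := h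
  rw [zsmul_eq_mul, mul_one] at hn
  rw [← hn, ← Int.cast_abs] at hab
  have hn0 : n = 0 := Int.abs_lt_one_iff.1 (by exact_mod_cast hab)
  rw [hn0, Int.cast_zero] at hn
  linarith

/-- If a simply connected, locally path connected space contains an embedded circle, then
some circle is contained in any given neighborhood of any point of that circle. -/
theorem exists_isSimpleClosedCurve_subset_of_mem_nhds {X : Type*} [MetricSpace X]
    [LocallyPathConnectedSpace X] [SimplyConnectedSpace X] {f : AddCircle (1 : ℝ) → X}
    (hf : Continuous f) (hinj : Function.Injective f) {O : Set X} (hO : IsOpen O)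
    (hfO : f 0 ∈ O) : ∃ S ⊆ O, IsSimpleClosedCurve S := by
  classical
  by_contra hno
  set φ : ℝ → X := fun s => f s with hφdef
  have hφ : Continuous φ := hf.comp (AddCircle.continuous_mk' 1)
  have hφinj : ∀ {a b : ℝ}, |a - b| < 1 → φ a = φ b → a = b := fun hab h =>
    AddCircle.coe_one_injOn hab (hinj h)
  have hφ0 : φ 0 = f 0 := rfl
  set p : X := f 0 with hp
  obtain ⟨δ, hδ, hδO⟩ := Metric.mem_nhds_iff.1 (hφ.continuousAt (x := 0) (hO.mem_nhds hfO))
  set ε : ℝ := min (δ / 2) (1 / 4) with hεdef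
  have hε : 0 < ε := lt_min (by positivity) (by norm_num)
  have hε4 : ε ≤ 1 / 4 := min_le_right _ _
  have hεO : ∀ s, |s| ≤ ε → φ s ∈ O := fun s hs => hδO (by
    rw [mem_ball_zero_iff, Real.norm_eq_abs]
    have : ε ≤ δ / 2 := min_le_left _ _
    linarith)
  set W : Set X := O \ {p} with hWdef
  have hW : IsOpen W := hO.sdiff isClosed_singleton
  have hφW : ∀ s, |s| ≤ ε → s ≠ 0 → φ s ∈ W := fun s hs hs0 =>
    ⟨hεO s hs, fun h => hs0 (hφinj (by rw [sub_zero]; linarith) h)⟩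
  set L : Set X := pathComponentIn W (φ ε) with hLdef
  have hL : IsOpen L := hW.pathComponentIn _
  have hright : ∀ s ∈ Ioc 0 ε, φ s ∈ L := by
    intro s hs
    have hpc := ((convex_Icc s ε).isPathConnected ⟨s, le_rfl, hs.2⟩).image hφ
    have hj := hpc.joinedIn _ (mem_image_of_mem φ (right_mem_Icc.2 hs.2)) _
      (mem_image_of_mem φ (left_mem_Icc.2 hs.2))
    refine hj.mono ?_
    rintro _ ⟨a, ha, rfl⟩
    have ha0 : 0 < a := hs.1.trans_le ha.1
    exact hφW a (by rw [abs_of_pos ha0]; exact ha.2) ha0.ne'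
  have hleft : ∀ s ∈ Ico (-ε) 0, φ s ∉ L := by
    rintro s hs ⟨β, hβ⟩
    have hlt : 0 < ε - s := by linarith [hs.2]
    let α : Path (φ ε) (φ s) :=
      { toFun := fun u => φ (ε + u * (s - ε))
        continuous_toFun := by fun_prop
        source' := by simp
        target' := by simp }
    have habs : ∀ u v : I, |(u : ℝ) - v| ≤ 1 := fun u v =>
      abs_sub_le_iff.2 ⟨by linarith [u.2.2, v.2.1], by linarith [v.2.2, u.2.1]⟩
    have hα : Function.Injective α := by
      intro u v huv
      have h1 := hφinj (by
        rw [add_sub_add_left_eq_sub, ← sub_mul, abs_mul, abs_of_neg (by linarith : s - ε < 0)]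
        have := mul_le_mul_of_nonneg_right (habs u v) (by linarith : 0 ≤ -(s - ε))
        linarith [hs.1]) huv
      exact Subtype.ext (mul_right_cancel₀ (by linarith : s - ε ≠ 0) (add_left_cancel h1))
    let s₀ : I := ⟨ε / (ε - s), by positivity, (div_le_one hlt).2 (by linarith [hs.2])⟩
    have hs₀ : α s₀ = p := by
      change φ (ε + ε / (ε - s) * (s - ε)) = p
      rw [← hφ0]
      congr 1
      field_simp
      ring
    obtain ⟨S, hS, hSc⟩ := exists_isSimpleClosedCurve_of_notMem_range α β hα (s₀ := s₀) (by
      rintro ⟨t, ht⟩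
      exact (hβ t).2 (ht.trans hs₀))
    refine hno ⟨S, hS.trans (union_subset ?_ ?_), hSc⟩
    · rintro _ ⟨u, rfl⟩
      refine hεO _ (abs_le.2 ⟨?_, ?_⟩)
      · nlinarith [u.2.1, u.2.2, hs.1]
      · nlinarith [u.2.1, u.2.2, hs.1]
    · rintro _ ⟨t, rfl⟩
      exact (hβ t).1
  have hfront : frontier L ⊆ {p} ∪ Oᶜ := by
    intro x hx
    by_contra hxW
    have hxW' : x ∈ W := by
      simp only [mem_union, mem_compl_iff, not_or, not_not] at hxW
      exact ⟨hxW.2, hxW.1⟩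
    have hnhds : pathComponentIn W x ∈ 𝓝 x :=
      (hW.pathComponentIn x).mem_nhds (mem_pathComponentIn_self hxW')
    obtain ⟨y, hy, hyL⟩ := mem_closure_iff_nhds.1 (frontier_subset_closure hx) _ hnhds
    have hxL : x ∈ L := JoinedIn.trans hyL (JoinedIn.symm hy)
    rw [hL.frontier_eq] at hx
    exact hx.2 hxL
  obtain ⟨u, hu0, hu1, -⟩ := exists_continuous_zero_one_of_isClosed hO.isClosed_compl
    (isClosed_singleton (x := p)) (disjoint_singleton_right.2 fun h => h hfO)
  have hup : u p = 1 := hu1 rfl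
  set g : X → ℝ := L.piecewise u 0 with hg
  let G : X → AddCircle (1 : ℝ) := L.piecewise (fun x => (u x : AddCircle (1 : ℝ))) 0
  have hGg : ∀ x, G x = (g x : AddCircle (1 : ℝ)) := fun x => by
    by_cases hx : x ∈ L <;> simp [G, g, hx]
  have hG : Continuous G := by
    refine Continuous.piecewise (fun x hx => ?_)
      ((AddCircle.continuous_mk' 1).comp u.continuous) continuous_const
    rcases hfront hx with h | h
    · rw [mem_singleton_iff.1 h, hup]
      exact AddCircle.coe_period 1
    · simp [hu0 h]
  have hgc : ContinuousOn g {p}ᶜ := by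
    refine ContinuousOn.piecewise (fun x hx => ?_) u.continuous.continuousOn continuousOn_const
    rcases hfront hx.2 with h | h
    · exact absurd h hx.1
    · exact hu0 h
  obtain ⟨e₀, he₀⟩ := QuotientAddGroup.mk_surjective (G p)
  obtain ⟨h, ⟨-, hh⟩, -⟩ := (AddCircle.isCoveringMap_coe (1 : ℝ)).existsUnique_continuousMap_lifts
    (⟨G, hG⟩ : C(X, AddCircle (1 : ℝ))) p e₀ he₀
  have hh' : ∀ x, (h x : AddCircle (1 : ℝ)) = (g x : AddCircle (1 : ℝ)) := fun x => by
    rw [← hGg]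
    exact congrFun hh x
  have hmaps : MapsTo (fun θ => h (φ θ) - g (φ θ)) (Ioo 0 1)
      (AddSubgroup.zmultiples (1 : ℝ) : Set ℝ) := fun θ _ =>
    QuotientAddGroup.eq_iff_sub_mem.1 (hh' (φ θ))
  have hcont : ContinuousOn (fun θ => h (φ θ) - g (φ θ)) (Ioo 0 1) := by
    refine (h.continuous.comp hφ).continuousOn.sub (hgc.comp hφ.continuousOn fun θ hθ hθp => ?_)
    have := hφinj (a := θ) (b := 0) (by rw [sub_zero, abs_of_pos hθ.1]; exact hθ.2) hθp
    exact hθ.1.ne' this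
  have hconst : ∀ θ ∈ Ioo (0 : ℝ) 1, h (φ θ) - g (φ θ) = h (φ ε) - g (φ ε) := fun θ hθ =>
    isPreconnected_Ioo.constant_of_mapsTo
      ⟨inferInstanceAs (DiscreteTopology (AddSubgroup.zmultiples (1 : ℝ)))⟩ hcont hmaps hθ ⟨hε, by linarith⟩
  have hlim0 : h (φ 0) - u (φ 0) = h (φ ε) - g (φ ε) := by
    have ht : Filter.Tendsto (fun θ => h (φ θ) - u (φ θ)) (𝓝[>] 0) (𝓝 (h (φ 0) - u (φ 0))) :=
      (((h.continuous.comp hφ).sub (u.continuous.comp hφ)).tendsto 0).mono_left nhdsWithin_le_nhds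
    refine tendsto_nhds_unique ht (tendsto_const_nhds.congr' ?_)
    filter_upwards [Ioc_mem_nhdsGT hε] with θ hθ
    rw [← hconst θ ⟨hθ.1, by linarith [hθ.2]⟩, hg, piecewise_eq_of_mem _ _ _ (hright θ hθ)]
  have hlim1 : h (φ 0) = h (φ ε) - g (φ ε) := by
    have ht : Filter.Tendsto (fun θ => h (φ θ)) (𝓝[<] 0) (𝓝 (h (φ 0))) :=
      ((h.continuous.comp hφ).tendsto 0).mono_left nhdsWithin_le_nhds
    refine tendsto_nhds_unique ht (tendsto_const_nhds.congr' ?_)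
    filter_upwards [Ico_mem_nhdsLT (neg_lt_zero.2 hε)] with θ hθ
    have hθφ : φ (θ + 1) = φ θ := by
      change f ((θ + 1 : ℝ) : AddCircle (1 : ℝ)) = f θ
      rw [AddCircle.coe_add, AddCircle.coe_period, add_zero]
    rw [← hconst (θ + 1) ⟨by linarith [hθ.1], by linarith [hθ.2]⟩, hθφ, hg,
      piecewise_eq_of_notMem _ _ _ (hleft θ hθ)]
    simp
  rw [hφ0, hup] at hlim0
  rw [hφ0] at hlim1
  linarith

theorem IsDendrite.locallyPathConnectedSpace {X : Type*} [TopologicalSpace X] (h : IsDendrite X) :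
    LocallyPathConnectedSpace X := by
  obtain ⟨⟨-, _, -, _⟩, _, -⟩ := h
  let := TopologicalSpace.metrizableSpaceMetric X
  exact locallyPathConnectedSpace_of_locallyConnectedSpace X

theorem IsDendrite.simplyConnectedSpace {X : Type*} [TopologicalSpace X] (h : IsDendrite X) :
    SimplyConnectedSpace X := by
  have := h.locallyPathConnectedSpace
  obtain ⟨⟨-, -, _, _⟩, -, hX⟩ := h
  let := TopologicalSpace.metrizableSpaceMetric X
  have : PathConnectedSpace X := PathConnectedSpace.of_locallyPathConnectedSpace
  exact simplyConnectedSpace_of_forall_not_isSimpleClosedCurve hX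

theorem IsDendrite.isLocalDendrite {X : Type*} [TopologicalSpace X] (h : IsDendrite X) :
    IsLocalDendrite X := by
  refine ⟨h.1, fun x => ⟨univ, Filter.univ_mem, ?_⟩⟩
  obtain ⟨⟨_, _, _, _⟩, _, hX⟩ := h
  have e : (univ : Set X) ≃ₜ X := Homeomorph.Set.univ X
  refine ⟨⟨⟨e.symm (Classical.arbitrary X)⟩, isCompact_iff_compactSpace.1 isCompact_univ,
    isConnected_iff_connectedSpace.1 isConnected_univ, inferInstance⟩,
    e.locallyConnectedSpace, fun S hS => ?_⟩
  obtain ⟨c, hc, hinj, -⟩ := hS.exists_circle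
  exact hX _ (exists_isSimpleClosedCurve_of_injective (e.continuous.comp hc)
    (e.injective.comp hinj))

theorem IsLocalDendrite.locallyPathConnectedSpace {X : Type*} [TopologicalSpace X]
    (h : IsLocalDendrite X) : LocallyPathConnectedSpace X := by
  refine ⟨fun x => Filter.hasBasis_self.2 fun V hV => ?_⟩
  obtain ⟨N, hN, hNd⟩ := h.2 x
  have := hNd.locallyPathConnectedSpace
  let x' : N := ⟨x, mem_of_mem_nhds hN⟩
  obtain ⟨U, ⟨hU, hUp⟩, hUV⟩ := (path_connected_basis x').mem_iff.1
    (continuousAt_subtype_val (x := x') hV)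
  refine ⟨Subtype.val '' U, ?_, hUp.image continuous_subtype_val, image_subset_iff.2 hUV⟩
  rw [← map_nhds_subtype_coe_eq_nhds (mem_of_mem_nhds hN) hN]
  exact Filter.image_mem_map hU

theorem IsLocalDendrite.isDendrite {X : Type*} [TopologicalSpace X] (h : IsLocalDendrite X)
    [SimplyConnectedSpace X] : IsDendrite X := by
  have := h.locallyPathConnectedSpace
  refine ⟨h.1, inferInstance, fun S hS => ?_⟩
  obtain ⟨⟨-, -, -, _⟩, hloc⟩ := h
  let := TopologicalSpace.metrizableSpaceMetric X
  obtain ⟨f, hf, hinj, -⟩ := hS.exists_circle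
  obtain ⟨N, hN, -, -, hNd⟩ := hloc (f 0)
  obtain ⟨S', hS'N, hS'⟩ := exists_isSimpleClosedCurve_subset_of_mem_nhds hf hinj isOpen_interior
    (mem_interior_iff_mem_nhds.2 hN)
  exact not_isSimpleClosedCurve_of_subset hNd (hS'N.trans interior_subset) hS'

end LocalDendrites

/-- A topological space is a dendrite iff it is a simply connected
local dendrite. -/
theorem isDendrite_iff_simplyConnected_isLocalDendrite
    {X : Type u} [TopologicalSpace X] :
    IsDendrite X ↔ (IsLocalDendrite X ∧ SimplyConnectedSpace X) := by
  exact ⟨fun h => ⟨h.isLocalDendrite, h.simplyConnectedSpace⟩, fun ⟨h, _⟩ => h.isDendrite⟩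
end
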